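/- arXiv:2511.21144 — 3 statements merged into one kernel-verified Lean document; each statement's English description precedes it below -/
import Mathlib

section
/- For every integer d ≥ 9, the number of isomorphism classes of (3;4,d)-cages equals: 1 if d ≡ 1 (mod 4); 4 if d ≡ 2 (mod 4); 17 + ⌊d/8⌋ if d ≡ 3 (mod 4); and 27 + d + ⌊(d−4)/8⌋ if d ≡ 0 (mod 4). -/
/-- A graph is `k`-regular: every vertex has exactly `k` neighbours. -/
def IsRegular' (k : ℕ) {V : Type*} (G : SimpleGraph V) : Prop :=
  ∀ v : V, (G.neighborSet v).ncard = k

/-- A `(k; g, d)`-graph: a `k`-regular simple graph of girth exactly `g` and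
diameter exactly `d`. -/
def IsKGDGraph (k g d : ℕ) {V : Type*} (G : SimpleGraph V) : Prop :=
  IsRegular' k G ∧ G.egirth = g ∧ G.ediam = d

/-- `n(k; g, d)`: the minimum order of a `(k; g, d)`-graph. -/
noncomputable def minOrderKGD (k g d : ℕ) : ℕ :=
  sInf {n : ℕ | ∃ G : SimpleGraph (Fin n), IsKGDGraph k g d G}

/-- The number of isomorphism classes of `(k; g, d)`-cages, i.e. of `(k; g, d)`-graphs
with the minimum possible number `n(k; g, d)` of vertices. -/
noncomputable def numCages (k g d : ℕ) : ℕ :=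
  Nat.card (Quot (fun G H : {G : SimpleGraph (Fin (minOrderKGD k g d)) // IsKGDGraph k g d G} =>
    Nonempty (G.1 ≃g H.1)))

namespace CubicChain

/-! ### Rooted graphs and gluing along a bridge -/

/-- A graph with a distinguished vertex. -/
structure RGraph where
  V : Type
  G : SimpleGraph V
  root : V

/-- Isomorphism of rooted graphs. -/
def RGraph.Iso (R S : RGraph) : Prop := ∃ φ : R.G ≃g S.G, φ R.root = S.root

theorem RGraph.Iso.symm {R S : RGraph} : R.Iso S → S.Iso R := by
  rintro ⟨φ, h⟩
  exact ⟨φ.symm, by rw [← h]; exact φ.symm_apply_apply _⟩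

theorem RGraph.Iso.trans {R S T : RGraph} : R.Iso S → S.Iso T → R.Iso T := by
  rintro ⟨φ, hφ⟩ ⟨ψ, hψ⟩
  exact ⟨φ.trans ψ, by simp [hφ, hψ]⟩

/-- The disjoint union of two graphs together with one extra edge. -/
def joinAt {V W : Type*} (G : SimpleGraph V) (a : V) (H : SimpleGraph W) (b : W) :
    SimpleGraph (V ⊕ W) where
  Adj
    | .inl x, .inl y => G.Adj x y
    | .inr x, .inr y => H.Adj x y
    | .inl x, .inr y => x = a ∧ y = b
    | .inr y, .inl x => x = a ∧ y = b
  symm := ⟨by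
    rintro (x | x) (y | y) h
    exacts [G.adj_symm h, h, h, H.adj_symm h]⟩
  loopless := ⟨by
    rintro (x | x) h
    exacts [G.loopless.irrefl x h, H.loopless.irrefl x h]⟩

section joinAt
variable {V W : Type*} {G : SimpleGraph V} {a : V} {H : SimpleGraph W} {b : W}

@[simp] theorem joinAt_inl_inl {x y : V} :
    (joinAt G a H b).Adj (.inl x) (.inl y) ↔ G.Adj x y := Iff.rfl
@[simp] theorem joinAt_inr_inr {x y : W} :
    (joinAt G a H b).Adj (.inr x) (.inr y) ↔ H.Adj x y := Iff.rfl
@[simp] theorem joinAt_inl_inr {x : V} {y : W} :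
    (joinAt G a H b).Adj (.inl x) (.inr y) ↔ x = a ∧ y = b := Iff.rfl
@[simp] theorem joinAt_inr_inl {x : V} {y : W} :
    (joinAt G a H b).Adj (.inr y) (.inl x) ↔ x = a ∧ y = b := Iff.rfl

end joinAt

/-- Gluing is functorial. -/
def joinAtCongr {V W V' W' : Type*} {G : SimpleGraph V} {a : V} {H : SimpleGraph W} {b : W}
    {G' : SimpleGraph V'} {a' : V'} {H' : SimpleGraph W'} {b' : W'}
    (φ : G ≃g G') (ψ : H ≃g H') (ha : φ a = a') (hb : ψ b = b') :
    joinAt G a H b ≃g joinAt G' a' H' b' where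
  toEquiv := Equiv.sumCongr φ.toEquiv ψ.toEquiv
  map_rel_iff' := by
    subst ha hb
    rintro (x | x) (y | y) <;> simp [SimpleGraph.Iso.map_adj_iff]

/-- Gluing is commutative. -/
def joinAtComm {V W : Type*} (G : SimpleGraph V) (a : V) (H : SimpleGraph W) (b : W) :
    joinAt G a H b ≃g joinAt H b G a where
  toEquiv := Equiv.sumComm V W
  map_rel_iff' := by
    rintro (x | x) (y | y) <;> simp [and_comm]

/-- Gluing is associative: the middle graph may be moved from one side to the other. -/
def joinAtAssoc {U V W : Type*} (P : SimpleGraph U) (i o : U) (G : SimpleGraph V) (a : V)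
    (H : SimpleGraph W) (b : W) :
    joinAt (joinAt P o G a) (.inl i) H b ≃g joinAt G a (joinAt P i H b) (.inl o) where
  toEquiv :=
    { toFun := Sum.elim (Sum.elim (fun p => .inr (.inl p)) .inl) (fun w => .inr (.inr w))
      invFun := Sum.elim (fun v => .inl (.inr v)) (Sum.elim (fun p => .inl (.inl p)) .inr)
      left_inv := by rintro ((x | x) | x) <;> rfl
      right_inv := by rintro (x | (x | x)) <;> rfl }
  map_rel_iff' := by
    rintro ((x | x) | x) ((y | y) | y) <;> simp [and_comm]

/-- A graph with exactly one edge between a vertex set and its complement is glued from the two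
induced subgraphs. -/
noncomputable def splitIso {V : Type*} (G : SimpleGraph V) (S : Set V) (s : S) (t : (Sᶜ : Set V))
    (hst : G.Adj s t)
    (h : ∀ x ∈ S, ∀ y ∉ S, G.Adj x y → x = s ∧ y = t) :
    joinAt (G.induce S) s (G.induce Sᶜ) t ≃g G := by
  classical
  exact
  { toEquiv := Equiv.Set.sumCompl S
    map_rel_iff' := by
      rintro (⟨x, hx⟩ | ⟨x, hx⟩) (⟨y, hy⟩ | ⟨y, hy⟩)
      · simp
      · simp only [Equiv.Set.sumCompl_apply_inl, Equiv.Set.sumCompl_apply_inr, joinAt_inl_inr]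
        refine ⟨fun hxy => ?_, ?_⟩
        · obtain ⟨h1, h2⟩ := h x hx y hy hxy
          exact ⟨Subtype.ext h1, Subtype.ext h2⟩
        · rintro ⟨h1, h2⟩
          rw [Subtype.ext_iff] at h1 h2
          simp only at h1 h2
          rw [h1, h2]; exact hst
      · simp only [Equiv.Set.sumCompl_apply_inl, Equiv.Set.sumCompl_apply_inr, joinAt_inr_inl]
        refine ⟨fun hxy => ?_, ?_⟩
        · obtain ⟨h1, h2⟩ := h y hy x hx hxy.symm
          exact ⟨Subtype.ext h1, Subtype.ext h2⟩
        · rintro ⟨h1, h2⟩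
          rw [Subtype.ext_iff] at h1 h2
          simp only at h1 h2
          rw [h1, h2]; exact hst.symm
      · simp }

/-! ### Level functions -/

/-- `lev` is the distance from `r`, in a connected graph. -/
structure IsLevel {V : Type*} (G : SimpleGraph V) (r : V) (lev : V → ℕ) : Prop where
  root : lev r = 0
  pred : ∀ v, v ≠ r → ∃ w, G.Adj w v ∧ lev v = lev w + 1
  lip : ∀ u v, G.Adj u v → lev v ≤ lev u + 1

namespace IsLevel
variable {V : Type*} {G : SimpleGraph V} {r : V} {lev lev' : V → ℕ}

theorem eq_root (h : IsLevel G r lev) {v : V} (hv : lev v = 0) : v = r := by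
  by_contra hne
  obtain ⟨w, -, hw⟩ := h.pred v hne
  omega

theorem induct (h : IsLevel G r lev) {p : V → Prop} (h0 : p r)
    (hs : ∀ w v, G.Adj w v → lev v = lev w + 1 → p w → p v) (v : V) : p v := by
  induction hn : lev v generalizing v with
  | zero => rw [h.eq_root hn]; exact h0
  | succ n ih =>
    have hne : v ≠ r := by rintro rfl; rw [h.root] at hn; omega
    obtain ⟨w, hw, hl⟩ := h.pred v hne
    exact hs w v hw hl (ih w (by omega))

theorem le (h : IsLevel G r lev) (h' : IsLevel G r lev') (v : V) : lev v ≤ lev' v := by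
  refine h'.induct (p := fun v => lev v ≤ lev' v) ?_ ?_ v
  · rw [h.root]; omega
  · intro w v hwv hl ih
    have := h.lip w v hwv
    omega

theorem unique (h : IsLevel G r lev) (h' : IsLevel G r lev') : lev = lev' :=
  funext fun v => le_antisymm (h.le h' v) (h'.le h v)

theorem edist_le (h : IsLevel G r lev) (v : V) : G.edist r v ≤ lev v := by
  refine h.induct (p := fun v => G.edist r v ≤ lev v) ?_ ?_ v
  · simp
  · intro w v hwv hl ih
    calc G.edist r v ≤ G.edist r w + G.edist w v := SimpleGraph.edist_triangle
      _ ≤ lev w + 1 := by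
        gcongr
        exact (SimpleGraph.edist_eq_one_iff_adj.mpr hwv).le
      _ = lev v := by rw [hl]; simp

theorem comap {W : Type*} {H : SimpleGraph W} {s : W} (φ : G ≃g H) (hφ : φ r = s) {lev : W → ℕ}
    (h : IsLevel H s lev) : IsLevel G r (lev ∘ φ) where
  root := by simp [hφ, h.root]
  pred v hv := by
    obtain ⟨w, hw, hl⟩ := h.pred (φ v) (by rw [← hφ]; exact fun h => hv (φ.injective h))
    refine ⟨φ.symm w, ?_, by simp [hl]⟩
    rw [← φ.map_adj_iff]; simpa using hw
  lip u v huv := h.lip _ _ (φ.map_adj_iff.mpr huv)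

theorem exists_lt (h : IsLevel G r lev) {v : V} {i : ℕ} (hi : i ≤ lev v) : ∃ w, lev w = i := by
  induction hn : lev v - i generalizing v with
  | zero => exact ⟨v, by omega⟩
  | succ n ih =>
    have hne : v ≠ r := by rintro rfl; rw [h.root] at hn; omega
    obtain ⟨w, -, hl⟩ := h.pred v hne
    exact ih (v := w) (by omega) (by omega)

end IsLevel

/-- The level function of a connected graph given by distances. -/
theorem isLevel_dist {V : Type*} {G : SimpleGraph V} (hG : G.Connected) (r : V) :
    IsLevel G r (G.dist r) where
  root := by simp
  pred v hv := by
    obtain ⟨p, hp⟩ := hG.exists_walk_length_eq_dist r v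
    have hnil : ¬ p.Nil := SimpleGraph.Walk.not_nil_of_ne (Ne.symm hv)
    refine ⟨p.penultimate, p.adj_penultimate hnil, ?_⟩
    have h1 : G.dist r p.penultimate ≤ p.dropLast.length := SimpleGraph.dist_le _
    have h2 : p.dropLast.length + 1 = p.length := p.length_dropLast_add_one hnil
    have h3 : G.dist r v ≤ G.dist r p.penultimate + G.dist p.penultimate v := hG.dist_triangle
    have h4 : G.dist p.penultimate v = 1 :=
      SimpleGraph.dist_eq_one_iff_adj.mpr (p.adj_penultimate hnil)
    omega
  lip u v huv := by
    have h3 : G.dist r v ≤ G.dist r u + G.dist u v := hG.dist_triangle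
    have h4 : G.dist u v = 1 := SimpleGraph.dist_eq_one_iff_adj.mpr huv
    omega

/-- A function changing by at most one along edges bounds distances from below. -/
theorem le_edist_of_lip {V : Type*} {G : SimpleGraph V} {f : V → ℕ}
    (hf : ∀ u v, G.Adj u v → f v ≤ f u + 1) (u v : V) : (f v : ℕ∞) ≤ f u + G.edist u v := by
  by_cases h : G.edist u v = ⊤
  · simp [h]
  · obtain ⟨p, hp⟩ := SimpleGraph.exists_walk_of_edist_ne_top h
    rw [← hp]
    clear hp h
    norm_cast
    induction p with
    | nil => simp
    | cons hadj p ih =>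
      have := hf _ _ hadj
      simp only [SimpleGraph.Walk.length_cons]
      omega

/-- The level function of a glued graph. -/
theorem IsLevel.joinAt {U V : Type*} {P : SimpleGraph U} {i o : U} {G : SimpleGraph V} {r : V}
    {l : U → ℕ} {lev : V → ℕ} (hP : IsLevel P i l) (hG : IsLevel G r lev) :
    IsLevel (joinAt P o G r) (.inl i) (Sum.elim l (fun v => l o + 1 + lev v)) where
  root := by simp [hP.root]
  pred := by
    rintro (v | v) hv
    · obtain ⟨w, hw, hl⟩ := hP.pred v (by simpa using hv)
      exact ⟨.inl w, hw, by simpa using hl⟩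
    · by_cases h : v = r
      · exact ⟨.inl o, ⟨rfl, h⟩, by simp [h, hG.root]⟩
      · obtain ⟨w, hw, hl⟩ := hG.pred v h
        exact ⟨.inr w, hw, by simp [hl]; ring⟩
  lip := by
    rintro (u | u) (v | v) h
    · exact hP.lip u v h
    · obtain ⟨rfl, rfl⟩ := h
      simp [hG.root]
    · obtain ⟨rfl, rfl⟩ := h
      simp [hG.root]; omega
    · have := hG.lip u v h
      simp; omega

/-! ### Tails -/

/-- A tail: what lies beyond a bridge of a cubic triangle-free graph. The root is the end vertex of
the bridge and `e` is the largest distance from it. -/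
structure IsTail (R : RGraph) (lev : R.V → ℕ) (e : ℕ) : Prop where
  finite : Finite R.V
  isLevel : IsLevel R.G R.root lev
  deg_root : (R.G.neighborSet R.root).ncard = 2
  deg : ∀ v, v ≠ R.root → (R.G.neighborSet v).ncard = 3
  tri : ∀ a b c, R.G.Adj a b → R.G.Adj b c → R.G.Adj c a → False
  le : ∀ v, lev v ≤ e
  attained : ∃ v, lev v = e

theorem ncard_neighborSet_iso {V W : Type*} {G : SimpleGraph V} {H : SimpleGraph W} (φ : G ≃g H)
    (v : V) : (G.neighborSet v).ncard = (H.neighborSet (φ v)).ncard := by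
  rw [← Set.ncard_image_of_injective _ φ.injective]
  congr 1
  ext w
  constructor
  · rintro ⟨x, hx, rfl⟩
    exact φ.map_adj_iff.mpr hx
  · intro h
    exact ⟨φ.symm w, by rw [SimpleGraph.mem_neighborSet, ← φ.map_adj_iff]; simpa using h, by simp⟩

theorem IsTail.comap {R S : RGraph} (φ : R.G ≃g S.G) (hφ : φ R.root = S.root) {lev : S.V → ℕ}
    {e : ℕ} (h : IsTail S lev e) : IsTail R (lev ∘ φ) e where
  finite := by have := h.finite; exact Finite.of_equiv _ φ.toEquiv.symm
  isLevel := h.isLevel.comap φ hφ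
  deg_root := by rw [ncard_neighborSet_iso φ, hφ, h.deg_root]
  deg v hv := by
    rw [ncard_neighborSet_iso φ, h.deg]
    rw [← hφ]; exact fun h => hv (φ.injective h)
  tri a b c h1 h2 h3 :=
    h.tri _ _ _ (φ.map_adj_iff.mpr h1) (φ.map_adj_iff.mpr h2) (φ.map_adj_iff.mpr h3)
  le v := h.le _
  attained := by
    obtain ⟨v, hv⟩ := h.attained
    exact ⟨φ.symm v, by simpa using hv⟩

theorem IsTail.ecc_unique {R : RGraph} {lev lev' : R.V → ℕ} {e e' : ℕ} (h : IsTail R lev e)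
    (h' : IsTail R lev' e') : e = e' := by
  have hl := h.isLevel.unique h'.isLevel
  subst hl
  obtain ⟨v, hv⟩ := h.attained
  obtain ⟨w, hw⟩ := h'.attained
  have := h.le w
  have := h'.le v
  omega

/-! ### Degrees and triangles in glued graphs -/

section
variable {V W : Type*} {G : SimpleGraph V} {a : V} {H : SimpleGraph W} {b : W}

theorem neighborSet_joinAt_inl_of_ne {x : V} (hx : x ≠ a) :
    (joinAt G a H b).neighborSet (.inl x) = Sum.inl '' G.neighborSet x := by
  ext (y | y) <;> simp [hx]

theorem neighborSet_joinAt_inl :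
    (joinAt G a H b).neighborSet (.inl a) = insert (.inr b) (Sum.inl '' G.neighborSet a) := by
  ext (y | y) <;> simp

theorem neighborSet_joinAt_inr_of_ne {x : W} (hx : x ≠ b) :
    (joinAt G a H b).neighborSet (.inr x) = Sum.inr '' H.neighborSet x := by
  ext (y | y) <;> simp [hx]

theorem neighborSet_joinAt_inr :
    (joinAt G a H b).neighborSet (.inr b) = insert (.inl a) (Sum.inr '' H.neighborSet b) := by
  ext (y | y) <;> simp

theorem ncard_joinAt_inl_of_ne {x : V} (hx : x ≠ a) :
    ((joinAt G a H b).neighborSet (.inl x)).ncard = (G.neighborSet x).ncard := by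
  rw [neighborSet_joinAt_inl_of_ne hx, Set.ncard_image_of_injective _ Sum.inl_injective]

theorem ncard_joinAt_inr_of_ne {x : W} (hx : x ≠ b) :
    ((joinAt G a H b).neighborSet (.inr x)).ncard = (H.neighborSet x).ncard := by
  rw [neighborSet_joinAt_inr_of_ne hx, Set.ncard_image_of_injective _ Sum.inr_injective]

theorem ncard_joinAt_inl [Finite V] :
    ((joinAt G a H b).neighborSet (.inl a)).ncard = (G.neighborSet a).ncard + 1 := by
  rw [neighborSet_joinAt_inl, Set.ncard_insert_of_notMem (by simp) (Set.toFinite _),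
    Set.ncard_image_of_injective _ Sum.inl_injective]

theorem ncard_joinAt_inr [Finite W] :
    ((joinAt G a H b).neighborSet (.inr b)).ncard = (H.neighborSet b).ncard + 1 := by
  rw [neighborSet_joinAt_inr, Set.ncard_insert_of_notMem (by simp) (Set.toFinite _),
    Set.ncard_image_of_injective _ Sum.inr_injective]

theorem joinAt_tri (hG : ∀ x y z, G.Adj x y → G.Adj y z → G.Adj z x → False)
    (hH : ∀ x y z, H.Adj x y → H.Adj y z → H.Adj z x → False) (x y z : V ⊕ W) :
    (joinAt G a H b).Adj x y → (joinAt G a H b).Adj y z → (joinAt G a H b).Adj z x → False := by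
  rcases x with x | x <;> rcases y with y | y <;> rcases z with z | z <;>
    simp only [joinAt_inl_inl, joinAt_inl_inr, joinAt_inr_inl, joinAt_inr_inr]
  · exact hG x y z
  · rintro h ⟨rfl, -⟩ ⟨rfl, -⟩; exact h.ne rfl
  · rintro ⟨rfl, -⟩ ⟨rfl, -⟩ h; exact h.ne rfl
  · rintro ⟨-, rfl⟩ h ⟨-, rfl⟩; exact h.ne rfl
  · rintro ⟨rfl, -⟩ h ⟨rfl, -⟩; exact h.ne rfl
  · rintro ⟨-, rfl⟩ ⟨-, rfl⟩ h; exact h.ne rfl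
  · rintro h ⟨-, rfl⟩ ⟨-, rfl⟩; exact h.ne rfl
  · exact hH x y z

end

/-- Two tails joined by a bridge form a cubic graph. -/
theorem ncard_joinAt_of_isTail {R S : RGraph} {l : R.V → ℕ} {l' : S.V → ℕ} {e e' : ℕ}
    (hR : IsTail R l e) (hS : IsTail S l' e') (v : R.V ⊕ S.V) :
    ((joinAt R.G R.root S.G S.root).neighborSet v).ncard = 3 := by
  have := hR.finite
  have := hS.finite
  rcases v with v | v
  · by_cases h : v = R.root
    · rw [h, ncard_joinAt_inl, hR.deg_root]
    · rw [ncard_joinAt_inl_of_ne h, hR.deg v h]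
  · by_cases h : v = S.root
    · rw [h, ncard_joinAt_inr, hS.deg_root]
    · rw [ncard_joinAt_inr_of_ne h, hS.deg v h]

/-! ### The building blocks -/

/-- The graph on `Fin n` whose edges are read off from a list of rows of (back) neighbours. -/
def codeGraph (c : List (List ℕ)) (n : ℕ) : SimpleGraph (Fin n) where
  Adj i j := (i < j ∧ i.1 ∈ c.getD j.1 []) ∨ (j < i ∧ j.1 ∈ c.getD i.1 [])
  symm := ⟨fun _ _ h => h.symm⟩
  loopless := ⟨fun i h => by simp at h⟩

instance (c : List (List ℕ)) (n : ℕ) : DecidableRel (codeGraph c n).Adj := fun i j =>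
  inferInstanceAs (Decidable ((i < j ∧ i.1 ∈ c.getD j.1 []) ∨ (j < i ∧ j.1 ∈ c.getD i.1 [])))

/-- Levels of the vertices of a graph whose rows are sorted and listed in breadth first order. -/
def levels (c : List (List ℕ)) : List ℕ :=
  c.tail.foldl (fun acc row => acc ++ [acc.getD (row.headD 0) 0 + 1]) [0]

/-- The three pieces, by back neighbours. -/
def pieceCodes : List (List (List ℕ)) :=
  [[[], [0], [0], [1, 2], [1, 2], [3, 4]],
   [[], [0], [0], [1, 2], [1, 2], [3], [4], [5, 6], [5, 6], [7, 8]],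
   [[], [0], [0], [1, 2], [1, 2], [3], [4, 5], [5], [6], [7, 8], [7, 8], [9, 10]]]

/-- The nineteen ends, by neighbours. -/
def endCodes : List (List (List ℕ)) :=
  [[[1, 2], [0, 3, 4], [0, 5, 6], [1, 5, 6], [1, 5, 6], [2, 3, 4], [2, 3, 4]],
   [[1, 2], [0, 3, 4], [0, 5, 6], [1, 7, 8], [1, 5, 7], [2, 4, 8], [2, 7, 8], [3, 4, 6], [3, 5, 6]],
   [[1, 2], [0, 3, 4], [0, 5, 6], [1, 5, 7], [1, 6, 8], [2, 3, 8], [2, 4, 7], [3, 6, 8], [4, 5, 7]],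
   [[1, 2], [0, 3, 4], [0, 5, 6], [1, 5, 7], [1, 6, 7], [2, 3, 8], [2, 4, 8], [3, 4, 8], [5, 6, 7]],
   [[1, 2], [0, 3, 4], [0, 3, 5], [1, 2, 6], [1, 7, 8], [2, 7, 8], [3, 7, 8], [4, 5, 6], [4, 5, 6]],
   [[1, 2], [0, 3, 4], [0, 5, 6], [1, 7, 8], [1, 5, 9], [2, 4, 7], [2, 8, 9], [3, 5, 10], [3, 6, 10], [4, 6, 10], [7, 8, 9]],
   [[1, 2], [0, 3, 4], [0, 5, 6], [1, 7, 8], [1, 5, 7], [2, 4, 9], [2, 8, 9], [3, 4, 10], [3, 6, 10], [5, 6, 10], [7, 8, 9]],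
   [[1, 2], [0, 3, 4], [0, 3, 5], [1, 2, 6], [1, 7, 8], [2, 6, 9], [3, 5, 10], [4, 9, 10], [4, 9, 10], [5, 7, 8], [6, 7, 8]],
   [[1, 2], [0, 3, 4], [0, 3, 5], [1, 2, 6], [1, 7, 8], [2, 7, 9], [3, 8, 10], [4, 5, 10], [4, 6, 9], [5, 8, 10], [6, 7, 9]],
   [[1, 2], [0, 3, 4], [0, 3, 5], [1, 2, 6], [1, 7, 8], [2, 7, 9], [3, 8, 9], [4, 5, 10], [4, 6, 10], [5, 6, 10], [7, 8, 9]],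
   [[1, 2], [0, 3, 4], [0, 3, 5], [1, 2, 6], [1, 5, 7], [2, 4, 8], [3, 9, 10], [4, 9, 10], [5, 9, 10], [6, 7, 8], [6, 7, 8]],
   [[1, 2], [0, 3, 4], [0, 3, 4], [1, 2, 5], [1, 2, 6], [3, 7, 8], [4, 9, 10], [5, 9, 10], [5, 9, 10], [6, 7, 8], [6, 7, 8]],
   [[1, 2], [0, 3, 4], [0, 3, 5], [1, 2, 6], [1, 5, 7], [2, 4, 8], [3, 9, 10], [4, 9, 11], [5, 10, 11], [6, 7, 12], [6, 8, 12], [7, 8, 12], [9, 10, 11]],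
   [[1, 2], [0, 3, 4], [0, 3, 5], [1, 2, 6], [1, 5, 7], [2, 4, 6], [3, 5, 8], [4, 9, 10], [6, 11, 12], [7, 11, 12], [7, 11, 12], [8, 9, 10], [8, 9, 10]],
   [[1, 2], [0, 3, 4], [0, 3, 4], [1, 2, 5], [1, 2, 6], [3, 7, 8], [4, 9, 10], [5, 11, 12], [5, 9, 11], [6, 8, 12], [6, 11, 12], [7, 8, 10], [7, 9, 10]],
   [[1, 2], [0, 3, 4], [0, 3, 4], [1, 2, 5], [1, 2, 6], [3, 7, 8], [4, 9, 10], [5, 9, 11], [5, 10, 12], [6, 7, 12], [6, 8, 11], [7, 10, 12], [8, 9, 11]],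
   [[1, 2], [0, 3, 4], [0, 3, 4], [1, 2, 5], [1, 2, 6], [3, 7, 8], [4, 9, 10], [5, 9, 11], [5, 10, 11], [6, 7, 12], [6, 8, 12], [7, 8, 12], [9, 10, 11]],
   [[1, 2], [0, 3, 4], [0, 3, 4], [1, 2, 5], [1, 2, 6], [3, 7, 8], [4, 7, 9], [5, 6, 10], [5, 11, 12], [6, 11, 12], [7, 11, 12], [8, 9, 10], [8, 9, 10]],
   [[1, 2], [0, 3, 4], [0, 3, 4], [1, 2, 5], [1, 2, 6], [3, 6, 7], [4, 5, 8], [5, 9, 10], [6, 11, 12], [7, 11, 12], [7, 11, 12], [8, 9, 10], [8, 9, 10]]]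

/-- The excess of a piece. -/
def pex : Fin 3 → ℕ := ![0, 2, 3]

/-- The excess of an end. -/
def eex (i : Fin 19) : ℕ := if i.1 < 1 then 0 else if i.1 < 5 then 1 else if i.1 < 12 then 2 else 3

abbrev pcode (x : Fin 3) : List (List ℕ) := pieceCodes.getD x.1 []

abbrev ecode (i : Fin 19) : List (List ℕ) := endCodes.getD i.1 []

def piece (x : Fin 3) : SimpleGraph (Fin (5 + 2 * pex x + 1)) := codeGraph (pcode x) _

instance (x : Fin 3) : DecidableRel (piece x).Adj :=
  inferInstanceAs (DecidableRel (codeGraph _ _).Adj)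

def pieceLev (x : Fin 3) (v : Fin (5 + 2 * pex x + 1)) : ℕ := (levels (pcode x)).getD v.1 0

def endGraph (i : Fin 19) : SimpleGraph (Fin (6 + 2 * eex i + 1)) := codeGraph (ecode i) _

instance (i : Fin 19) : DecidableRel (endGraph i).Adj :=
  inferInstanceAs (DecidableRel (codeGraph _ _).Adj)

def endLev (i : Fin 19) (v : Fin (6 + 2 * eex i + 1)) : ℕ := (levels (ecode i)).getD v.1 0

def endR (i : Fin 19) : RGraph := ⟨_, endGraph i, 0⟩

/-- Put a piece in front of a rooted graph. -/
def attach (x : Fin 3) (R : RGraph) : RGraph :=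
  ⟨Fin (5 + 2 * pex x + 1) ⊕ R.V, joinAt (piece x) (Fin.last _) R.G R.root, .inl 0⟩

/-- A sequence of pieces closed by an end. -/
def chain : List (Fin 3) → Fin 19 → RGraph
  | [], E => endR E
  | x :: w, E => attach x (chain w E)

def chainLev : (w : List (Fin 3)) → (E : Fin 19) → (chain w E).V → ℕ
  | [], E => endLev E
  | x :: w, E => Sum.elim (pieceLev x) (fun v => 3 + pex x + 1 + chainLev w E v)

/-- Total excess of a sequence of pieces. -/
def wex (w : List (Fin 3)) : ℕ := (w.map pex).sum

@[simp] theorem wex_nil : wex [] = 0 := rfl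

@[simp] theorem wex_cons (x : Fin 3) (w : List (Fin 3)) : wex (x :: w) = pex x + wex w := by
  simp [wex]

@[simp] theorem wex_append (w w' : List (Fin 3)) : wex (w ++ w') = wex w + wex w' := by
  simp [wex]

@[simp] theorem wex_reverse (w : List (Fin 3)) : wex w.reverse = wex w := by
  simp [wex, List.sum_reverse]

def chainEcc (w : List (Fin 3)) (E : Fin 19) : ℕ := 2 + eex E + 4 * w.length + wex w

theorem isLevel_piece (x : Fin 3) : IsLevel (piece x) 0 (pieceLev x) := by
  revert x
  have h1 : ∀ x, pieceLev x 0 = 0 := by decide +kernel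
  have h2 : ∀ x v, v ≠ 0 → ∃ w, (piece x).Adj w v ∧ pieceLev x v = pieceLev x w + 1 := by
    decide +kernel
  have h3 : ∀ x u v, (piece x).Adj u v → pieceLev x v ≤ pieceLev x u + 1 := by decide +kernel
  exact fun x => ⟨h1 x, h2 x, h3 x⟩

theorem isLevel_endGraph (i : Fin 19) : IsLevel (endGraph i) 0 (endLev i) := by
  revert i
  have h1 : ∀ x, endLev x 0 = 0 := by decide +kernel
  have h2 : ∀ x v, v ≠ 0 → ∃ w, (endGraph x).Adj w v ∧ endLev x v = endLev x w + 1 := by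
    decide +kernel
  have h3 : ∀ x u v, (endGraph x).Adj u v → endLev x v ≤ endLev x u + 1 := by decide +kernel
  exact fun x => ⟨h1 x, h2 x, h3 x⟩

theorem pieceLev_last : ∀ x, pieceLev x (Fin.last _) = 3 + pex x := by decide +kernel

theorem pieceLev_le : ∀ x v, pieceLev x v ≤ 3 + pex x := by decide +kernel

theorem pieceLev_rev_last : ∀ x v, pieceLev x v = 3 + pex x → v = Fin.last _ := by decide +kernel

theorem endLev_le : ∀ i v, endLev i v ≤ 2 + eex i := by decide +kernel

theorem endLev_attained : ∀ i, ∃ v, endLev i v = 2 + eex i := by decide +kernel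

theorem ncard_neighborSet_eq {n : ℕ} (G : SimpleGraph (Fin n)) [DecidableRel G.Adj] (v : Fin n) :
    (G.neighborSet v).ncard = (Finset.univ.filter (G.Adj v)).card := by
  rw [← Set.ncard_coe_finset]; congr; ext; simp

theorem ncard_piece_zero (x : Fin 3) : ((piece x).neighborSet 0).ncard = 2 := by
  rw [ncard_neighborSet_eq]; revert x; decide +kernel

theorem ncard_piece_last (x : Fin 3) : ((piece x).neighborSet (Fin.last _)).ncard = 2 := by
  rw [ncard_neighborSet_eq]; revert x; decide +kernel

theorem ncard_piece (x : Fin 3) (v) (h : v ≠ 0) (h' : v ≠ Fin.last _) :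
    ((piece x).neighborSet v).ncard = 3 := by
  rw [ncard_neighborSet_eq]; revert x; decide +kernel

theorem ncard_end_zero (i : Fin 19) : ((endGraph i).neighborSet 0).ncard = 2 := by
  rw [ncard_neighborSet_eq]; revert i; decide +kernel

theorem ncard_end (i : Fin 19) (v) (h : v ≠ 0) : ((endGraph i).neighborSet v).ncard = 3 := by
  rw [ncard_neighborSet_eq]; revert i; decide +kernel

theorem piece_tri : ∀ x a b, (piece x).Adj a b → ∀ c, (piece x).Adj b c →
    ¬ (piece x).Adj c a := by decide +kernel

theorem end_tri : ∀ i a b, (endGraph i).Adj a b → ∀ c, (endGraph i).Adj b c →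
    ¬ (endGraph i).Adj c a := by decide +kernel

theorem end_square : ∀ i, ∃ a b, (endGraph i).Adj a b ∧ ∃ c, (endGraph i).Adj b c ∧ a ≠ c ∧
    ∃ d, (endGraph i).Adj c d ∧ (endGraph i).Adj d a ∧ b ≠ d := by decide +kernel

/-- Pieces are symmetric. -/
def pieceRev (x : Fin 3) : piece x ≃g piece x where
  toEquiv := Fin.revPerm
  map_rel_iff' := by
    intro a b
    have : ∀ x a b, (piece x).Adj (Fin.rev a) (Fin.rev b) ↔ (piece x).Adj a b := by decide +kernel
    exact this x a b

theorem pieceRev_zero (x : Fin 3) : pieceRev x 0 = Fin.last _ := Fin.rev_zero _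

theorem pieceRev_last (x : Fin 3) : pieceRev x (Fin.last _) = 0 := Fin.rev_last _

theorem isTail_attach (x : Fin 3) {R : RGraph} {lev : R.V → ℕ} {e : ℕ} (h : IsTail R lev e) :
    IsTail (attach x R) (Sum.elim (pieceLev x) (fun v => 3 + pex x + 1 + lev v))
      (4 + pex x + e) where
  finite := by have := h.finite; exact inferInstanceAs (Finite (_ ⊕ _))
  isLevel := by
    have := (isLevel_piece x).joinAt (o := Fin.last _) h.isLevel
    rw [pieceLev_last] at this
    exact this
  deg_root := by
    have h0 : (0 : Fin (5 + 2 * pex x + 1)) ≠ Fin.last _ := by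
      simp only [ne_eq, Fin.ext_iff, Fin.val_zero, Fin.val_last]; omega
    exact (ncard_joinAt_inl_of_ne h0).trans (ncard_piece_zero x)
  deg := by
    have := h.finite
    rintro (v | v) hv
    · by_cases hl : v = Fin.last _
      · rw [hl]
        exact ncard_joinAt_inl.trans (by rw [ncard_piece_last])
      · exact (ncard_joinAt_inl_of_ne hl).trans
          (ncard_piece x v (fun h => hv (by rw [h]; rfl)) hl)
    · by_cases hl : v = R.root
      · rw [hl]
        exact ncard_joinAt_inr.trans (by rw [h.deg_root])
      · exact (ncard_joinAt_inr_of_ne hl).trans (h.deg v hl)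
  tri := joinAt_tri (fun a b c h1 h2 => piece_tri x a b h1 c h2) h.tri
  le := by
    rintro (v | v)
    · have := pieceLev_le x v
      simp; omega
    · have := h.le v
      simp; omega
  attained := by
    obtain ⟨v, hv⟩ := h.attained
    exact ⟨.inr v, by simp [hv]; ring⟩

theorem isTail_endR (E : Fin 19) : IsTail (endR E) (endLev E) (2 + eex E) where
  finite := inferInstanceAs (Finite (Fin _))
  isLevel := isLevel_endGraph E
  deg_root := ncard_end_zero E
  deg := ncard_end E
  tri a b c h1 h2 := end_tri E a b h1 c h2
  le := endLev_le E
  attained := endLev_attained E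

theorem isTail_chain (w : List (Fin 3)) (E : Fin 19) :
    IsTail (chain w E) (chainLev w E) (chainEcc w E) := by
  induction w with
  | nil => exact isTail_endR E
  | cons x w ih =>
    have h := isTail_attach x ih
    have h' : 4 + pex x + chainEcc w E = chainEcc (x :: w) E := by simp [chainEcc]; ring
    rw [h'] at h
    exact h

theorem card_chain (w : List (Fin 3)) (E : Fin 19) :
    Nat.card (chain w E).V = 7 + 2 * eex E + 6 * w.length + 2 * wex w := by
  induction w with
  | nil => exact (Nat.card_fin _).trans (by simp; ring)
  | cons x w ih =>
    have := (isTail_chain w E).finite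
    have h : Nat.card (chain (x :: w) E).V = _ := Nat.card_sum (α := Fin (5 + 2 * pex x + 1))
      (β := (chain w E).V)
    rw [h, ih, Nat.card_fin]
    simp; ring

theorem edist_map_le {V W : Type*} {G : SimpleGraph V} {H : SimpleGraph W} (f : G →g H) (u v : V) :
    H.edist (f u) (f v) ≤ G.edist u v := by
  by_cases h : G.edist u v = ⊤
  · simp [h]
  · obtain ⟨p, hp⟩ := SimpleGraph.exists_walk_of_edist_ne_top h
    rw [← hp]
    simpa using SimpleGraph.edist_le (p.map f)

def joinInl {V W : Type*} (G : SimpleGraph V) (a : V) (H : SimpleGraph W) (b : W) :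
    G →g joinAt G a H b := ⟨.inl, fun h => h⟩

def joinInr {V W : Type*} (G : SimpleGraph V) (a : V) (H : SimpleGraph W) (b : W) :
    H →g joinAt G a H b := ⟨.inr, fun h => h⟩

theorem edist_joinAt_le {V W : Type*} {G : SimpleGraph V} {a : V} {H : SimpleGraph W} {b : W}
    (u : V) (v : W) :
    (joinAt G a H b).edist (.inl u) (.inr v) ≤ G.edist a u + 1 + H.edist b v := by
  have h1 : (joinAt G a H b).edist (.inl u) (.inl a) ≤ G.edist a u := by
    rw [SimpleGraph.edist_comm]; exact edist_map_le (joinInl G a H b) a u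
  have h2 : (joinAt G a H b).edist (.inr b) (.inr v) ≤ H.edist b v :=
    edist_map_le (joinInr G a H b) b v
  have h3 : (joinAt G a H b).edist (.inl a) (.inr b) = 1 :=
    SimpleGraph.edist_eq_one_iff_adj.mpr ⟨rfl, rfl⟩
  calc _ ≤ (joinAt G a H b).edist (.inl u) (.inl a) + (joinAt G a H b).edist (.inl a) (.inr v) :=
        SimpleGraph.edist_triangle
    _ ≤ (joinAt G a H b).edist (.inl u) (.inl a) + ((joinAt G a H b).edist (.inl a) (.inr b) +
        (joinAt G a H b).edist (.inr b) (.inr v)) := by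
        gcongr; exact SimpleGraph.edist_triangle
    _ ≤ _ := by rw [h3, ← add_assoc]; gcongr

theorem IsLevel.edist_le_add {V : Type*} {G : SimpleGraph V} {r : V} {lev : V → ℕ}
    (h : IsLevel G r lev) (u v : V) : G.edist u v ≤ (lev u + lev v : ℕ) := by
  calc G.edist u v ≤ G.edist u r + G.edist r v := SimpleGraph.edist_triangle
    _ ≤ lev u + lev v := by
      rw [SimpleGraph.edist_comm]
      exact add_le_add (h.edist_le u) (h.edist_le v)
    _ = _ := by push_cast; rfl

theorem isLevel_piece_last (x : Fin 3) : IsLevel (piece x) (Fin.last _) (pieceLev x ∘ pieceRev x) :=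
  (isLevel_piece x).comap _ (pieceRev_last x)

theorem chain_edist_le {D : ℕ} (w : List (Fin 3)) (E : Fin 19) (hE : 4 + 2 * eex E ≤ D)
    (hw : ∀ x ∈ w, 6 + 2 * pex x ≤ D) (he : chainEcc w E ≤ D) (u v : (chain w E).V) :
    (chain w E).G.edist u v ≤ D := by
  induction w with
  | nil =>
    refine ((isLevel_endGraph E).edist_le_add u v).trans ?_
    have := endLev_le E u
    have := endLev_le E v
    exact_mod_cast (by omega)
  | cons x w ih =>
    have hx := hw x (by simp)
    have ih := ih (fun y hy => hw y (by simp [hy])) (by simp [chainEcc] at he ⊢; omega)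
    have key : ∀ (u : Fin (5 + 2 * pex x + 1)) (v : (chain w E).V),
        (chain (x :: w) E).G.edist (.inl u) (.inr v) ≤ D := by
      intro u v
      refine (edist_joinAt_le u v).trans ?_
      have h1 := (isLevel_piece_last x).edist_le u
      have h2 := (isTail_chain w E).isLevel.edist_le v
      have h3 := pieceLev_le x (pieceRev x u)
      have h4 := (isTail_chain w E).le v
      calc _ ≤ (((pieceLev x ∘ pieceRev x) u : ℕ) : ℕ∞) + 1 + (chainLev w E v : ℕ∞) := by gcongr
        _ ≤ D := by
          norm_cast
          simp [chainEcc] at he h4 ⊢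
          omega
    rcases u with u | u <;> rcases v with v | v
    · refine (edist_map_le (joinInl (piece x) (Fin.last _) (chain w E).G (chain w E).root) u v).trans
        (((isLevel_piece x).edist_le_add u v).trans ?_)
      have := pieceLev_le x u
      have := pieceLev_le x v
      exact_mod_cast (by omega)
    · exact key u v
    · exact SimpleGraph.edist_comm.trans_le (key v u)
    · exact (edist_map_le (joinInr (piece x) (Fin.last _) (chain w E).G (chain w E).root) u v).trans
        (ih u v)

/-! ### Isomorphism testing of codes -/

/-- Extend a partial rooted isomorphism `σ` to the remaining rows in all possible ways. -/
def isoSearch (N : List (List ℕ)) : List (List ℕ) → List ℕ → Bool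
  | [], _ => true
  | row :: rs, σ =>
    let τ := (row.filter (· < σ.length)).map (σ.getD · 0)
    (match τ with
      | [] => List.range N.length
      | y :: _ => N.getD y []).any fun x =>
        !σ.elem x && τ.all (fun y => (N.getD x []).elem y) &&
        (N.getD x []).all (fun y => !σ.elem y || τ.elem y) && isoSearch N rs (σ ++ [x])

def isoCode (A B : List (List ℕ)) : Bool := A.length == B.length && isoSearch B A.tail [0]

/-- `N` is the list of neighbour lists of a graph. -/
def WFCode (N : List (List ℕ)) : Prop :=
  ∀ x < N.length, ∀ y ∈ N.getD x [], y < N.length ∧ y ≠ x ∧ x ∈ N.getD y []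

theorem wfCode_ecode (i : Fin 19) : WFCode (ecode i) := by
  revert i; unfold WFCode; decide +kernel

theorem length_ecode : ∀ i, (ecode i).length = 6 + 2 * eex i + 1 := by decide +kernel

theorem isoCode_ecode : ∀ i j, isoCode (ecode i) (ecode j) = true → i = j := by decide +kernel

/-- Neighbour lists out of range are empty, so `WFCode` is symmetric. -/
theorem WFCode.lt {N : List (List ℕ)} {x y : ℕ} (h : y ∈ N.getD x []) : x < N.length := by
  by_contra hx
  rw [List.getD_eq_default _ _ (by omega)] at h
  simp at h

theorem WFCode.mem_comm {N : List (List ℕ)} (hN : WFCode N) {x y : ℕ} :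
    x ∈ N.getD y [] ↔ y ∈ N.getD x [] :=
  ⟨fun h => (hN _ (WFCode.lt h) _ h).2.2, fun h => (hN _ (WFCode.lt h) _ h).2.2⟩

theorem codeGraph_adj_of_wf {N : List (List ℕ)} (hN : WFCode N) {n : ℕ} {x y : Fin n} :
    (codeGraph N n).Adj x y ↔ x.1 ∈ N.getD y.1 [] := by
  have h := hN.mem_comm (x := x.1) (y := y.1)
  constructor
  · rintro (⟨-, hxy⟩ | ⟨-, hxy⟩)
    exacts [hxy, h.mpr hxy]
  · intro hxy
    have hne := (hN _ (WFCode.lt hxy) _ hxy).2.1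
    rcases lt_trichotomy x y with hlt | heq | hgt
    · exact .inl ⟨hlt, hxy⟩
    · exact absurd (congrArg Fin.val heq) hne
    · exact .inr ⟨hgt, h.mp hxy⟩

/-- `x` is a possible image of vertex `k`. -/
def StepOK (A N : List (List ℕ)) (p : ℕ → ℕ) (k x : ℕ) : Prop :=
  x < N.length ∧ ∀ i < k, p i ≠ x ∧ (i ∈ A.getD k [] ↔ p i ∈ N.getD x [])

theorem isoSearch_step {A N : List (List ℕ)} (hN : WFCode N) {p : ℕ → ℕ} {k : ℕ}
    (hk : k < A.length) (hp : ∀ j < k, StepOK A N p j (p j)) :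
    isoSearch N (A.drop k) ((List.range k).map p) = true ↔
      ∃ x, StepOK A N p k x ∧
        isoSearch N (A.drop (k + 1)) ((List.range k).map p ++ [x]) = true := by
  have hinj : ∀ i < k, ∀ j < k, p i = p j → i = j := by
    intro i hi j hj h
    rcases lt_trichotomy i j with hlt | heq | hgt
    · exact absurd h ((hp j hj).2 i hlt).1
    · exact heq
    · exact absurd h.symm ((hp i hi).2 j hgt).1
  rw [List.drop_eq_getElem_cons hk, isoSearch]
  have hrow : A[k] = A.getD k [] := (List.getD_eq_getElem _ _ hk).symm
  rw [hrow]
  set row := A.getD k []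
  set σ := (List.range k).map p with hσ
  have hσl : σ.length = k := by simp [hσ]
  have hσm : ∀ y, y ∈ σ ↔ ∃ i < k, p i = y := by simp [hσ]
  have hget : ∀ i < k, σ.getD i 0 = p i := by
    intro i hi
    rw [List.getD_eq_getElem _ _ (by omega)]
    simp [hσ]
  set τ := (row.filter (· < σ.length)).map (σ.getD · 0) with hτ
  have hτm : ∀ y, y ∈ τ ↔ ∃ i < k, i ∈ row ∧ p i = y := by
    intro y
    simp only [hτ, hσl, List.mem_map, List.mem_filter, decide_eq_true_eq]
    constructor
    · rintro ⟨i, ⟨hi, hik⟩, rfl⟩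
      exact ⟨i, hik, hi, (hget i hik).symm⟩
    · rintro ⟨i, hik, hi, rfl⟩
      exact ⟨i, ⟨hi, hik⟩, hget i hik⟩
  have hcond : ∀ x, ((∀ i < k, p i ≠ x ∧ (i ∈ row ↔ p i ∈ N.getD x [])) ↔
      (x ∉ σ ∧ (∀ y ∈ τ, y ∈ N.getD x [])) ∧ ∀ y ∈ N.getD x [], y ∉ σ ∨ y ∈ τ) := by
    intro x
    constructor
    · intro h
      refine ⟨⟨?_, ?_⟩, ?_⟩
      · rw [hσm]; rintro ⟨i, hi, h'⟩; exact (h i hi).1 h'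
      · intro y hy
        obtain ⟨i, hi, hir, rfl⟩ := (hτm y).mp hy
        exact (h i hi).2.mp hir
      · intro y hy
        by_cases hys : y ∈ σ
        · obtain ⟨i, hi, rfl⟩ := (hσm y).mp hys
          exact .inr ((hτm _).mpr ⟨i, hi, (h i hi).2.mpr hy, rfl⟩)
        · exact .inl hys
    · rintro ⟨⟨h1, h2⟩, h3⟩ i hi
      refine ⟨fun h => h1 ((hσm x).mpr ⟨i, hi, h⟩), fun h => h2 _ ((hτm _).mpr ⟨i, hi, h, rfl⟩), ?_⟩
      intro h
      rcases h3 _ h with h4 | h4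
      · exact absurd ((hσm _).mpr ⟨i, hi, rfl⟩) h4
      · obtain ⟨j, hj, hjr, hji⟩ := (hτm _).mp h4
        rwa [← hinj j hj i hi hji]
  simp only [List.any_eq_true, Bool.and_eq_true, Bool.not_eq_true', List.all_eq_true,
    Bool.or_eq_true, List.elem_eq_mem, decide_eq_true_eq, decide_eq_false_iff_not]
  clear_value τ
  constructor
  · rintro ⟨x, hx, hc, hs⟩
    refine ⟨x, ⟨?_, (hcond x).mpr hc⟩, hs⟩
    split at hx
    · simpa using hx
    · exact (hN _ (WFCode.lt hx) _ hx).1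
  · rintro ⟨x, ⟨hx, hc⟩, hs⟩
    have hc' := (hcond x).mp hc
    refine ⟨x, ?_, hc', hs⟩
    split
    · simpa using hx
    · next y _ => exact hN.mem_comm.mp (hc'.1.2 y (by simp))

theorem map_range_update (p : ℕ → ℕ) (k x : ℕ) :
    (List.range (k + 1)).map (Function.update p k x) = (List.range k).map p ++ [x] := by
  rw [List.range_succ, List.map_append]
  congr 1
  · exact List.map_congr_left fun i hi => by
      rw [Function.update_of_ne]; simp at hi; omega
  · simp

theorem StepOK.congr {A N : List (List ℕ)} {p q : ℕ → ℕ} {k x : ℕ} (h : StepOK A N p k x)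
    (hpq : ∀ i < k, q i = p i) : StepOK A N q k x :=
  ⟨h.1, fun i hi => by rw [hpq i hi]; exact h.2 i hi⟩

theorem isoSearch_sound {A N : List (List ℕ)} (hN : WFCode N) {p : ℕ → ℕ} {k : ℕ}
    (hk : k ≤ A.length) (hp : ∀ j < k, StepOK A N p j (p j))
    (h : isoSearch N (A.drop k) ((List.range k).map p) = true) :
    ∃ q : ℕ → ℕ, (∀ j < A.length, StepOK A N q j (q j)) ∧ ∀ i < k, q i = p i := by
  induction hn : A.length - k generalizing k p with
  | zero => exact ⟨p, fun j hj => hp j (by omega), fun _ _ => rfl⟩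
  | succ n ih =>
    obtain ⟨x, hx, hs⟩ := (isoSearch_step hN (by omega) hp).mp h
    rw [← map_range_update] at hs
    obtain ⟨q, hq, hqp⟩ := ih (k := k + 1) (by omega) (by
      intro j hj
      by_cases hjk : j = k
      · subst hjk
        rw [Function.update_self]
        exact hx.congr fun i hi => Function.update_of_ne (by omega) _ _
      · rw [Function.update_of_ne hjk]
        exact (hp j (by omega)).congr fun i hi => Function.update_of_ne (by omega) _ _) hs (by omega)
    exact ⟨q, hq, fun i hi => by rw [hqp i (by omega), Function.update_of_ne (by omega)]⟩

theorem isoSearch_complete {A N : List (List ℕ)} (hN : WFCode N) {p : ℕ → ℕ} {k : ℕ}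
    (hk : k ≤ A.length) (hp : ∀ j < A.length, StepOK A N p j (p j)) :
    isoSearch N (A.drop k) ((List.range k).map p) = true := by
  induction hn : A.length - k generalizing k with
  | zero => rw [List.drop_of_length_le (by omega)]; rfl
  | succ n ih =>
    refine (isoSearch_step hN (by omega) fun j hj => hp j (by omega)).mpr
      ⟨p k, hp k (by omega), ?_⟩
    have := ih (k := k + 1) (by omega) (by omega)
    rwa [List.range_succ, List.map_append] at this

theorem iso_of_isoCode {A N : List (List ℕ)} (hN : WFCode N) {k n : ℕ} (hk : A.length = k)
    (hn : N.length = n) (hk0 : 0 < k) (h : isoCode A N = true) :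
    ∃ φ : codeGraph A k ≃g codeGraph N n, ∀ i, i.1 = 0 → (φ i).1 = 0 := by
  rw [isoCode, Bool.and_eq_true, beq_iff_eq] at h
  obtain ⟨hl, h⟩ := h
  have hkn : k = n := by omega
  subst hkn
  obtain ⟨q, hq, hq0⟩ := isoSearch_sound (A := A) hN (p := fun _ => 0) (k := 1) (by omega) (by
    intro j hj
    obtain rfl : j = 0 := by omega
    exact ⟨by omega, by simp⟩) (by simpa using h)
  let f : Fin k → Fin k := fun i => ⟨q i, by have := (hq i (by omega)).1; omega⟩
  have hf : Function.Injective f := by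
    intro i j hij
    rw [Fin.mk.injEq] at hij
    rcases lt_trichotomy i j with hlt | heq | hgt
    · exact absurd hij ((hq j (by omega)).2 i hlt).1
    · exact heq
    · exact absurd hij.symm ((hq i (by omega)).2 j hgt).1
  have key : ∀ i j : Fin k, i < j → ((codeGraph N k).Adj (f i) (f j) ↔ (codeGraph A k).Adj i j) := by
    intro i j hij
    rw [codeGraph_adj_of_wf hN]
    refine ((hq j (by omega)).2 i hij).2.symm.trans ?_
    have := hij.not_gt
    simp [codeGraph, hij, this]
  refine ⟨⟨Equiv.ofBijective f (Finite.injective_iff_bijective.mp hf), ?_⟩, ?_⟩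
  · intro i j
    rcases lt_trichotomy i j with hlt | heq | hgt
    · exact key i j hlt
    · subst heq; simp
    · rw [SimpleGraph.adj_comm, SimpleGraph.adj_comm _ i j]; exact key j i hgt
  · intro i hi
    have : q i.1 = 0 := by rw [hi]; exact hq0 0 (by omega)
    exact this

theorem isoCode_of_iso {A N : List (List ℕ)} (hA : WFCode A) (hN : WFCode N) {k n : ℕ}
    (hk : A.length = k) (hn : N.length = n) (hk0 : 0 < k)
    (φ : codeGraph A k ≃g codeGraph N n) (hφ : ∀ i, i.1 = 0 → (φ i).1 = 0) :
    isoCode A N = true := by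
  have hkn : k = n := by simpa using Fintype.card_congr φ.toEquiv
  subst hkn
  rw [isoCode, Bool.and_eq_true, beq_iff_eq]
  refine ⟨by omega, ?_⟩
  let p : ℕ → ℕ := fun i => if h : i < k then (φ ⟨i, h⟩).1 else 0
  have hp : ∀ j < A.length, StepOK A N p j (p j) := by
    intro j hj
    have hj' : j < k := by omega
    refine ⟨by simp [p, hj']; omega, fun i hi => ?_⟩
    have hi' : i < k := by omega
    simp only [p, hi', hj', dif_pos]
    constructor
    · intro h
      have := φ.injective (Fin.ext h)
      simp at this; omega
    · rw [← codeGraph_adj_of_wf hN, φ.map_adj_iff, codeGraph_adj_of_wf hA]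
  have := isoSearch_complete hN (k := 1) (by omega) hp
  have hp0 : p 0 = 0 := by
    simp only [p, hk0, dif_pos]; exact hφ _ rfl
  simpa [hp0] using this

theorem endR_iso {i j : Fin 19} (h : (endR i).Iso (endR j)) : i = j := by
  obtain ⟨φ, hφ⟩ := h
  refine isoCode_ecode i j (isoCode_of_iso (wfCode_ecode i) (wfCode_ecode j) (length_ecode i)
    (length_ecode j) (by omega) φ fun v hv => ?_)
  have : v = (endR i).root := Fin.ext hv
  rw [this]
  exact congrArg Fin.val hφ

/-! ### The search for short tails -/

/-- All ways of joining the vertex `u`, whose neighbours `b` are already processed, to `need`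
vertices, discovered or new. Returns the number of new neighbours and the updated queue. -/
def choices (u : ℕ) (b : List ℕ) : ℕ → List (ℕ × List ℕ) → List (ℕ × List (ℕ × List ℕ))
  | need, [] => [(need, [])]
  | need, (l', b') :: r =>
    (choices u b need r).map (fun q => (q.1, (l', b') :: q.2)) ++
    (match need with
      | 0 => []
      | n + 1 => if b'.length < 3 && b'.all (fun i => !b.elem i) then
          (choices u b n r).map (fun q => (q.1, (l', b' ++ [u]) :: q.2)) else [])

/-- Breadth first construction of all short tails: each branch is pruned, ends in one of the
nineteen ends, or reaches a bridge behind one of the three pieces. -/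
def search : ℕ → List (List ℕ) → List (ℕ × List ℕ) → ℕ → Bool
  | 0, _, _, _ => false
  | _ + 1, done, [], lmax =>
    Nat.blt (3 * (lmax + 1) + 8) (2 * done.length) ||
      (List.finRange 19).any fun i => isoCode done (ecode i)
  | fuel + 1, done, (l, b) :: rest, lmax =>
    if rest.isEmpty && b.length == 1 then
      Nat.blt (3 * l + 3) (2 * done.length) ||
        (List.finRange 3).any fun x => pcode x == done && b == [5 + 2 * pex x]
    else
      (choices done.length b ((if done.isEmpty then 2 else 3) - b.length) rest).all fun q =>
        Nat.blt (3 * ((if q.1 == 0 then lmax else l + 1) + 1) + 9)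
          (2 * (done.length + 1 + q.2.length + q.1)) ||
        search fuel (done ++ [b]) (q.2 ++ List.replicate q.1 (l + 1, [done.length]))
          (if q.1 == 0 then lmax else l + 1)

set_option maxRecDepth 100000 in
theorem search_eq_true : search 40 [] [(0, [])] 0 = true := by decide +kernel

theorem choices_mem (u : ℕ) (b : List ℕ) (dec : ℕ → Bool) (g : ℕ → ℕ × List ℕ) (J : List ℕ)
    (need c : ℕ) (hc : J.countP dec + c = need)
    (hJ : ∀ j ∈ J, dec j = true → (g j).2.length < 3 ∧ ∀ i ∈ (g j).2, i ∉ b) :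
    (c, J.map fun j => if dec j then ((g j).1, (g j).2 ++ [u]) else g j) ∈
      choices u b need (J.map g) := by
  induction J generalizing need with
  | nil => simp at hc; simp [choices, hc]
  | cons j J ih =>
    have hJ_succ := fun i hi => hJ i (List.mem_cons_of_mem _ hi)
    obtain ⟨l', b', hg⟩ : ∃ l' b', g j = (l', b') := ⟨_, _, rfl⟩
    rw [List.map_cons, List.map_cons, choices.eq_def]
    simp only [hg, List.mem_append]
    by_cases hj : dec j = true
    · right
      rw [List.countP_cons_of_pos hj] at hc
      obtain ⟨n, rfl⟩ : ∃ n, need = n + 1 := ⟨need - 1, by omega⟩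
      obtain ⟨h1, h2⟩ := hJ j (by simp) hj
      rw [hg] at h1 h2
      have h3 : (b'.length < 3 && b'.all (fun i => !b.elem i)) = true := by
        simpa [show b'.length < 3 from h1] using h2
      simp only [h3, if_true, hj, List.mem_map]
      exact ⟨_, ih n (by omega) hJ_succ, rfl⟩
    · left
      rw [List.countP_cons_of_neg hj] at hc
      simp only [hj, List.mem_map]
      exact ⟨_, ih need hc hJ_succ, rfl⟩

/-! ### Counting vertices by level -/

theorem IsTail.ncard_gt {R : RGraph} {lev : R.V → ℕ} {e : ℕ} (h : IsTail R lev e) (n i : ℕ)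
    (hi : i + n = e) : 3 * n ≤ 2 * {v | i < lev v}.ncard + 1 := by
  have := h.finite
  have hdeg : ∀ v, 0 < lev v → (R.G.neighborSet v).ncard = 3 := by
    intro v hv
    refine h.deg v ?_
    rintro rfl
    rw [h.isLevel.root] at hv
    omega
  have hpred : ∀ v, 0 < lev v → ∃ w, R.G.Adj w v ∧ lev v = lev w + 1 := by
    intro v hv
    refine h.isLevel.pred v ?_
    rintro rfl
    rw [h.isLevel.root] at hv
    omega
  obtain ⟨z, hz⟩ := h.attained
  have big : ∀ i, i + 2 ≤ e → 4 ≤ {v | i < lev v}.ncard := by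
    intro i hi
    have h1 : (insert z (R.G.neighborSet z)).ncard = 4 := by
      rw [Set.ncard_insert_of_notMem (by simp) (Set.toFinite _), hdeg z (by omega)]
    rw [← h1]
    refine Set.ncard_le_ncard ?_ (Set.toFinite _)
    rintro v (rfl | hv)
    · simp; omega
    · have := h.isLevel.lip v z hv.symm
      simp; omega
  induction n using Nat.strong_induction_on generalizing i with
  | _ n ih =>
    rcases Nat.lt_or_ge n 4 with hn | hn
    · rcases Nat.lt_or_ge n 2 with hn' | hn'
      · rcases Nat.lt_or_ge n 1 with hn'' | hn''
        · omega
        · have : 0 < {v | i < lev v}.ncard :=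
            (Set.ncard_pos (Set.toFinite _)).mpr ⟨z, by simp; omega⟩
          omega
      · have := big i (by omega)
        omega
    · have ih' := ih (n - 4) (by omega) (i + 4) (by omega)
      obtain ⟨w, hw⟩ := h.isLevel.exists_lt (v := z) (i := i + 3) (by omega)
      obtain ⟨v, hvw, hv⟩ := hpred w (by omega)
      have hd : Disjoint (R.G.neighborSet v) (R.G.neighborSet w) :=
        Set.disjoint_left.mpr fun x hx hy => h.tri v w x hvw hy hx.symm
      have hN := Set.ncard_union_eq hd (Set.toFinite _) (Set.toFinite _)
      rw [hdeg v (by omega), hdeg w (by omega)] at hN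
      have hd' : Disjoint (R.G.neighborSet v ∪ R.G.neighborSet w) {v | i + 4 < lev v} := by
        refine Set.disjoint_left.mpr ?_
        rintro x (hx | hx) (hy : i + 4 < lev x)
        · have := h.isLevel.lip v x hx
          omega
        · have := h.isLevel.lip w x hx
          omega
      have hN' := Set.ncard_union_eq hd' (Set.toFinite _) (Set.toFinite _)
      have hle : (R.G.neighborSet v ∪ R.G.neighborSet w ∪ {v | i + 4 < lev v}).ncard ≤
          {v | i < lev v}.ncard := by
        refine Set.ncard_le_ncard ?_ (Set.toFinite _)
        rintro x ((hx | hx) | hx)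
        · have := h.isLevel.lip x v hx.symm
          simp; omega
        · have := h.isLevel.lip x w hx.symm
          simp; omega
        · simp at hx ⊢; omega
      omega

/-- In a short tail there are few vertices up to any level. -/
theorem IsTail.ncard_le {R : RGraph} {lev : R.V → ℕ} {e : ℕ} (h : IsTail R lev e)
    (hm : 2 * Nat.card R.V ≤ 3 * (e + 1) + 8) {i : ℕ} (hi : i ≤ e) :
    2 * {v | lev v ≤ i}.ncard ≤ 3 * (i + 1) + 9 := by
  have := h.finite
  have h1 := h.ncard_gt (e - i) i (by omega)
  have h2 := Set.ncard_add_ncard_compl {v | lev v ≤ i}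
  have h3 : {v | lev v ≤ i}ᶜ = {v | i < lev v} := by ext; simp
  rw [h3] at h2
  omega

open Classical in
/-- The vertices among the first `s` ones adjacent to the `j`-th one. -/
noncomputable def back {V : Type} (G : SimpleGraph V) (f : ℕ → V) (s j : ℕ) : List ℕ :=
  (List.range s).filter fun i => G.Adj (f i) (f j)

noncomputable def doneRows {V : Type} (G : SimpleGraph V) (f : ℕ → V) (u : ℕ) : List (List ℕ) :=
  (List.range u).map fun j => back G f j j

noncomputable def queue {V : Type} (G : SimpleGraph V) (lev : V → ℕ) (f : ℕ → V) (u n : ℕ) :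
    List (ℕ × List ℕ) :=
  (List.range' u n).map fun j => (lev (f j), back G f u j)

section
variable {V : Type} {G : SimpleGraph V} {f f' : ℕ → V} {s j i : ℕ}

theorem mem_back : i ∈ back G f s j ↔ i < s ∧ G.Adj (f i) (f j) := by simp [back]

theorem nodup_back : (back G f s j).Nodup := List.Nodup.filter _ List.nodup_range

theorem back_congr (h : ∀ i < s, f' i = f i) (hj : f' j = f j) : back G f' s j = back G f s j := by
  unfold back
  refine List.filter_congr fun i hi => ?_
  rw [h i (by simpa using hi), hj]

open Classical in
theorem back_succ : back G f (s + 1) j =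
    if G.Adj (f s) (f j) then back G f s j ++ [s] else back G f s j := by
  unfold back
  rw [List.range_succ, List.filter_append]
  split_ifs with h <;> simp [h]

@[simp] theorem length_doneRows : (doneRows G f s).length = s := by simp [doneRows]

theorem getD_doneRows (h : j < s) : (doneRows G f s).getD j [] = back G f j j := by
  rw [List.getD_eq_getElem _ _ (by simpa using h)]
  simp [doneRows]

/-- A set enumerated injectively induces the graph described by its rows. -/
noncomputable def doneIso (hf : ∀ i < s, ∀ j < s, f i = f j → i = j) :
    codeGraph (doneRows G f s) s ≃g G.induce {v | ∃ i < s, f i = v} where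
  toEquiv := Equiv.ofBijective (fun i => ⟨f i.1, i.1, i.2, rfl⟩) ⟨fun i j h =>
    Fin.ext (hf i.1 i.2 j.1 j.2 (congrArg Subtype.val h)), by
      rintro ⟨v, i, hi, rfl⟩; exact ⟨⟨i, hi⟩, rfl⟩⟩
  map_rel_iff' := by
    intro i j
    change G.Adj (f i.1) (f j.1) ↔ (i < j ∧ _) ∨ (j < i ∧ _)
    rw [getD_doneRows i.2, getD_doneRows j.2, mem_back, mem_back]
    rcases lt_trichotomy i j with hlt | heq | hgt
    · simp [hlt, hlt.not_gt]
    · simp [heq]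
    · have : i.1 > j.1 := hgt
      simp [hgt, hgt.not_gt, this, SimpleGraph.adj_comm]

end

/-- The vertices `f 0, …, f (k - 1)` are discovered in breadth first order, and the first `u`
of them are processed. -/
structure Inv (R : RGraph) (lev : R.V → ℕ) (f : ℕ → R.V) (u k : ℕ) : Prop where
  le : u ≤ k
  pos : 0 < k
  inj : ∀ i < k, ∀ j < k, f i = f j → i = j
  root : f 0 = R.root
  closed : ∀ i < u, ∀ v, R.G.Adj (f i) v → ∃ j < k, f j = v
  mono : ∀ i j, i ≤ j → j < k → lev (f i) ≤ lev (f j)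
  known : u < k → ∀ v, lev v ≤ lev (f u) → ∃ j < k, f j = v
  next : u < k → ∀ j < k, lev (f j) ≤ lev (f u) + 1

theorem Inv.step {R : RGraph} {lev : R.V → ℕ} {e : ℕ} (hR : IsTail R lev e) {f : ℕ → R.V}
    {u k : ℕ} (h : Inv R lev f u k) (hu : u < k) : ∃ f' c, Inv R lev f' (u + 1) (k + c) ∧
      (∀ i < k, f' i = f i) ∧
      ∀ i, k ≤ i → i < k + c → R.G.Adj (f u) (f' i) ∧ lev (f' i) = lev (f u) + 1 ∧
        ∀ j < u, ¬ R.G.Adj (f j) (f' i) := by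
  classical
  have := hR.finite
  set F : Set R.V := {v | R.G.Adj (f u) v ∧ ∀ j < k, f j ≠ v} with hF
  set L := (Set.toFinite F).toFinset.toList with hL
  have hLm : ∀ v, v ∈ L ↔ R.G.Adj (f u) v ∧ ∀ j < k, f j ≠ v := by simp [hL, hF]
  have hLn : L.Nodup := Finset.nodup_toList _
  set c := L.length with hc
  let f' : ℕ → R.V := fun i => if i < k then f i else L.getD (i - k) R.root
  have hold : ∀ i < k, f' i = f i := fun i hi => by simp [f', hi]
  have hnew : ∀ i, (hk : k ≤ i) → (hi : i < k + c) → f' i = L[i - k]'(by omega) := by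
    intro i hk hi
    simp only [f', hk.not_gt, if_false]
    exact List.getD_eq_getElem _ _ _
  have hmem : ∀ i, k ≤ i → i < k + c → f' i ∈ L := fun i hk hi => by
    rw [hnew i hk hi]; exact List.getElem_mem _
  have hlev : ∀ v ∈ L, lev v = lev (f u) + 1 := by
    intro v hv
    obtain ⟨h1, h2⟩ := (hLm v).mp hv
    have h3 := hR.isLevel.lip _ _ h1
    by_contra hne
    obtain ⟨j, hj, hjv⟩ := h.known hu v (by omega)
    exact h2 j hj hjv
  have hclosed : ∀ i < u + 1, ∀ v, R.G.Adj (f' i) v → ∃ j < k + c, f' j = v := by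
    intro i hi v hv
    rw [hold i (by omega)] at hv
    by_cases hv' : ∃ j < k, f j = v
    · obtain ⟨j, hj, rfl⟩ := hv'
      exact ⟨j, by omega, hold j hj⟩
    · have hiu : i = u := by
        by_contra hne
        exact hv' (h.closed i (by omega) v hv)
      subst hiu
      push Not at hv'
      obtain ⟨n, hn, rfl⟩ := List.getElem_of_mem ((hLm v).mpr ⟨hv, hv'⟩)
      exact ⟨k + n, by omega, by rw [hnew _ (by omega) (by omega)]; simp⟩
  have hmono : ∀ i j, i ≤ j → j < k + c → lev (f' i) ≤ lev (f' j) := by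
    intro i j hij hj
    by_cases hjk : j < k
    · rw [hold i (by omega), hold j hjk]; exact h.mono i j hij hjk
    · rw [hlev _ (hmem j (by omega) hj)]
      by_cases hik : i < k
      · rw [hold i hik]; exact h.next hu i hik
      · rw [hlev _ (hmem i (by omega) (by omega))]
  refine ⟨f', c, ⟨by omega, by omega, ?_, by rw [hold 0 h.pos, h.root], hclosed, hmono, ?_, ?_⟩,
    hold, ?_⟩
  · intro i hi j hj hij
    by_cases hik : i < k <;> by_cases hjk : j < k
    · rw [hold i hik, hold j hjk] at hij; exact h.inj i hik j hjk hij
    · rw [hold i hik] at hij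
      exact absurd hij (((hLm _).mp (hmem j (by omega) hj)).2 i hik)
    · rw [hold j hjk] at hij
      exact absurd hij.symm (((hLm _).mp (hmem i (by omega) hi)).2 j hjk)
    · rw [hnew i (by omega) hi, hnew j (by omega) hj, hLn.getElem_inj_iff] at hij
      omega
  · intro huk v hv
    have hl1 : lev (f' u) ≤ lev (f' (u + 1)) := hmono _ _ (by omega) huk
    rw [hold u hu] at hl1
    have hl2 : lev (f' (u + 1)) ≤ lev (f u) + 1 := by
      by_cases hk : u + 1 < k
      · rw [hold _ hk]; exact h.next hu _ hk
      · rw [hlev _ (hmem _ (by omega) huk)]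
    by_cases hv' : lev v ≤ lev (f u)
    · obtain ⟨j, hj, rfl⟩ := h.known hu v hv'
      exact ⟨j, by omega, hold j hj⟩
    · have hne : v ≠ R.root := by
        rintro rfl
        rw [hR.isLevel.root] at hv'
        omega
      obtain ⟨w, hw, hwl⟩ := hR.isLevel.pred v hne
      obtain ⟨j, hj, rfl⟩ := h.known hu w (by omega)
      have hju : j < u + 1 := by
        by_contra hju
        have := hmono (u + 1) j (by omega) (by omega)
        rw [hold j hj] at this
        omega
      exact hclosed j hju v (by rwa [hold j hj])
  · intro huk j hj
    have hl1 : lev (f' u) ≤ lev (f' (u + 1)) := hmono _ _ (by omega) huk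
    rw [hold u hu] at hl1
    by_cases hjk : j < k
    · rw [hold j hjk]
      have := h.next hu j hjk
      omega
    · rw [hlev _ (hmem j (by omega) hj)]
      omega
  · intro i hk hi
    have hm := hmem i hk hi
    refine ⟨((hLm _).mp hm).1, hlev _ hm, fun j hj hadj => ?_⟩
    obtain ⟨a, ha, hav⟩ := h.closed j hj _ hadj
    exact ((hLm _).mp hm).2 a ha hav

theorem ncard_eq_length {V : Type} (s : Set V) (L : List V) (hL : L.Nodup) (h : ∀ v, v ∈ s ↔ v ∈ L) :
    s.ncard = L.length := by
  classical
  have : s = (L.toFinset : Set V) := by ext v; simp [h]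
  rw [this, Set.ncard_coe_finset, List.toFinset_card_of_nodup hL]

theorem length_le_ncard {V : Type} [Finite V] (s : Set V) (L : List V) (hL : L.Nodup)
    (h : ∀ v ∈ L, v ∈ s) : L.length ≤ s.ncard := by
  rw [← ncard_eq_length {v | v ∈ L} L hL (fun v => Iff.rfl)]
  exact Set.ncard_le_ncard h (Set.toFinite _)

theorem Inv.deg {R : RGraph} {lev : R.V → ℕ} {e : ℕ} (hR : IsTail R lev e) {f : ℕ → R.V} {u k : ℕ}
    (h : Inv R lev f u k) {j : ℕ} (hj : j < k) :
    (R.G.neighborSet (f j)).ncard = if j = 0 then 2 else 3 := by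
  split_ifs with hj0
  · rw [hj0, h.root, hR.deg_root]
  · refine hR.deg _ fun h' => hj0 ?_
    rw [← h.root] at h'
    exact h.inj _ hj _ h.pos h'

open Classical in
/-- The number of neighbours of the vertex being processed. -/
theorem Inv.count {R : RGraph} {lev : R.V → ℕ} {e : ℕ} (hR : IsTail R lev e) {f f' : ℕ → R.V}
    {u k c : ℕ} (h : Inv R lev f u k) (hu : u < k) (h' : Inv R lev f' (u + 1) (k + c))
    (hold : ∀ i < k, f' i = f i) (hnew : ∀ i, k ≤ i → i < k + c → R.G.Adj (f u) (f' i)) :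
    (back R.G f u u).length +
      ((List.range' (u + 1) (k - (u + 1))).countP (fun j => R.G.Adj (f u) (f j)) + c) =
      if u = 0 then 2 else 3 := by
  rw [← h.deg hR hu]
  have hinj := h'.inj
  have h0 : (R.G.neighborSet (f u)).ncard =
      (((List.range (k + c)).filter fun j => R.G.Adj (f u) (f' j)).map f').length := by
    refine ncard_eq_length _ _ ?_ ?_
    · refine List.Nodup.map_on ?_ (List.Nodup.filter _ List.nodup_range)
      intro i hi j hj hij
      simp at hi hj
      exact hinj i hi.1 j hj.1 hij
    · intro v
      simp only [SimpleGraph.mem_neighborSet, List.mem_map, List.mem_filter, List.mem_range,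
        decide_eq_true_eq]
      constructor
      · intro hv
        obtain ⟨j, hj, rfl⟩ := h'.closed u (by omega) v (by rwa [hold u hu])
        exact ⟨j, ⟨hj, hv⟩, rfl⟩
      · rintro ⟨j, ⟨-, hv⟩, rfl⟩
        exact hv
  rw [h0, List.length_map]
  have hsplit : List.range (k + c) = List.range u ++ [u] ++ List.range' (u + 1) (k - (u + 1)) ++
      List.range' k c := by
    have h1 := List.range'_append_1 (s := 0) (m := u + 1) (n := k - (u + 1))
    rw [show 0 + (u + 1) = u + 1 by omega, show u + 1 + (k - (u + 1)) = k by omega] at h1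
    have h2 := List.range'_append_1 (s := 0) (m := k) (n := c)
    rw [show 0 + k = k by omega] at h2
    rw [← List.range_succ, List.range_eq_range', List.range_eq_range', Nat.succ_eq_add_one, h1, h2]
  rw [hsplit, List.filter_append, List.filter_append, List.filter_append, List.length_append,
    List.length_append, List.length_append]
  have e1 : ((List.range u).filter fun j => decide (R.G.Adj (f u) (f' j))) = back R.G f u u := by
    unfold back
    refine List.filter_congr fun i hi => ?_
    rw [hold i (by simp at hi; omega), SimpleGraph.adj_comm]
  have e2 : ([u].filter fun j => decide (R.G.Adj (f u) (f' j))) = [] := by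
    simp [hold u hu]
  have e3 : ((List.range' (u + 1) (k - (u + 1))).filter fun j =>
      decide (R.G.Adj (f u) (f' j))).length =
      (List.range' (u + 1) (k - (u + 1))).countP (fun j => R.G.Adj (f u) (f j)) := by
    rw [← List.countP_eq_length_filter]
    refine List.countP_congr fun i hi => ?_
    simp at hi
    rw [hold i (by omega)]
  have e4 : ((List.range' k c).filter fun j => decide (R.G.Adj (f u) (f' j))) =
      List.range' k c := by
    rw [List.filter_eq_self]
    intro i hi
    simp at hi
    simpa using hnew i hi.1 hi.2
  rw [e1, e2, e3, e4]
  simp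
  omega

theorem queue_succ {V : Type} {G : SimpleGraph V} {lev : V → ℕ} {f : ℕ → V} {u n : ℕ} :
    queue G lev f u (n + 1) = (lev (f u), back G f u u) ::
      (List.range' (u + 1) n).map fun j => (lev (f j), back G f u j) := by
  simp [queue, List.range'_succ]

/-- Once everything discovered is processed, all vertices are known. -/
theorem Inv.iso {R : RGraph} {lev : R.V → ℕ} {e : ℕ} (hR : IsTail R lev e) {f : ℕ → R.V} {k : ℕ}
    (h : Inv R lev f k k) : ∀ v, ∃ i < k, f i = v :=
  hR.isLevel.induct ⟨0, h.pos, h.root⟩ (by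
    rintro w v hwv - ⟨i, hi, rfl⟩
    exact h.closed i hi v hwv)

theorem search_leaf {R : RGraph} {lev : R.V → ℕ} {e : ℕ} (hR : IsTail R lev e)
    (hm : 2 * Nat.card R.V ≤ 3 * (e + 1) + 8) {f : ℕ → R.V} {k lmax : ℕ} (h : Inv R lev f k k)
    (hl : ∃ i < k, lev (f i) = lmax) (hl' : ∀ i < k, lev (f i) ≤ lmax)
    (hs : (Nat.blt (3 * (lmax + 1) + 8) (2 * (doneRows R.G f k).length) ||
      (List.finRange 19).any fun i => isoCode (doneRows R.G f k) (ecode i)) = true) :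
    ∃ E, R.Iso (endR E) := by
  have hsurj := h.iso hR
  have he : lmax = e := by
    obtain ⟨v, hv⟩ := hR.attained
    obtain ⟨i, hi, rfl⟩ := hsurj v
    obtain ⟨j, hj, rfl⟩ := hl
    have := hl' i hi
    have := hR.le (f j)
    omega
  let ψ : R.G.induce {v | ∃ i < k, f i = v} ≃g R.G :=
    ⟨Equiv.subtypeUnivEquiv hsurj, Iff.rfl⟩
  let φ : codeGraph (doneRows R.G f k) k ≃g R.G := (doneIso h.inj).trans ψ
  have hφ : ∀ i, φ i = f i.1 := fun i => rfl
  have hcard : Nat.card R.V = k := by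
    rw [← Nat.card_congr φ.toEquiv, Nat.card_fin]
  rw [Bool.or_eq_true, Nat.blt_eq, length_doneRows, List.any_eq_true] at hs
  rcases hs with hs | ⟨E, -, hE⟩
  · omega
  · refine ⟨E, RGraph.Iso.symm ?_⟩
    obtain ⟨ψ, hψ⟩ := iso_of_isoCode (wfCode_ecode E) length_doneRows (length_ecode E) h.pos hE
    refine ⟨ψ.symm.trans φ, ?_⟩
    have h0 : ψ ⟨0, h.pos⟩ = (endR E).root := Fin.ext (hψ _ rfl)
    rw [← h0]
    exact (congrArg φ (ψ.symm_apply_apply _)).trans ((hφ _).trans h.root)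

theorem search_sound {R : RGraph} {lev : R.V → ℕ} {e : ℕ} (hR : IsTail R lev e)
    (hm : 2 * Nat.card R.V ≤ 3 * (e + 1) + 8) (fuel : ℕ) {f : ℕ → R.V} {u k lmax : ℕ}
    (h : Inv R lev f u k) (hl : ∃ i < k, lev (f i) = lmax) (hl' : ∀ i < k, lev (f i) ≤ lmax)
    (hs : search fuel (doneRows R.G f u) (queue R.G lev f u (k - u)) lmax = true) :
    (∃ E, R.Iso (endR E)) ∨ ∃ f u, Inv R lev f u (u + 1) ∧ (back R.G f u u).length = 1 ∧
      (3 * lev (f u) + 3 < 2 * u ∨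
        ∃ x, doneRows R.G f u = pcode x ∧ back R.G f u u = [5 + 2 * pex x]) := by
  classical
  have := hR.finite
  induction fuel generalizing f u k lmax with
  | zero => exact absurd hs (by simp [search])
  | succ fuel ih =>
    rcases h.le.eq_or_lt with rfl | hu
    · rw [Nat.sub_self] at hs
      exact .inl (search_leaf hR hm h hl hl' hs)
    obtain ⟨n, rfl⟩ : ∃ n, k = u + 1 + n := ⟨k - (u + 1), by omega⟩
    rw [show u + 1 + n - u = n + 1 by omega, queue_succ, search] at hs
    split at hs
    · next hmid =>
      rw [Bool.and_eq_true, List.isEmpty_iff, beq_iff_eq] at hmid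
      obtain ⟨hn, hb⟩ := hmid
      have hn : n = 0 := by simpa using hn
      subst hn
      refine .inr ⟨f, u, h, hb, ?_⟩
      rw [Bool.or_eq_true, Nat.blt_eq, length_doneRows, List.any_eq_true] at hs
      rcases hs with hs | ⟨x, -, hx⟩
      · exact .inl hs
      · rw [Bool.and_eq_true, beq_iff_eq, beq_iff_eq] at hx
        exact .inr ⟨x, hx.1.symm, hx.2⟩
    · obtain ⟨f', c, h', hold, hnew⟩ := h.step hR hu
      have hcount := h.count hR hu h' hold fun i hi hi' => (hnew i hi hi').1
      rw [show u + 1 + n - (u + 1) = n by omega] at hcount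
      have hmem := choices_mem u (back R.G f u u) (fun j => R.G.Adj (f u) (f j))
        (fun j => (lev (f j), back R.G f u j)) (List.range' (u + 1) n)
        ((if u = 0 then 2 else 3) - (back R.G f u u).length) c (by omega) (by
          intro j hj hadj
          rw [decide_eq_true_eq] at hadj
          rw [List.mem_range'_1] at hj
          constructor
          · have h1 := length_le_ncard (R.G.neighborSet (f j)) ((back R.G f (u + 1) j).map f)
              (List.Nodup.map_on (fun a ha b hb hab => by
                rw [mem_back] at ha hb
                exact h.inj a (by omega) b (by omega) hab) nodup_back) (by
              intro v hv
              obtain ⟨i, hi, rfl⟩ := List.mem_map.mp hv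
              exact (mem_back.mp hi).2.symm)
            rw [h.deg hR (by omega), List.length_map, back_succ, if_pos hadj, if_neg (by omega)] at h1
            simp at h1
            omega
          · intro i hi hi'
            exact hR.tri _ _ _ (mem_back.mp hi).2 hadj.symm (mem_back.mp hi').2.symm)
      have hemp : (doneRows R.G f u).isEmpty = true ↔ u = 0 := by
        rw [List.isEmpty_iff, ← List.length_eq_zero_iff, length_doneRows]
      simp only [length_doneRows, hemp, List.all_eq_true] at hs
      have hs := hs _ hmem
      simp only [List.length_map, List.length_range'] at hs
      have hlmax : (∃ i < u + 1 + n + c, lev (f' i) = if (c == 0) = true then lmax else lev (f u) + 1) ∧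
          ∀ i < u + 1 + n + c, lev (f' i) ≤ if (c == 0) = true then lmax else lev (f u) + 1 := by
        split_ifs with hc
        · rw [beq_iff_eq] at hc
          subst hc
          obtain ⟨i, hi, hil⟩ := hl
          exact ⟨⟨i, hi, by rw [hold i hi, hil]⟩, fun i hi => by rw [hold i hi]; exact hl' i hi⟩
        · rw [beq_iff_eq] at hc
          refine ⟨⟨u + 1 + n, by omega, (hnew _ le_rfl (by omega)).2.1⟩, fun i hi => ?_⟩
          by_cases hin : i < u + 1 + n
          · rw [hold i hin]; exact h.next hu i hin
          · exact (hnew i (by omega) hi).2.1.le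
      set lmax' := if (c == 0) = true then lmax else lev (f u) + 1
      obtain ⟨hl1, hl2⟩ := hlmax
      rw [Bool.or_eq_true, Nat.blt_eq] at hs
      rcases hs with hs | hs
      · obtain ⟨i, hi, hil⟩ := hl1
        have h1 := hR.ncard_le hm (i := lmax') (by rw [← hil]; exact hR.le _)
        have h2 := length_le_ncard {v | lev v ≤ lmax'} ((List.range (u + 1 + n + c)).map f')
          (List.Nodup.map_on (fun a ha b hb hab => h'.inj a (by simpa using ha) b (by simpa using hb)
            hab) List.nodup_range) (by
          intro v hv
          obtain ⟨j, hj, rfl⟩ := List.mem_map.mp hv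
          exact hl2 j (by simpa using hj))
        simp at h2
        omega
      · refine ih h' hl1 hl2 ?_
        convert hs using 2
        · unfold doneRows
          rw [List.range_succ, List.map_append]
          congr 1
          · refine List.map_congr_left fun j hj => ?_
            rw [List.mem_range] at hj
            exact back_congr (fun i hi => hold i (by omega)) (hold j (by omega))
          · simp only [List.map_cons, List.map_nil]
            rw [back_congr (fun i hi => hold i (by omega)) (hold u (by omega))]
        · unfold queue
          rw [show u + 1 + n + c - (u + 1) = n + c by omega, ← List.range'_append_1, List.map_append]
          congr 1
          · refine List.map_congr_left fun j hj => ?_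
            rw [List.mem_range'_1] at hj
            rw [hold j (by omega), back_congr (fun i hi => hold i (by omega)) (hold j (by omega)),
              back_succ]
            by_cases hadj : R.G.Adj (f u) (f j) <;> simp [hadj]
          · rw [List.eq_replicate_iff]
            refine ⟨by simp, ?_⟩
            intro b hb
            obtain ⟨j, hj, rfl⟩ := List.mem_map.mp hb
            rw [List.mem_range'_1] at hj
            obtain ⟨h1, h2, h3⟩ := hnew j (by omega) (by omega)
            rw [h2, back_succ, hold u (by omega), if_pos h1]
            have h4 : back R.G f' u j = [] := by
              rw [List.eq_nil_iff_forall_not_mem]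
              intro i hi
              obtain ⟨hi1, hi2⟩ := mem_back.mp hi
              rw [hold i (by omega)] at hi2
              exact h3 i hi1 hi2
            rw [h4]; rfl

theorem tail_cases {R : RGraph} {lev : R.V → ℕ} {e : ℕ} (hR : IsTail R lev e)
    (hm : 2 * Nat.card R.V ≤ 3 * (e + 1) + 8) :
    (∃ E, R.Iso (endR E)) ∨ ∃ f u, Inv R lev f u (u + 1) ∧ (back R.G f u u).length = 1 ∧
      (3 * lev (f u) + 3 < 2 * u ∨
        ∃ x, doneRows R.G f u = pcode x ∧ back R.G f u u = [5 + 2 * pex x]) := by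
  refine search_sound hR hm 40 (f := fun _ => R.root) (u := 0) (k := 1) (lmax := 0) ?_ ?_ ?_ ?_
  · refine ⟨by omega, by omega, fun i hi j hj _ => by omega, rfl, fun i hi => by omega,
      fun i j _ _ => le_rfl, fun _ v hv => ⟨0, by omega, ?_⟩, fun _ j _ => by omega⟩
    rw [hR.isLevel.root] at hv
    exact (hR.isLevel.eq_root (by omega)).symm
  · exact ⟨0, by omega, hR.isLevel.root⟩
  · intro i _; exact hR.isLevel.root.le
  · have h1 : doneRows R.G (fun _ => R.root) 0 = [] := rfl
    have h2 : queue R.G lev (fun _ => R.root) 0 (1 - 0) = [(0, [])] := by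
      simp [queue, back, hR.isLevel.root]
    rw [h1, h2]
    exact search_eq_true

/-! ### Short tails are chains -/

theorem isTail_of_bridge {V : Type} [Finite V] {G : SimpleGraph V} {S : Set V} {s : S}
    {t : (Sᶜ : Set V)} (hst : G.Adj s t) (h : ∀ x ∈ S, ∀ y ∉ S, G.Adj x y → x = s ∧ y = t)
    (hdeg : ∀ v ∉ S, (G.neighborSet v).ncard = 3)
    (tri : ∀ a b c, G.Adj a b → G.Adj b c → G.Adj c a → False)
    {lev : (Sᶜ : Set V) → ℕ} {e : ℕ} (hlev : IsLevel (G.induce Sᶜ) t lev) (le : ∀ v, lev v ≤ e)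
    (att : ∃ v, lev v = e) : IsTail ⟨(Sᶜ : Set V), G.induce Sᶜ, t⟩ lev e where
  finite := inferInstanceAs (Finite (Sᶜ : Set V))
  isLevel := hlev
  deg_root := by
    have h1 := ncard_neighborSet_iso (splitIso G S s t hst h) (.inr t)
    rw [ncard_joinAt_inr] at h1
    have h2 : (splitIso G S s t hst h) (.inr t) = t.1 := rfl
    rw [h2, hdeg t t.2] at h1
    change ((G.induce Sᶜ).neighborSet t).ncard = 2
    omega
  deg v hv := by
    have h1 := ncard_neighborSet_iso (splitIso G S s t hst h) (.inr v)
    rw [ncard_joinAt_inr_of_ne hv] at h1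
    have h2 : (splitIso G S s t hst h) (.inr v) = v.1 := rfl
    rw [h2, hdeg v v.2] at h1
    exact h1
  tri a b c h1 h2 h3 := tri a b c h1 h2 h3
  le := le
  attained := att

theorem isLevel_compl {V : Type} {G : SimpleGraph V} {r : V} {lev : V → ℕ} (hl : IsLevel G r lev)
    {S : Set V} {s : S} {t : (Sᶜ : Set V)} (hr : r ∈ S)
    (h : ∀ x ∈ S, ∀ y ∉ S, G.Adj x y → x = s ∧ y = t) (hge : ∀ v ∉ S, lev t ≤ lev v) :
    IsLevel (G.induce Sᶜ) t (fun v => lev v - lev t) where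
  root := by simp
  pred := by
    rintro ⟨v, hv⟩ hvt
    obtain ⟨w, hwv, hw⟩ := hl.pred v (by rintro rfl; exact hv hr)
    have hwS : w ∉ S := fun hwS => hvt (Subtype.ext (h w hwS v hv hwv).2)
    have := hge w hwS
    exact ⟨⟨w, hwS⟩, hwv, by simp only; omega⟩
  lip u v huv := by
    have := hl.lip u.1 v.1 huv
    have := hge u u.2
    omega

theorem attach_congr (x : Fin 3) {R S : RGraph} (h : R.Iso S) : (attach x R).Iso (attach x S) := by
  obtain ⟨φ, hφ⟩ := h
  exact ⟨joinAtCongr .refl φ rfl hφ, rfl⟩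

theorem exists_doneIso {V : Type} {G : SimpleGraph V} {f : ℕ → V} {s : ℕ} {c : List (List ℕ)}
    (hf : ∀ i < s, ∀ j < s, f i = f j → i = j) (hc : doneRows G f s = c) :
    ∃ φ : codeGraph c s ≃g G.induce {v | ∃ i < s, f i = v}, ∀ i, (φ i).1 = f i.1 := by
  subst hc
  exact ⟨doneIso hf, fun i => rfl⟩

theorem length_pcode : ∀ x, (pcode x).length = 5 + 2 * pex x + 1 := by decide

/-- A short tail is a sequence of pieces closed by an end. -/
theorem IsTail.exists_iso_chain {R : RGraph} {lev : R.V → ℕ} {e : ℕ} (hR : IsTail R lev e)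
    (hm : 2 * Nat.card R.V ≤ 3 * (e + 1) + 8) : ∃ w E, R.Iso (chain w E) := by
  induction hn : Nat.card R.V using Nat.strong_induction_on generalizing R e with
  | _ n ih =>
    subst hn
    rcases tail_cases hR hm with ⟨E, hE⟩ | ⟨f, u, h, hb, hfin⟩
    · exact ⟨[], E, hE⟩
    have := hR.finite
    obtain ⟨q, hq⟩ := List.length_eq_one_iff.mp hb
    have hqu : q < u ∧ R.G.Adj (f q) (f u) := by rw [← mem_back, hq]; simp
    set S : Set R.V := {v | ∃ i < u, f i = v} with hS
    have hinj : ∀ i < u, ∀ j < u, f i = f j → i = j := fun i hi j hj =>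
      h.inj i (by omega) j (by omega)
    have htS : f u ∉ S := by
      rintro ⟨i, hi, hiu⟩
      have := h.inj i (by omega) u (by omega) hiu
      omega
    let s : S := ⟨f q, q, hqu.1, rfl⟩
    let t : (Sᶜ : Set R.V) := ⟨f u, htS⟩
    have hcross : ∀ x ∈ S, ∀ y ∉ S, R.G.Adj x y → x = s ∧ y = t := by
      rintro x ⟨i, hi, rfl⟩ y hy hxy
      obtain ⟨j, hj, rfl⟩ := h.closed i hi y hxy
      obtain rfl : j = u := by
        by_contra hne
        exact hy ⟨j, by omega, rfl⟩
      have : i ∈ back R.G f j j := mem_back.mpr ⟨hi, hxy⟩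
      rw [hq, List.mem_singleton] at this
      subst this
      exact ⟨rfl, rfl⟩
    have hroot : R.root ∈ S := ⟨0, by omega, h.root⟩
    have hge : ∀ v ∉ S, lev (f u) ≤ lev v := by
      intro v hv
      by_contra hlt
      obtain ⟨j, hj, rfl⟩ := h.known (by omega) v (by omega)
      have hju : j = u := by
        by_contra hne
        exact hv ⟨j, by omega, rfl⟩
      subst hju
      omega
    set l := lev (f u) with hl
    have hle : l ≤ e := hR.le _
    set T : RGraph := ⟨(Sᶜ : Set R.V), R.G.induce Sᶜ, t⟩ with hT
    have hTail : IsTail T (fun v : (Sᶜ : Set R.V) => lev v - l) (e - l) := by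
      refine isTail_of_bridge (s := s) hqu.2 hcross
        (fun v hv => hR.deg v (by rintro rfl; exact hv hroot)) hR.tri
        (isLevel_compl hR.isLevel hroot hcross hge) (fun v => ?_) ?_
      · have := hR.le v.1
        omega
      · obtain ⟨v, hv⟩ := hR.attained
        by_cases hvS : v ∈ S
        · refine ⟨t, ?_⟩
          obtain ⟨i, hi, rfl⟩ := hvS
          have : lev (f i) ≤ lev (f u) := h.mono i u (by omega) (by omega)
          change l - l = _
          omega
        · exact ⟨⟨v, hvS⟩, by simp only; omega⟩
    have hcardS : Nat.card S = u := by
      rw [← Nat.card_congr (doneIso (G := R.G) hinj).toEquiv, Nat.card_fin]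
    have hcard : Nat.card S + Nat.card T.V = Nat.card R.V := Set.ncard_add_ncard_compl S
    have hlow : 3 * (e - l + 1) + 5 ≤ 2 * Nat.card T.V := by
      by_contra hlt
      obtain ⟨w, E, φ, hφ⟩ := ih (Nat.card T.V) (by omega) hTail (by omega) rfl
      have h1 := hTail.ecc_unique ((isTail_chain w E).comap φ hφ)
      have h2 := Nat.card_congr φ.toEquiv
      rw [card_chain] at h2
      rw [chainEcc] at h1
      omega
    rcases hfin with hfin | ⟨x, hx, hxb⟩
    · omega
    have hu : u = 5 + 2 * pex x + 1 := by
      rw [← length_doneRows (G := R.G) (f := f) (s := u), hx, length_pcode]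
    subst hu
    obtain ⟨φ, hφ⟩ := exists_doneIso hinj hx
    have hiso : (attach x T).Iso R := by
      refine ⟨(joinAtCongr φ .refl (a' := s) (Subtype.ext ?_) rfl).trans
        (splitIso R.G S s t hqu.2 hcross), ?_⟩
      · rw [hq, List.singleton_inj] at hxb
        rw [hφ]
        simp [s, hxb]
      · exact (hφ 0).trans h.root
    obtain ⟨ψ, hψ⟩ := hiso
    have he := (isTail_attach x hTail).ecc_unique (hR.comap ψ hψ)
    obtain ⟨w, E, hwE⟩ := ih (Nat.card T.V) (by omega) hTail (by omega) rfl
    exact ⟨x :: w, E, (RGraph.Iso.symm ⟨ψ, hψ⟩).trans (attach_congr x hwE)⟩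

/-! ### Existence of a bridge -/

theorem IsLevel.connected {V : Type*} {G : SimpleGraph V} {r : V} {lev : V → ℕ}
    (h : IsLevel G r lev) : G.Connected := by
  rw [SimpleGraph.connected_iff_exists_forall_reachable]
  refine ⟨r, fun v => SimpleGraph.reachable_of_edist_ne_top fun ht => ?_⟩
  have := h.edist_le v
  rw [ht] at this
  simp at this

theorem ncard_union_neighborSet {V : Type*} [Finite V] {G : SimpleGraph V}
    (hdeg : ∀ v, (G.neighborSet v).ncard = 3)
    (tri : ∀ a b c, G.Adj a b → G.Adj b c → G.Adj c a → False) {a b : V} (h : G.Adj a b) :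
    (G.neighborSet a ∪ G.neighborSet b).ncard = 6 := by
  rw [Set.ncard_union_eq, hdeg, hdeg]
  rw [Set.disjoint_left]
  intro c hac hbc
  exact tri a b c h hbc hac.symm

/-- A cubic triangle-free graph with few vertices has a layer consisting of one vertex. -/
theorem exists_singleton_layer {V : Type} [Finite V] {G : SimpleGraph V} {d : ℕ} (hd : 9 ≤ d)
    (hdeg : ∀ v, (G.neighborSet v).ncard = 3)
    (tri : ∀ a b c, G.Adj a b → G.Adj b c → G.Adj c a → False)
    (hn : Nat.card V ≤ 2 * d + 2) {x : V} {lev : V → ℕ} (hl : IsLevel G x lev)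
    (att : ∃ v, lev v = d) :
    ∃ i v, 3 ≤ i ∧ i + 3 ≤ d ∧ ∀ u, lev u = i ↔ u = v := by
  obtain ⟨y, hy⟩ := att
  by_contra hno
  have htwo : ∀ i, 3 ≤ i → i + 3 ≤ d → 2 ≤ {v | lev v = i}.ncard := by
    intro i h3 hi
    obtain ⟨w, hw⟩ := hl.exists_lt (v := y) (i := i) (by omega)
    have hpos : 0 < {v | lev v = i}.ncard := (Set.ncard_pos).mpr ⟨w, hw⟩
    by_contra hlt
    obtain ⟨v, hv⟩ := Set.ncard_eq_one.mp (show {v | lev v = i}.ncard = 1 by omega)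
    refine hno ⟨i, v, h3, hi, fun u => ?_⟩
    have : u ∈ {v | lev v = i} ↔ u ∈ ({v} : Set V) := by rw [hv]
    simpa using this
  have hmid : ∀ m, m + 5 ≤ d → 2 * m ≤ {v | 3 ≤ lev v ∧ lev v < 3 + m}.ncard := by
    intro m
    induction m with
    | zero => simp
    | succ m ih =>
      intro hm
      have h1 := ih (by omega)
      have h2 := htwo (3 + m) (by omega) (by omega)
      have h3 : {v | 3 ≤ lev v ∧ lev v < 3 + (m + 1)} =
          {v | 3 ≤ lev v ∧ lev v < 3 + m} ∪ {v | lev v = 3 + m} := by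
        ext v; simp only [Set.mem_ofPred_eq, Set.mem_union]; omega
      rw [h3, Set.ncard_union_eq]
      · omega
      · rw [Set.disjoint_left]
        intro v hv hv'
        simp only [Set.mem_ofPred_eq] at hv hv'
        omega
  have hbot : 7 ≤ {v | lev v < 3}.ncard := by
    obtain ⟨w, hw⟩ := hl.exists_lt (v := y) (i := 3) (by omega)
    obtain ⟨p, hpw, hp⟩ := hl.pred w (by rintro rfl; rw [hl.root] at hw; omega)
    obtain ⟨a, hxa, hap⟩ : ∃ a, G.Adj x a ∧ ¬ G.Adj a p := by
      by_contra hall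
      push Not at hall
      have hsub : insert w (G.neighborSet x) ⊆ G.neighborSet p := by
        rintro c (rfl | hc)
        · exact hpw
        · exact (hall c hc).symm
      have := Set.ncard_le_ncard hsub
      rw [Set.ncard_insert_of_notMem, hdeg, hdeg] at this
      · omega
      · intro hxw
        have := hl.lip _ _ hxw
        rw [hl.root] at this
        omega
    have h6 := ncard_union_neighborSet hdeg tri hxa
    have ha : lev a ≤ 1 := by have := hl.lip _ _ hxa; rw [hl.root] at this; omega
    have hsub : insert p (G.neighborSet x ∪ G.neighborSet a) ⊆ {v | lev v < 3} := by
      rintro c (rfl | hc | hc)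
      · simp only [Set.mem_ofPred_eq]; omega
      · have := hl.lip _ _ hc
        rw [hl.root] at this
        simp only [Set.mem_ofPred_eq]; omega
      · have := hl.lip _ _ hc
        simp only [Set.mem_ofPred_eq]; omega
    have := Set.ncard_le_ncard hsub
    rw [Set.ncard_insert_of_notMem, h6] at this
    · exact this
    · rintro (hxp | hxp)
      · have := hl.lip _ _ hxp
        rw [hl.root] at this
        omega
      · exact hap hxp
  have htop : 6 ≤ {v | d ≤ lev v + 2}.ncard := by
    obtain ⟨z, hz, -⟩ := hl.pred y (by rintro rfl; rw [hl.root] at hy; omega)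
    rw [← ncard_union_neighborSet hdeg tri hz]
    refine Set.ncard_le_ncard ?_
    have := hl.lip _ _ hz
    rintro c (hc | hc)
    · have := hl.lip _ _ hc.symm
      simp only [Set.mem_ofPred_eq]; omega
    · have := hl.lip _ _ hc.symm
      simp only [Set.mem_ofPred_eq]; omega
  have hm := hmid (d - 5) (by omega)
  have hu : {v | lev v < 3} ∪ {v | 3 ≤ lev v ∧ lev v < 3 + (d - 5)} ∪ {v | d ≤ lev v + 2} =
      Set.univ := by
    ext v
    simp only [Set.mem_union, Set.mem_ofPred_eq, Set.mem_univ, iff_true]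
    omega
  have hcard := Set.ncard_univ V
  rw [← hu, Set.ncard_union_eq, Set.ncard_union_eq] at hcard
  · omega
  all_goals
    rw [Set.disjoint_left]
    intro v hv hv'
    simp only [Set.mem_ofPred_eq, Set.mem_union] at hv hv'
    omega

/-- A cubic triangle-free graph with few vertices has a bridge between two layers. -/
theorem exists_layer_bridge {V : Type} [Finite V] {G : SimpleGraph V} {d : ℕ} (hd : 9 ≤ d)
    (hdeg : ∀ v, (G.neighborSet v).ncard = 3)
    (tri : ∀ a b c, G.Adj a b → G.Adj b c → G.Adj c a → False)
    (hn : Nat.card V ≤ 2 * d + 2) {x : V} {lev : V → ℕ} (hl : IsLevel G x lev)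
    (att : ∃ v, lev v = d) :
    ∃ s t, G.Adj s t ∧ lev t = lev s + 1 ∧
      ∀ a b, lev a < lev t → lev t ≤ lev b → G.Adj a b → a = s ∧ b = t := by
  obtain ⟨i, v, h3, hi, hv⟩ := exists_singleton_layer hd hdeg tri hn hl att
  obtain ⟨y, hy⟩ := att
  have hvi : lev v = i := (hv v).mpr rfl
  set B := {u | G.Adj v u ∧ lev u + 1 = i} with hB
  set F := {u | G.Adj v u ∧ lev u = i + 1} with hF
  have hBF : B.ncard + F.ncard = 3 := by
    rw [← hdeg v, ← Set.ncard_union_eq]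
    · congr 1
      ext u
      simp only [hB, hF, Set.mem_union, Set.mem_ofPred_eq, SimpleGraph.mem_neighborSet]
      constructor
      · rintro (h | h) <;> exact h.1
      · intro h
        have h1 := hl.lip _ _ h
        have h2 := hl.lip _ _ h.symm
        have h4 : lev u ≠ i := fun h5 => h.ne ((hv u).mp h5).symm
        by_cases h5 : lev u < i
        · left; exact ⟨h, by omega⟩
        · right; exact ⟨h, by omega⟩
    · rw [Set.disjoint_left]
      rintro u ⟨-, h1⟩ ⟨-, h2⟩
      omega
  have hBpos : 0 < B.ncard := by
    obtain ⟨w, hw, hw'⟩ := hl.pred v (by rintro rfl; rw [hl.root] at hvi; omega)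
    exact (Set.ncard_pos).mpr ⟨w, hw.symm, by omega⟩
  have hFpos : 0 < F.ncard := by
    obtain ⟨u, hu⟩ := hl.exists_lt (v := y) (i := i + 1) (by omega)
    obtain ⟨w, hw, hw'⟩ := hl.pred u (by rintro rfl; rw [hl.root] at hu; omega)
    obtain rfl := (hv w).mp (by omega)
    exact (Set.ncard_pos).mpr ⟨u, hw, hu⟩
  by_cases hB1 : B.ncard = 1
  · obtain ⟨s, hs⟩ := Set.ncard_eq_one.mp hB1
    have hsB : s ∈ B := by rw [hs]; rfl
    refine ⟨s, v, hsB.1.symm, by have := hsB.2; omega, ?_⟩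
    intro a b ha hb hab
    have := hl.lip _ _ hab
    obtain rfl := (hv b).mp (by omega)
    refine ⟨?_, rfl⟩
    have : a ∈ B := ⟨hab.symm, by omega⟩
    rwa [hs] at this
  · obtain ⟨t, ht⟩ := Set.ncard_eq_one.mp (show F.ncard = 1 by omega)
    have htF : t ∈ F := by rw [ht]; rfl
    have htl : lev t = i + 1 := htF.2
    refine ⟨v, t, htF.1, by omega, ?_⟩
    intro a b ha hb hab
    have := hl.lip _ _ hab
    obtain rfl := (hv a).mp (by omega)
    refine ⟨rfl, ?_⟩
    have : b ∈ F := ⟨hab, by omega⟩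
    rwa [ht] at this

/-- A cubic triangle-free graph with few vertices consists of two tails joined by a bridge. -/
theorem exists_tails {V : Type} [Finite V] {G : SimpleGraph V} {d : ℕ} (hd : 9 ≤ d)
    (hdeg : ∀ v, (G.neighborSet v).ncard = 3)
    (tri : ∀ a b c, G.Adj a b → G.Adj b c → G.Adj c a → False)
    (hdiam : G.ediam = d) (hn : Nat.card V ≤ 2 * d + 2) :
    ∃ (R S : RGraph) (l : R.V → ℕ) (l' : S.V → ℕ) (e e' : ℕ), IsTail R l e ∧ IsTail S l' e' ∧
      e + 1 + e' = d ∧ Nonempty (joinAt R.G R.root S.G S.root ≃g G) := by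
  have hne : Nontrivial V := SimpleGraph.nontrivial_of_ediam_ne_zero (G := G)
    (by rw [hdiam]; norm_cast; omega)
  have hconn : G.Connected := SimpleGraph.connected_of_ediam_ne_top (by rw [hdiam]; simp)
  obtain ⟨x, y, hxy⟩ := G.exists_edist_eq_ediam_of_finite
  rw [hdiam] at hxy
  have hl := isLevel_dist hconn x
  set lev := G.dist x with hlev
  have hle : ∀ u v, G.edist u v ≤ d := fun u v => hdiam ▸ SimpleGraph.edist_le_ediam
  have hcast : ∀ v, (lev v : ℕ∞) = G.edist x v := fun v =>
    ENat.natCast_toNat (SimpleGraph.edist_ne_top_iff_reachable.mpr (hconn.preconnected x v))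
  have le : ∀ v, lev v ≤ d := fun v => by
    have := hle x v
    rw [← hcast] at this
    exact_mod_cast this
  have hy : lev y = d := by
    rw [← hcast] at hxy
    exact_mod_cast hxy
  obtain ⟨s, t, hst, hts, hcr⟩ := exists_layer_bridge hd hdeg tri hn hl ⟨y, hy⟩
  set S : Set V := {v | lev v < lev t} with hS
  have hsS : s ∈ S := by simp only [hS, Set.mem_ofPred_eq]; omega
  have htS : t ∉ S := by simp [hS]
  have hxS : x ∈ S := by simp only [hS, Set.mem_ofPred_eq, hl.root]; omega
  have hcross : ∀ a ∈ S, ∀ b ∉ S, G.Adj a b → a = s ∧ b = t := fun a ha b hb =>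
    hcr a b ha (not_lt.mp hb)
  have hlevR := isLevel_compl hl (S := S) (s := ⟨s, hsS⟩) (t := ⟨t, htS⟩) hxS hcross
    (fun v hv => not_lt.mp hv)
  simp only at hlevR
  have hlevL0 : IsLevel (G.induce S) ⟨x, hxS⟩ (fun v => lev v) := by
    refine ⟨hl.root, ?_, fun u v huv => hl.lip _ _ huv⟩
    rintro ⟨v, hv⟩ hvx
    obtain ⟨w, hw, hw'⟩ := hl.pred v (fun h => hvx (Subtype.ext h))
    have hv' : lev v < lev t := hv
    exact ⟨⟨w, show lev w < lev t by omega⟩, hw, hw'⟩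
  have hlevL := isLevel_dist hlevL0.connected ⟨s, hsS⟩
  set m := (G.induce S).dist ⟨s, hsS⟩ with hm
  have : Nonempty S := ⟨⟨s, hsS⟩⟩
  obtain ⟨p, hp⟩ := Finite.exists_max m
  have hp1 : lev s ≤ m p := by
    refine le_trans ?_ (hp ⟨x, hxS⟩)
    have h1 := le_edist_of_lip hlevL0.lip ⟨x, hxS⟩ ⟨s, hsS⟩
    have h2 := hlevL.edist_le ⟨x, hxS⟩
    rw [SimpleGraph.edist_comm] at h1
    have h3 := h1.trans (add_le_add_right h2 _)
    simp only [hl.root] at h3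
    norm_cast at h3
    omega
  have hp2 : m p + 1 + (d - lev t) ≤ d := by
    classical
    have hlip : ∀ u v, G.Adj u v →
        (if h : v ∈ S then m p - m ⟨v, h⟩ else m p + 1 + (lev v - lev t)) ≤
        (if h : u ∈ S then m p - m ⟨u, h⟩ else m p + 1 + (lev u - lev t)) + 1 := by
      intro u v huv
      by_cases hu : u ∈ S <;> by_cases hv : v ∈ S
      · rw [dif_pos hu, dif_pos hv]
        have := hlevL.lip ⟨v, hv⟩ ⟨u, hu⟩ huv.symm
        omega
      · rw [dif_pos hu, dif_neg hv]
        obtain ⟨rfl, rfl⟩ := hcross u hu v hv huv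
        have : m ⟨u, hu⟩ = 0 := hlevL.root
        omega
      · rw [dif_neg hu, dif_pos hv]
        omega
      · rw [dif_neg hu, dif_neg hv]
        have := hl.lip u v huv
        have : lev t ≤ lev u := not_lt.mp hu
        omega
    have h1 := le_edist_of_lip hlip p.1 y
    have hyS : y ∉ S := by
      have := le t
      simp only [hS, Set.mem_ofPred_eq]; omega
    rw [dif_neg hyS, dif_pos p.2, hy] at h1
    have h2 := h1.trans (add_le_add_right (hle p.1 y) _)
    norm_cast at h2
    have h3 : m ⟨p.1, p.2⟩ = m p := rfl
    omega
  have htd := le t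
  have hcompl : Sᶜᶜ = S := compl_compl S
  refine ⟨⟨S, G.induce S, ⟨s, hsS⟩⟩, ⟨(Sᶜ : Set V), G.induce Sᶜ, ⟨t, htS⟩⟩, m,
    fun v => lev v.1 - lev t, m p, d - lev t, ?_, ?_, by omega,
    ⟨splitIso G S ⟨s, hsS⟩ ⟨t, htS⟩ hst hcross⟩⟩
  · have key : ∀ (T : Set V) (hT : T = Sᶜ), IsTail ⟨(Tᶜ : Set V), G.induce Tᶜ, ⟨s, by simpa [hT]⟩⟩
        (fun v => m ⟨v.1, by have := v.2; simpa [hT] using this⟩) (m p) := by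
      rintro T rfl
      refine isTail_of_bridge (S := Sᶜ) (s := ⟨t, htS⟩) (t := ⟨s, by simpa⟩) hst.symm ?_
        (fun v _ => hdeg v) tri ?_ (fun v => hp _) ⟨⟨p.1, by simp⟩, rfl⟩
      · intro a ha b hb hab
        exact (hcross b (by simpa using hb) a ha hab.symm).symm
      · refine ⟨hlevL.root, ?_, fun u v huv => hlevL.lip _ _ huv⟩
        rintro ⟨v, hv⟩ hvs
        obtain ⟨w, hw, hw'⟩ := hlevL.pred ⟨v, by simpa using hv⟩ (fun h => hvs (by
          rw [Subtype.ext_iff] at h ⊢; exact h))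
        exact ⟨⟨w.1, by simp⟩, hw, hw'⟩
    have k := key Sᶜ rfl
    let φ : G.induce S ≃g G.induce Sᶜᶜ :=
      { toEquiv := Equiv.setCongr hcompl.symm
        map_rel_iff' := by intro a b; rfl }
    exact k.comap (R := ⟨S, G.induce S, ⟨s, hsS⟩⟩) φ rfl
  · refine isTail_of_bridge (s := ⟨s, hsS⟩) hst hcross (fun v _ => hdeg v) tri hlevR
      (fun v => ?_) ⟨⟨y, ?_⟩, ?_⟩
    · have := le v.1
      omega
    · simp only [hS, Set.mem_compl_iff, Set.mem_ofPred_eq]; omega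
    · simp only; omega

/-! ### Two chains joined by a bridge -/

/-- Two chains joined by a bridge. -/
abbrev dbl (u : List (Fin 3)) (i : Fin 19) (w : List (Fin 3)) (j : Fin 19) :
    SimpleGraph ((chain u i).V ⊕ (chain w j).V) :=
  joinAt (chain u i).G (chain u i).root (chain w j).G (chain w j).root

def dblComm (u : List (Fin 3)) (i : Fin 19) (w : List (Fin 3)) (j : Fin 19) :
    dbl u i w j ≃g dbl w j u i := joinAtComm _ _ _ _

/-- A piece may be moved across the bridge. -/
def dblShift (x : Fin 3) (u : List (Fin 3)) (i : Fin 19) (w : List (Fin 3)) (j : Fin 19) :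
    dbl (x :: u) i w j ≃g dbl u i (x :: w) j :=
  (joinAtAssoc (piece x) 0 (Fin.last _) (chain u i).G (chain u i).root (chain w j).G
    (chain w j).root).trans
    (joinAtCongr .refl (joinAtCongr (pieceRev x) .refl (pieceRev_zero x) rfl) rfl
      (congrArg Sum.inl (pieceRev_last x)))

theorem dbl_normal (u : List (Fin 3)) (i : Fin 19) (w : List (Fin 3)) (j : Fin 19) :
    Nonempty (dbl u i w j ≃g dbl [] i (u.reverse ++ w) j) := by
  induction u generalizing w with
  | nil => exact ⟨.refl⟩
  | cons x u ih =>
    obtain ⟨φ⟩ := ih (x :: w)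
    refine ⟨(dblShift x u i w j).trans ?_⟩
    rw [List.reverse_cons, List.append_assoc]
    exact φ

theorem dbl_reverse (i : Fin 19) (w : List (Fin 3)) (j : Fin 19) :
    Nonempty (dbl [] i w j ≃g dbl [] j w.reverse i) := by
  obtain ⟨φ⟩ := dbl_normal w j [] i
  refine ⟨(dblComm [] i w j).trans ?_⟩
  rw [List.append_nil] at φ
  exact φ

/-! ### The parameters of two joined chains -/

theorem card_dbl (i : Fin 19) (w : List (Fin 3)) (j : Fin 19) :
    Nat.card ((chain [] i).V ⊕ (chain w j).V) =
      14 + 6 * w.length + 2 * (eex i + eex j + wex w) := by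
  have := (isTail_chain [] i).finite
  have := (isTail_chain w j).finite
  rw [Nat.card_sum, card_chain, card_chain]
  simp only [List.length_nil, wex_nil]
  ring

theorem ediam_le_of_iso {V W : Type*} {G : SimpleGraph V} {H : SimpleGraph W} (φ : G ≃g H) :
    H.ediam ≤ G.ediam := by
  refine SimpleGraph.ediam_le_of_edist_le fun u v => ?_
  have h : H.edist (φ (φ.symm u)) (φ (φ.symm v)) ≤ _ :=
    edist_map_le φ.toHom (φ.symm u) (φ.symm v)
  rw [φ.apply_symm_apply, φ.apply_symm_apply] at h
  exact h.trans SimpleGraph.edist_le_ediam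

theorem isKGDGraph_iso {V W : Type*} {G : SimpleGraph V} {H : SimpleGraph W} (φ : G ≃g H)
    {k g d : ℕ} (h : IsKGDGraph k g d G) : IsKGDGraph k g d H := by
  refine ⟨fun v => ?_, by rw [← φ.egirth_eq]; exact h.2.1,
    le_antisymm (h.2.2 ▸ ediam_le_of_iso φ) (h.2.2 ▸ ediam_le_of_iso φ.symm)⟩
  rw [ncard_neighborSet_iso φ.symm]
  exact h.1 _

theorem tri_of_egirth {V : Type*} {G : SimpleGraph V} (hg : G.egirth = (4 : ℕ)) (a b c : V)
    (h1 : G.Adj a b) (h2 : G.Adj b c) (h3 : G.Adj c a) : False := by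
  have hc : (SimpleGraph.Walk.cons h1 (.cons h2 (.cons h3 .nil))).IsCycle := by
    rw [SimpleGraph.Walk.cons_isCycle_iff]
    simp [h1.ne, h2.ne, h3.ne, h1.ne.symm, h3.ne.symm]
  have := SimpleGraph.egirth_le_length hc
  rw [hg] at this
  simp only [SimpleGraph.Walk.length_cons, SimpleGraph.Walk.length_nil] at this
  norm_cast at this

theorem egirth_eq_four {V : Type*} {G : SimpleGraph V}
    (tri : ∀ a b c, G.Adj a b → G.Adj b c → G.Adj c a → False) {a b c d : V} (h1 : G.Adj a b)
    (h2 : G.Adj b c) (h3 : G.Adj c d) (h4 : G.Adj d a) (hac : a ≠ c) (hbd : b ≠ d) :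
    G.egirth = (4 : ℕ) := by
  refine le_antisymm ?_ ?_
  · have hc : (SimpleGraph.Walk.cons h1 (.cons h2 (.cons h3 (.cons h4 .nil)))).IsCycle := by
      rw [SimpleGraph.Walk.cons_isCycle_iff]
      simp [h1.ne, h2.ne, h3.ne, h4.ne, h1.ne.symm, h4.ne.symm, hac, hbd, hac.symm]
    exact SimpleGraph.egirth_le_length hc
  · rw [SimpleGraph.le_egirth]
    intro x w hw
    have h3 := hw.three_le_length
    by_contra hlt
    have hlen : w.length = 3 := by
      norm_cast at hlt
      omega
    match w, hlen with
    | .cons e1 (.cons e2 (.cons e3 .nil)), _ => exact tri _ _ _ e1 e2 e3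

theorem isKGDGraph_dbl {d : ℕ} (hd : 9 ≤ d) (i : Fin 19) (w : List (Fin 3)) (j : Fin 19)
    (hX : eex i + eex j + wex w ≤ 3) (hdw : d = 5 + 4 * w.length + (eex i + eex j + wex w)) :
    IsKGDGraph 3 4 d (dbl [] i w j) := by
  have hi := isTail_chain [] i
  have hj := isTail_chain w j
  have hei : chainEcc [] i = 2 + eex i := by simp [chainEcc]
  have hej : chainEcc w j = 2 + eex j + 4 * w.length + wex w := rfl
  have hsum : chainEcc [] i + 1 + chainEcc w j = d := by omega
  refine ⟨ncard_joinAt_of_isTail hi hj, ?_, le_antisymm ?_ ?_⟩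
  · obtain ⟨a, b, hab, c, hbc, hac, e, hce, hea, hbe⟩ := end_square i
    have := egirth_eq_four (G := dbl [] i w j) (a := .inl a) (b := .inl b) (c := .inl c)
      (d := .inl e) (joinAt_tri hi.tri hj.tri) hab hbc hce hea
      (fun h => hac (Sum.inl_injective h)) (fun h => hbe (Sum.inl_injective h))
    exact this
  · refine SimpleGraph.ediam_le_of_edist_le ?_
    have hcross : ∀ u v, (dbl [] i w j).edist (.inl u) (.inr v) ≤ d := by
      intro u v
      refine (edist_joinAt_le u v).trans ?_
      have h1 := (hi.isLevel.edist_le u).trans (Nat.cast_le.mpr (hi.le u))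
      have h2 := (hj.isLevel.edist_le v).trans (Nat.cast_le.mpr (hj.le v))
      refine (add_le_add (add_le_add_left h1 1) h2).trans ?_
      rw [← hsum]
      push_cast
      exact le_rfl
    rintro (u | u) (v | v)
    · exact (edist_map_le (joinInl _ _ _ _) u v).trans
        (chain_edist_le [] i (by omega) (by simp) (by omega) u v)
    · exact hcross u v
    · rw [SimpleGraph.edist_comm]; exact hcross v u
    · refine (edist_map_le (joinInr _ _ _ _) u v).trans
        (chain_edist_le w j (by omega) (fun x hx => ?_) (by omega) u v)
      have : pex x ≤ wex w := List.single_le_sum (by simp) _ (List.mem_map_of_mem hx)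
      omega
  · obtain ⟨u, hu⟩ := hi.attained
    obtain ⟨v, hv⟩ := hj.attained
    have hlip : ∀ a b, (dbl [] i w j).Adj a b →
        Sum.elim (fun u => chainEcc [] i - chainLev [] i u)
          (fun v => chainEcc [] i + 1 + chainLev w j v) b ≤
        Sum.elim (fun u => chainEcc [] i - chainLev [] i u)
          (fun v => chainEcc [] i + 1 + chainLev w j v) a + 1 := by
      rintro (a | a) (b | b) hab
      · have := hi.isLevel.lip _ _ ((joinAt_inl_inl).mp hab).symm
        simp only [Sum.elim_inl]; omega
      · obtain ⟨rfl, rfl⟩ := hab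
        simp [hi.isLevel.root, hj.isLevel.root]
      · simp only [Sum.elim_inl, Sum.elim_inr]; omega
      · have := hj.isLevel.lip _ _ ((joinAt_inr_inr).mp hab)
        simp only [Sum.elim_inr]; omega
    have h1 := le_edist_of_lip hlip (.inl u) (.inr v)
    simp only [Sum.elim_inl, Sum.elim_inr, hu, hv, hsum] at h1
    rw [Nat.sub_self, Nat.cast_zero, zero_add] at h1
    exact h1.trans SimpleGraph.edist_le_ediam

/-- A small `(3; 4, d)`-graph consists of two ends joined by a sequence of pieces. -/
theorem exists_iso_dbl {V : Type} [Finite V] {G : SimpleGraph V} {d : ℕ} (hd : 9 ≤ d)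
    (hG : IsKGDGraph 3 4 d G) (hn : 2 * Nat.card V ≤ 3 * (d + 1) + 10 + (d - 5) % 4) :
    ∃ i w j, Nonempty (dbl [] i w j ≃g G) ∧ eex i + eex j + wex w = (d - 5) % 4 ∧
      w.length = (d - 5) / 4 := by
  have tri := tri_of_egirth hG.2.1
  obtain ⟨R, S, l, l', e, e', hR, hS, hee, ⟨φ⟩⟩ :=
    exists_tails hd hG.1 tri hG.2.2 (by omega)
  have := hR.finite
  have := hS.finite
  have hcard := Nat.card_congr φ.toEquiv
  rw [Nat.card_sum] at hcard
  have hlow : ∀ {T : RGraph} {l : T.V → ℕ} {e : ℕ}, IsTail T l e →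
      3 * (e + 1) + 5 ≤ 2 * Nat.card T.V := by
    intro T l e hT
    by_contra hlt
    obtain ⟨w, E, ψ, hψ⟩ := hT.exists_iso_chain (by omega)
    have h1 := hT.ecc_unique ((isTail_chain w E).comap ψ hψ)
    have h2 := Nat.card_congr ψ.toEquiv
    rw [card_chain] at h2
    rw [chainEcc] at h1
    omega
  have hRl := hlow hR
  have hSl := hlow hS
  obtain ⟨u, i, ψ, hψ⟩ := hR.exists_iso_chain (by omega)
  obtain ⟨w, j, χ, hχ⟩ := hS.exists_iso_chain (by omega)
  have h1 := hR.ecc_unique ((isTail_chain u i).comap ψ hψ)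
  have h2 := hS.ecc_unique ((isTail_chain w j).comap χ hχ)
  have h3 := Nat.card_congr ψ.toEquiv
  have h4 := Nat.card_congr χ.toEquiv
  rw [card_chain] at h3 h4
  rw [chainEcc] at h1 h2
  obtain ⟨ω⟩ := dbl_normal u i w j
  refine ⟨i, u.reverse ++ w, j, ⟨(ω.symm.trans (joinAtCongr ψ χ hψ hχ).symm).trans φ⟩, ?_, ?_⟩
  · rw [wex_append, wex_reverse]; omega
  · rw [List.length_append, List.length_reverse]; omega

/-! ### Bridges -/

/-- The edge from `u` to `v` is a bridge, separating `u` from `v`. -/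
def Cut {V : Type*} (G : SimpleGraph V) (u v : V) : Prop :=
  G.Adj u v ∧ ∃ A : Set V, u ∈ A ∧ v ∉ A ∧ ∀ x ∈ A, ∀ y ∉ A, G.Adj x y → x = u ∧ y = v

theorem Cut.comap {V W : Type*} {G : SimpleGraph V} {H : SimpleGraph W} (f : V → W)
    (hf : Function.Injective f) (hadj : ∀ x y, G.Adj x y ↔ H.Adj (f x) (f y)) {u v : V}
    (h : Cut H (f u) (f v)) : Cut G u v := by
  obtain ⟨huv, A, hu, hv, hA⟩ := h
  refine ⟨(hadj _ _).mpr huv, f ⁻¹' A, hu, hv, fun x hx y hy hxy => ?_⟩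
  obtain ⟨h1, h2⟩ := hA _ hx _ hy ((hadj _ _).mp hxy)
  exact ⟨hf h1, hf h2⟩

theorem Cut.map {V W : Type*} {G : SimpleGraph V} {H : SimpleGraph W} (φ : G ≃g H) {u v : V}
    (h : Cut G u v) : Cut H (φ u) (φ v) := by
  refine Cut.comap (H := G) φ.symm φ.symm.injective (fun x y => (φ.symm.map_adj_iff).symm) ?_
  rwa [φ.symm_apply_apply, φ.symm_apply_apply]

theorem cut_joinAt {V W : Type*} (G : SimpleGraph V) (a : V) (H : SimpleGraph W) (b : W) :
    Cut (joinAt G a H b) (.inl a) (.inr b) := by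
  refine ⟨⟨rfl, rfl⟩, Set.range Sum.inl, ⟨a, rfl⟩, by simp, ?_⟩
  rintro _ ⟨x, rfl⟩ (y | y) hy hxy
  · exact absurd ⟨y, rfl⟩ hy
  · obtain ⟨rfl, rfl⟩ := hxy
    exact ⟨rfl, rfl⟩

/-- Is there a walk from `x` to `v` of length at most `k` which does not use the edge from `u` to
`v`? -/
def bypass {n : ℕ} (G : SimpleGraph (Fin n)) [DecidableRel G.Adj] (u v : Fin n) :
    ℕ → Fin n → Bool
  | 0, x => x == v
  | k + 1, x => x == v || (List.finRange n).any fun y =>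
      decide (G.Adj x y) && !(x == u && y == v) && bypass G u v k y

theorem mem_of_bypass {n : ℕ} {G : SimpleGraph (Fin n)} [DecidableRel G.Adj] {u v : Fin n}
    {A : Set (Fin n)} (hA : ∀ x ∈ A, ∀ y ∉ A, G.Adj x y → x = u ∧ y = v) (k : ℕ) (x : Fin n)
    (hx : x ∈ A) (h : bypass G u v k x = true) : v ∈ A := by
  induction k generalizing x with
  | zero =>
    obtain rfl : x = v := by simpa [bypass] using h
    exact hx
  | succ k ih =>
    rw [bypass, Bool.or_eq_true, List.any_eq_true] at h
    rcases h with h | ⟨y, -, h⟩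
    · obtain rfl : x = v := by simpa using h
      exact hx
    · simp only [Bool.and_eq_true, decide_eq_true_eq] at h
      obtain ⟨⟨hxy, hne⟩, hy⟩ := h
      by_cases hyA : y ∈ A
      · exact ih y hyA hy
      · obtain ⟨rfl, rfl⟩ := hA x hx y hyA hxy
        simp at hne

theorem not_cut_of_bypass {n : ℕ} {G : SimpleGraph (Fin n)} [DecidableRel G.Adj]
    (h : ∀ u v, G.Adj u v →
      (bypass G u v 3 u || bypass G u v 4 u || bypass G u v 5 u || bypass G u v 7 u) = true) (u v : Fin n) :
    ¬ Cut G u v := by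
  rintro ⟨huv, A, hu, hv, hA⟩
  have := h u v huv
  rw [Bool.or_eq_true, Bool.or_eq_true, Bool.or_eq_true] at this
  rcases this with ((h | h) | h) | h <;> exact hv (mem_of_bypass hA _ u hu h)

theorem not_cut_piece (x : Fin 3) : ∀ u v, ¬ Cut (piece x) u v := by
  refine not_cut_of_bypass ?_
  revert x
  decide +kernel

theorem not_cut_end (i : Fin 19) : ∀ u v, ¬ Cut (endGraph i) u v := by
  refine not_cut_of_bypass ?_
  revert i
  decide +kernel

/-! ### The bridges of two joined chains -/

theorem dblShift_symm_last (x : Fin 3) (u : List (Fin 3)) (i : Fin 19) (w : List (Fin 3))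
    (j : Fin 19) :
    (dblShift x u i w j).symm (.inr (.inl (Fin.last _))) = .inl (chain (x :: u) i).root := by
  rw [← (dblShift x u i w j).injective.eq_iff, RelIso.apply_symm_apply]
  exact congrArg (fun p => Sum.inr (Sum.inl p)) (pieceRev_zero x).symm

theorem dblShift_symm_inr (x : Fin 3) (u : List (Fin 3)) (i : Fin 19) (w : List (Fin 3))
    (j : Fin 19) (v : (chain w j).V) :
    (dblShift x u i w j).symm (.inr (.inr v)) = .inr v := by
  rw [← (dblShift x u i w j).injective.eq_iff, RelIso.apply_symm_apply]
  rfl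

theorem cut_right (w : List (Fin 3)) (u : List (Fin 3)) (i j : Fin 19)
    {a b : (chain u i).V ⊕ (chain w j).V} (hcut : Cut (dbl u i w j) a b)
    (hab : (a = .inl (chain u i).root ∧ b = .inr (chain w j).root) ∨
      (a = .inr (chain w j).root ∧ b = .inl (chain u i).root) ∨
      ∃ a' b', a = .inr a' ∧ b = .inr b') :
    ∃ u' w', u'.reverse ++ w' = u.reverse ++ w ∧ ∃ φ : dbl u i w j ≃g dbl u' i w' j,
      (φ a = .inl (chain u' i).root ∧ φ b = .inr (chain w' j).root) ∨
      (φ a = .inr (chain w' j).root ∧ φ b = .inl (chain u' i).root) := by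
  induction w generalizing u with
  | nil =>
    rcases hab with ⟨rfl, rfl⟩ | ⟨rfl, rfl⟩ | ⟨a', b', rfl, rfl⟩
    · exact ⟨u, [], rfl, .refl, .inl ⟨rfl, rfl⟩⟩
    · exact ⟨u, [], rfl, .refl, .inr ⟨rfl, rfl⟩⟩
    · exact absurd (Cut.comap (G := endGraph j) Sum.inr Sum.inr_injective (fun _ _ => Iff.rfl) hcut)
        (not_cut_end j a' b')
  | cons x w ih =>
    rcases hab with ⟨rfl, rfl⟩ | ⟨rfl, rfl⟩ | ⟨a', b', rfl, rfl⟩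
    · exact ⟨u, x :: w, rfl, .refl, .inl ⟨rfl, rfl⟩⟩
    · exact ⟨u, x :: w, rfl, .refl, .inr ⟨rfl, rfl⟩⟩
    · have hc := hcut.map (dblShift x u i w j).symm
      suffices h : _ by
        obtain ⟨u', w', huw, φ, hφ⟩ := ih (x :: u) hc h
        refine ⟨u', w', by simpa using huw, (dblShift x u i w j).symm.trans φ, hφ⟩
      rcases a' with a' | a' <;> rcases b' with b' | b'
      · exact absurd (Cut.comap (G := piece x) (fun p => Sum.inr (Sum.inl p))
          (Sum.inr_injective.comp Sum.inl_injective) (fun _ _ => Iff.rfl) hcut)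
          (not_cut_piece x a' b')
      · obtain ⟨rfl, rfl⟩ : a' = Fin.last _ ∧ b' = (chain w j).root := hcut.1
        exact .inl ⟨dblShift_symm_last x u i w j, dblShift_symm_inr x u i w j _⟩
      · obtain ⟨rfl, rfl⟩ : b' = Fin.last _ ∧ a' = (chain w j).root := hcut.1
        exact .inr (.inl ⟨dblShift_symm_inr x u i w j _, dblShift_symm_last x u i w j⟩)
      · exact .inr (.inr ⟨a', b', dblShift_symm_inr x u i w j _, dblShift_symm_inr x u i w j _⟩)

/-- Every bridge of two joined chains becomes the joining bridge after moving pieces across. -/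
theorem cut_dbl (u : List (Fin 3)) (i : Fin 19) (w : List (Fin 3)) (j : Fin 19)
    {a b : (chain u i).V ⊕ (chain w j).V} (hcut : Cut (dbl u i w j) a b) :
    ∃ u' w', u'.reverse ++ w' = u.reverse ++ w ∧ ∃ φ : dbl u i w j ≃g dbl u' i w' j,
      (φ a = .inl (chain u' i).root ∧ φ b = .inr (chain w' j).root) ∨
      (φ a = .inr (chain w' j).root ∧ φ b = .inl (chain u' i).root) := by
  rcases a with a | a <;> rcases b with b | b
  · obtain ⟨w', u', h, φ, hφ⟩ := cut_right u w j i (a := .inr a) (b := .inr b)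
      (hcut.map (dblComm u i w j)) (.inr (.inr ⟨a, b, rfl, rfl⟩))
    refine ⟨u', w', ?_, ((dblComm u i w j).trans φ).trans (dblComm w' j u' i), ?_⟩
    · have := congrArg List.reverse h
      simpa using this
    · have hC : ∀ c, (((dblComm u i w j).trans φ).trans (dblComm w' j u' i)) (.inl c) =
        dblComm w' j u' i (φ (.inr c)) := fun c => rfl
      rw [hC, hC]
      rcases hφ with ⟨h1, h2⟩ | ⟨h1, h2⟩
      · rw [h1, h2]; exact .inr ⟨rfl, rfl⟩
      · rw [h1, h2]; exact .inl ⟨rfl, rfl⟩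
  · obtain ⟨rfl, rfl⟩ := hcut.1
    exact cut_right w u i j hcut (.inl ⟨rfl, rfl⟩)
  · obtain ⟨rfl, rfl⟩ := hcut.1
    exact cut_right w u i j hcut (.inr (.inl ⟨rfl, rfl⟩))
  · exact cut_right w u i j hcut (.inr (.inr ⟨a, b, rfl, rfl⟩))

/-! ### Recovering the pieces -/

theorem exists_inl_of_iso {R S R' S' : RGraph} {l : R.V → ℕ} (hl : IsLevel R.G R.root l)
    (φ : joinAt R.G R.root S.G S.root ≃g joinAt R'.G R'.root S'.G S'.root)
    (h : φ (.inl R.root) = .inl R'.root) (h' : φ (.inr S.root) = .inr S'.root) (v : R.V) :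
    ∃ v', φ (.inl v) = .inl v' := by
  refine hl.induct (p := fun v => ∃ v', φ (.inl v) = .inl v') ⟨_, h⟩ ?_ v
  rintro w v hwv - ⟨w', hw'⟩
  rcases hv : φ (.inl v) with v' | v'
  · exact ⟨v', rfl⟩
  · have hadj := φ.map_adj_iff.mpr (show (joinAt R.G R.root S.G S.root).Adj (.inl w) (.inl v) from hwv)
    rw [hw', hv] at hadj
    obtain ⟨rfl, rfl⟩ := hadj
    rw [← h'] at hv
    exact absurd (φ.injective hv) (by simp)

theorem iso_of_joinAt_iso {R S R' S' : RGraph} {l : R.V → ℕ} (hl : IsLevel R.G R.root l)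
    {l' : R'.V → ℕ} (hl' : IsLevel R'.G R'.root l')
    (φ : joinAt R.G R.root S.G S.root ≃g joinAt R'.G R'.root S'.G S'.root)
    (h : φ (.inl R.root) = .inl R'.root) (h' : φ (.inr S.root) = .inr S'.root) : R.Iso R' := by
  choose f hf using exists_inl_of_iso hl φ h h'
  choose g hg using exists_inl_of_iso hl' φ.symm (by rw [← h]; simp) (by rw [← h']; simp)
  refine ⟨⟨⟨f, g, fun v => ?_, fun v => ?_⟩, ?_⟩, ?_⟩
  · apply Sum.inl_injective (β := S.V)
    rw [← hg, ← hf]; simp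
  · apply Sum.inl_injective (β := S'.V)
    rw [← hf, ← hg]; simp
  · intro a b
    change R'.G.Adj (f a) (f b) ↔ R.G.Adj a b
    rw [← joinAt_inl_inl (a := R'.root) (H := S'.G) (b := S'.root), ← hf, ← hf, φ.map_adj_iff,
      joinAt_inl_inl]
  · apply Sum.inl_injective (β := S'.V)
    rw [← h]; exact (hf _).symm

theorem iso_of_joinAt_iso' {R S R' S' : RGraph} {l : S.V → ℕ} (hl : IsLevel S.G S.root l)
    {l' : S'.V → ℕ} (hl' : IsLevel S'.G S'.root l')
    (φ : joinAt R.G R.root S.G S.root ≃g joinAt R'.G R'.root S'.G S'.root)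
    (h : φ (.inl R.root) = .inl R'.root) (h' : φ (.inr S.root) = .inr S'.root) : S.Iso S' := by
  refine iso_of_joinAt_iso hl hl'
    (((joinAtComm R.G R.root S.G S.root).symm.trans φ).trans (joinAtComm _ _ _ _)) ?_ ?_
  · exact congrArg (joinAtComm R'.G R'.root S'.G S'.root) h'
  · exact congrArg (joinAtComm R'.G R'.root S'.G S'.root) h

theorem chainLev_iso {w w' : List (Fin 3)} {i i' : Fin 19} (φ : (chain w i).G ≃g (chain w' i').G)
    (hφ : φ (chain w i).root = (chain w' i').root) (v : (chain w i).V) :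
    chainLev w' i' (φ v) = chainLev w i v :=
  congrFun (((isTail_chain w' i').isLevel.comap φ hφ).unique (isTail_chain w i).isLevel) v

theorem ncard_chainLev_iso {w w' : List (Fin 3)} {i i' : Fin 19}
    (h : (chain w i).Iso (chain w' i')) (k : ℕ) :
    {v | chainLev w i v = k}.ncard = {v | chainLev w' i' v = k}.ncard := by
  obtain ⟨φ, hφ⟩ := h
  rw [← Set.ncard_image_of_injective _ φ.injective]
  congr 1
  ext v
  constructor
  · rintro ⟨u, hu, rfl⟩
    exact (chainLev_iso φ hφ u).trans hu
  · intro hv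
    refine ⟨φ.symm v, ?_, by simp⟩
    have := chainLev_iso φ hφ (φ.symm v)
    rw [φ.apply_symm_apply] at this
    exact this.symm.trans hv

theorem ncard_fin {n : ℕ} (f : Fin n → ℕ) (k : ℕ) :
    {v | f v = k}.ncard = (Finset.univ.filter (f · = k)).card := by
  rw [← Set.ncard_coe_finset]
  exact congrArg Set.ncard (Set.ext fun x => by simp)

theorem ncard_chainLev_cons (x : Fin 3) (w : List (Fin 3)) (i : Fin 19) {k : ℕ}
    (hk : k ≤ 3 + pex x) :
    {v | chainLev (x :: w) i v = k}.ncard = (Finset.univ.filter (pieceLev x · = k)).card := by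
  rw [← ncard_fin, ← Set.ncard_image_of_injective {v | pieceLev x v = k}
    (Sum.inl_injective (β := (chain w i).V))]
  refine congrArg Set.ncard (Set.ext fun v => ?_)
  rcases v with v | v
  · constructor
    · intro h; exact ⟨v, h, rfl⟩
    · rintro ⟨u, hu, h⟩
      obtain rfl := Sum.inl_injective h
      exact hu
  · constructor
    · intro h
      have : 3 + pex x + 1 + chainLev w i v = k := h
      omega
    · rintro ⟨u, hu, h⟩
      simp at h

theorem piece_count_ne : ∀ x x', x ≠ x' → ∃ k : Fin 7, k.1 ≤ 3 + pex x ∧ k.1 ≤ 3 + pex x' ∧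
    (Finset.univ.filter (pieceLev x · = k)).card ≠ (Finset.univ.filter (pieceLev x' · = k)).card := by
  decide +kernel

theorem piece_end_count_ne : ∀ x i, ∃ k : Fin 7, k.1 ≤ 3 + pex x ∧
    (Finset.univ.filter (pieceLev x · = k)).card ≠ (Finset.univ.filter (endLev i · = k)).card := by
  decide +kernel

theorem not_iso_nil_cons (x : Fin 3) (w : List (Fin 3)) (i j : Fin 19) :
    ¬ (chain [] i).Iso (chain (x :: w) j) := by
  intro h
  obtain ⟨k, hk, hne⟩ := piece_end_count_ne x i
  have h1 := ncard_chainLev_iso h k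
  rw [ncard_chainLev_cons x w j hk] at h1
  exact hne (h1.symm.trans (ncard_fin (endLev i) k))

theorem chain_injective (w w' : List (Fin 3)) (i i' : Fin 19) (h : (chain w i).Iso (chain w' i')) :
    w = w' ∧ i = i' := by
  induction w generalizing w' with
  | nil =>
    cases w' with
    | nil => exact ⟨rfl, endR_iso h⟩
    | cons x' w' => exact absurd h (not_iso_nil_cons x' w' i i')
  | cons x w ih =>
    cases w' with
    | nil => exact absurd h.symm (not_iso_nil_cons x w i' i)
    | cons x' w' =>
      have hx : x = x' := by
        by_contra hne
        obtain ⟨k, hk, hk', hcount⟩ := piece_count_ne x x' hne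
        have := ncard_chainLev_iso h k
        rw [ncard_chainLev_cons x w i hk, ncard_chainLev_cons x' w' i' hk'] at this
        exact hcount this
      subst hx
      obtain ⟨φ, hφ⟩ := h
      have hlast : φ (.inl (Fin.last _)) = .inl (Fin.last _) := by
        have h1 := chainLev_iso φ hφ (.inl (Fin.last _))
        have h2 : chainLev (x :: w) i (.inl (Fin.last _)) = 3 + pex x := pieceLev_last x
        rw [h2] at h1
        rcases hv : φ (.inl (Fin.last _)) with v | v
        · rw [hv] at h1
          exact congrArg _ (pieceLev_rev_last x v h1)
        · rw [hv] at h1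
          have : 3 + pex x + 1 + chainLev w' i' v = 3 + pex x := h1
          omega
      have hroot : φ (.inr (chain w i).root) = .inr (chain w' i').root := by
        have h1 := chainLev_iso φ hφ (.inr (chain w i).root)
        have h2 : chainLev (x :: w) i (.inr (chain w i).root) = 3 + pex x + 1 := by
          change 3 + pex x + 1 + chainLev w i (chain w i).root = _
          rw [(isTail_chain w i).isLevel.root]
        rw [h2] at h1
        rcases hv : φ (.inr (chain w i).root) with v | v
        · rw [hv] at h1
          have : pieceLev x v = 3 + pex x + 1 := h1
          have := pieceLev_le x v
          omega
        · rw [hv] at h1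
          have h3 : 3 + pex x + 1 + chainLev w' i' v = 3 + pex x + 1 := h1
          exact congrArg _ ((isTail_chain w' i').isLevel.eq_root (by omega))
      have hiso := iso_of_joinAt_iso' (R := ⟨_, piece x, Fin.last _⟩)
        (R' := ⟨_, piece x, Fin.last _⟩) (isTail_chain w i).isLevel (isTail_chain w' i').isLevel
        φ hlast hroot
      obtain ⟨rfl, rfl⟩ := ih w' hiso
      exact ⟨rfl, rfl⟩

theorem dbl_iso_iff (i j i' j' : Fin 19) (w w' : List (Fin 3)) :
    Nonempty (dbl [] i w j ≃g dbl [] i' w' j') ↔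
      (i = i' ∧ w = w' ∧ j = j') ∨ (i = j' ∧ w = w'.reverse ∧ j = i') := by
  constructor
  · rintro ⟨φ⟩
    have hcut := (cut_joinAt (chain [] i).G (chain [] i).root (chain w j).G (chain w j).root).map φ
    obtain ⟨u, v, huv, ψ, hψ⟩ := cut_dbl [] i' w' j' hcut
    simp only [List.reverse_nil, List.nil_append] at huv
    rcases hψ with ⟨h1, h2⟩ | ⟨h1, h2⟩
    · left
      obtain ⟨rfl, rfl⟩ := chain_injective _ _ _ _ (iso_of_joinAt_iso (isTail_chain [] i).isLevel
        (isTail_chain u i').isLevel (φ.trans ψ) h1 h2)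
      obtain ⟨rfl, rfl⟩ := chain_injective _ _ _ _ (iso_of_joinAt_iso' (isTail_chain w j).isLevel
        (isTail_chain v j').isLevel (φ.trans ψ) h1 h2)
      exact ⟨rfl, by simpa using huv, rfl⟩
    · right
      have h3 : ((φ.trans ψ).trans (dblComm u i' v j')) (.inl (chain [] i).root) =
          .inl (chain v j').root := congrArg (dblComm u i' v j') h1
      have h4 : ((φ.trans ψ).trans (dblComm u i' v j')) (.inr (chain w j).root) =
          .inr (chain u i').root := congrArg (dblComm u i' v j') h2
      obtain ⟨rfl, rfl⟩ := chain_injective _ _ _ _ (iso_of_joinAt_iso (isTail_chain [] i).isLevel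
        (isTail_chain v j').isLevel _ h3 h4)
      obtain ⟨rfl, rfl⟩ := chain_injective _ _ _ _ (iso_of_joinAt_iso' (isTail_chain w j).isLevel
        (isTail_chain u i').isLevel _ h3 h4)
      exact ⟨rfl, by simp [← huv], rfl⟩
  · rintro (⟨rfl, rfl, rfl⟩ | ⟨rfl, rfl, rfl⟩)
    · exact ⟨.refl⟩
    · obtain ⟨φ⟩ := dbl_reverse j w' i
      exact ⟨φ.symm⟩

/-! ### Words of small excess -/

/-- The words of length `q` with at most one letter different from `0`. -/
def word {q : ℕ} : Option (Fin q × Bool) → List (Fin 3)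
  | none => List.replicate q 0
  | some (p, b) => List.replicate p 0 ++ (if b then 2 else 1) :: List.replicate (q - (p + 1)) 0

def cost {q : ℕ} : Option (Fin q × Bool) → ℕ
  | none => 0
  | some (_, b) => if b then 3 else 2

def flip {q : ℕ} (o : Option (Fin q × Bool)) : Option (Fin q × Bool) :=
  o.map (Prod.map Fin.rev id)

theorem cost_flip {q : ℕ} (o : Option (Fin q × Bool)) : cost (flip o) = cost o := by
  rcases o with _ | ⟨p, b⟩ <;> rfl

theorem wex_replicate (n : ℕ) : wex (List.replicate n 0) = 0 := by
  simp [wex, pex]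

theorem length_word {q : ℕ} (o : Option (Fin q × Bool)) : (word o).length = q := by
  rcases o with _ | ⟨p, b⟩
  · simp [word]
  · have := p.2
    simp only [word, List.length_append, List.length_replicate, List.length_cons]
    omega

theorem wex_word {q : ℕ} (o : Option (Fin q × Bool)) : wex (word o) = cost o := by
  rcases o with _ | ⟨p, b⟩
  · exact wex_replicate q
  · rw [word, wex_append, wex_cons, wex_replicate, wex_replicate]
    cases b <;> rfl

theorem word_flip {q : ℕ} (o : Option (Fin q × Bool)) : word (flip o) = (word o).reverse := by
  rcases o with _ | ⟨p, b⟩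
  · simp [word, flip]
  · have hp := p.2
    simp only [word, flip, Option.map_some, Prod.map, Fin.val_rev, id, List.reverse_append,
      List.reverse_cons, List.reverse_replicate, List.append_assoc, List.singleton_append]
    rw [show q - (q - (p.1 + 1) + 1) = p.1 by omega]

theorem replicate_append_inj {a b : ℕ} {x y : Fin 3} {s t : List (Fin 3)} (hx : x ≠ 0) (hy : y ≠ 0)
    (h : List.replicate a 0 ++ x :: s = List.replicate b 0 ++ y :: t) : a = b ∧ x = y := by
  induction a generalizing b with
  | zero =>
    cases b with
    | zero => simp at h; exact ⟨rfl, h.1⟩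
    | succ b => simp [List.replicate_succ] at h; exact absurd h.1 hx
  | succ a ih =>
    cases b with
    | zero => simp [List.replicate_succ] at h; exact absurd h.1.symm hy
    | succ b =>
      simp only [List.replicate_succ, List.cons_append, List.cons.injEq, true_and] at h
      obtain ⟨h1, h2⟩ := ih h
      exact ⟨by omega, h2⟩

theorem word_injective {q : ℕ} : Function.Injective (word (q := q)) := by
  intro o o' h
  have hc := congrArg wex h
  rw [wex_word, wex_word] at hc
  rcases o with _ | ⟨p, b⟩ <;> rcases o' with _ | ⟨p', b'⟩
  · rfl
  · cases b' <;> simp [cost] at hc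
  · cases b <;> simp [cost] at hc
  · have hne : ∀ b : Bool, (if b then 2 else 1 : Fin 3) ≠ 0 := by decide
    have hinj : ∀ b b' : Bool, (if b then 2 else 1 : Fin 3) = (if b' then 2 else 1) → b = b' := by
      decide
    obtain ⟨h1, h2⟩ := replicate_append_inj (hne b) (hne b') h
    rw [Fin.ext h1, hinj b b' h2]

theorem eq_replicate_of_wex {w : List (Fin 3)} (h : wex w ≤ 1) : w = List.replicate w.length 0 := by
  induction w with
  | nil => rfl
  | cons x w ih =>
    rw [wex_cons] at h
    have h0 : ∀ x, pex x ≤ 1 → x = 0 := by decide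
    obtain rfl := h0 x (by omega)
    rw [List.length_cons, List.replicate_succ, ← ih (by omega)]

theorem exists_word {w : List (Fin 3)} (h : wex w ≤ 3) :
    ∃ o : Option (Fin w.length × Bool), w = word o := by
  suffices hs : w = List.replicate w.length 0 ∨
      ∃ a c x, x ≠ 0 ∧ w = List.replicate a 0 ++ x :: List.replicate c 0 by
    rcases hs with hs | ⟨a, c, x, hx, hs⟩
    · exact ⟨none, hs⟩
    · have hlen := congrArg List.length hs
      simp only [List.length_append, List.length_replicate, List.length_cons] at hlen
      have h2 : ∀ x : Fin 3, x ≠ 0 → ∃ b : Bool, x = if b then 2 else 1 := by decide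
      obtain ⟨b, rfl⟩ := h2 x hx
      refine ⟨some (⟨a, by omega⟩, b), ?_⟩
      rw [word, show w.length - (a + 1) = c by omega]
      exact hs
  induction w with
  | nil => left; rfl
  | cons x w ih =>
    rw [wex_cons] at h
    by_cases hx : x = 0
    · subst hx
      rcases ih (by omega) with hs | ⟨a, c, y, hy, hs⟩
      · left; rw [List.length_cons, List.replicate_succ, ← hs]
      · right; exact ⟨a + 1, c, y, hy, by rw [List.replicate_succ, List.cons_append, ← hs]⟩
    · right
      have h0 : ∀ x, x ≠ 0 → 2 ≤ pex x := by decide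
      have := h0 x hx
      exact ⟨0, w.length, x, hx, by rw [← eq_replicate_of_wex (by omega)]; rfl⟩

/-! ### Counting -/

/-- Does the configuration come first among itself and its reverse? -/
def IsFirst {q : ℕ} (c : Fin 19 × Fin 19 × Option (Fin q × Bool)) : Prop :=
  c.1 < c.2.1 ∨ c.1 = c.2.1 ∧ ∀ x ∈ c.2.2, 2 * x.1.1 + 1 ≤ q

instance {q : ℕ} : DecidablePred (IsFirst (q := q)) := fun c =>
  inferInstanceAs (Decidable (c.1 < c.2.1 ∨ c.1 = c.2.1 ∧ ∀ x ∈ c.2.2, 2 * x.1.1 + 1 ≤ q))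

/-- Representatives of all configurations up to reversal. -/
def reps (q r : ℕ) : Finset (Fin 19 × Fin 19 × Option (Fin q × Bool)) :=
  Finset.univ.filter fun c => eex c.1 + eex c.2.1 + cost c.2.2 = r ∧ IsFirst c

theorem card_half (q : ℕ) : (∑ p : Fin q, if 2 * p.1 + 1 ≤ q then 1 else 0) = (q + 1) / 2 := by
  rw [Fin.sum_univ_eq_sum_range (fun p => if 2 * p + 1 ≤ q then 1 else 0), ← Finset.card_filter]
  have : (Finset.range q).filter (fun p => 2 * p + 1 ≤ q) = Finset.range ((q + 1) / 2) := by
    ext p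
    simp only [Finset.mem_filter, Finset.mem_range]
    omega
  rw [this, Finset.card_range]

theorem card_reps_aux {α : Type*} [Fintype α] [LinearOrder α] (e : α → ℕ) (q r : ℕ) :
    ((Finset.univ : Finset (α × α × Option (Fin q × Bool))).filter fun c =>
      e c.1 + e c.2.1 + cost c.2.2 = r ∧
        (c.1 < c.2.1 ∨ c.1 = c.2.1 ∧ ∀ x ∈ c.2.2, 2 * x.1.1 + 1 ≤ q)).card =
    (∑ i, ∑ j, if e i + e j = r ∧ i ≤ j then 1 else 0) +
    ((∑ i, ∑ j, ∑ b : Bool,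
      if e i + e j + (if b then 3 else 2) = r ∧ i < j then 1 else 0) * q +
     (∑ i, ∑ j, ∑ b : Bool,
      if e i + e j + (if b then 3 else 2) = r ∧ i = j then 1 else 0) * ((q + 1) / 2)) := by
  rw [Finset.card_filter, Fintype.sum_prod_type]
  simp only [Finset.sum_mul, ← Finset.sum_add_distrib]
  refine Finset.sum_congr rfl fun i _ => ?_
  rw [Fintype.sum_prod_type]
  refine Finset.sum_congr rfl fun j _ => ?_
  rw [Fintype.sum_option, Fintype.sum_prod_type_right]
  congr 1
  · simp [cost, le_iff_lt_or_eq]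
  · refine Finset.sum_congr rfl fun b _ => ?_
    by_cases h : e i + e j + (if b then 3 else 2) = r
    · rcases lt_trichotomy i j with hij | hij | hij
      · simp [cost, h, hij, hij.ne]
      · subst hij
        simp [cost, h, ← card_half]
      · simp [cost, h, hij.not_gt, hij.ne']
    · simp [cost, h]

theorem card_reps (q : ℕ) {r : ℕ} (hr : r < 4) : (reps q r).card =
    if r = 0 then 1 else if r = 1 then 4 else if r = 2 then 17 + (q + 1) / 2
    else 35 + 4 * q + (q + 1) / 2 := by
  have hp : ∀ r < 4, (∑ i, ∑ j, if eex i + eex j = r ∧ i ≤ j then 1 else 0) =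
      if r = 0 then 1 else if r = 1 then 4 else if r = 2 then 17 else 35 := by decide +kernel
  have hlt : ∀ r < 4, (∑ i, ∑ j, ∑ b : Bool,
      if eex i + eex j + (if b then 3 else 2) = r ∧ i < j then 1 else 0) =
      if r = 3 then 4 else 0 := by decide +kernel
  have heq : ∀ r < 4, (∑ i, ∑ j, ∑ b : Bool,
      if eex i + eex j + (if b then 3 else 2) = r ∧ i = j then 1 else 0) =
      if r = 2 ∨ r = 3 then 1 else 0 := by decide +kernel
  rw [show (reps q r).card = _ from card_reps_aux eex q r, hp r hr, hlt r hr, heq r hr]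
  interval_cases r <;> simp
  omega

/-! ### The cages -/

abbrev dblOf {q : ℕ} (c : Fin 19 × Fin 19 × Option (Fin q × Bool)) :=
  dbl [] c.1 (word c.2.2) c.2.1

def excess {q : ℕ} (c : Fin 19 × Fin 19 × Option (Fin q × Bool)) : ℕ :=
  eex c.1 + eex c.2.1 + cost c.2.2

theorem mem_reps {q r : ℕ} {c : Fin 19 × Fin 19 × Option (Fin q × Bool)} :
    c ∈ reps q r ↔ excess c = r ∧ IsFirst c := by
  rw [reps, Finset.mem_filter]
  exact and_iff_right (Finset.mem_univ c)

theorem eq_of_isFirst {q : ℕ} {c c' : Fin 19 × Fin 19 × Option (Fin q × Bool)} (hc : IsFirst c)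
    (hc' : IsFirst c') (h : Nonempty (dblOf c ≃g dblOf c')) : c = c' := by
  obtain ⟨i, j, o⟩ := c
  obtain ⟨i', j', o'⟩ := c'
  rcases (dbl_iso_iff i j i' j' _ _).1 h with ⟨hi, hw, hj⟩ | ⟨hi, hw, hj⟩
  · simp only at hi hj hw
    rw [hi, hj, word_injective hw]
  · simp only at hi hj hw
    rw [← word_flip] at hw
    have ho := word_injective hw
    subst hi hj ho
    rcases hc with hc | ⟨hc, h1⟩ <;> rcases hc' with hc' | ⟨hc', h2⟩ <;> simp only at hc hc'
    · exact absurd hc hc'.not_gt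
    · exact absurd hc' hc.ne'
    · exact absurd hc hc'.ne'
    · subst hc
      rcases o' with _ | ⟨p, b⟩
      · rfl
      · have h1 := h1 (p.rev, b) rfl
        have h2 := h2 (p, b) rfl
        simp only [Fin.val_rev] at h1 h2
        have hp : p.rev = p := Fin.ext (by rw [Fin.val_rev]; omega)
        simp [flip, hp]

theorem exists_isFirst {q : ℕ} (c : Fin 19 × Fin 19 × Option (Fin q × Bool)) :
    ∃ c' : Fin 19 × Fin 19 × Option (Fin q × Bool), excess c' = excess c ∧ IsFirst c' ∧ Nonempty (dblOf c' ≃g dblOf c) := by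
  by_cases hc : IsFirst c
  · exact ⟨c, rfl, hc, ⟨.refl⟩⟩
  · obtain ⟨i, j, o⟩ := c
    refine ⟨(j, i, flip o), ?_, ?_, ?_⟩
    · simp only [excess, cost_flip]
      omega
    · simp only [IsFirst, not_or, not_and, not_lt] at hc ⊢
      rcases lt_or_eq_of_le hc.1 with h | rfl
      · exact .inl h
      · refine .inr ⟨rfl, fun x hx => ?_⟩
        rcases o with _ | ⟨p, b⟩
        · simp [flip] at hx
        · have h2 := hc.2 rfl
          simp only [Option.mem_def, Option.some.injEq, forall_eq', not_le] at h2
          simp only [flip, Option.map_some, Option.mem_def, Option.some.injEq] at hx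
          subst hx
          have := p.2
          simp only [Prod.map, Fin.val_rev]
          omega
    · exact (dbl_iso_iff _ _ _ _ _ _).2 (.inr ⟨rfl, word_flip o, rfl⟩)

theorem isKGDGraph_dblOf {d q : ℕ} (hd : 9 ≤ d) (hq : q = (d - 5) / 4)
    {c : Fin 19 × Fin 19 × Option (Fin q × Bool)} (hc : excess c = (d - 5) % 4) :
    IsKGDGraph 3 4 d (dblOf c) := by
  rw [excess] at hc
  refine isKGDGraph_dbl hd _ _ _ ?_ ?_ <;> rw [wex_word]
  · omega
  · rw [length_word]
    omega

theorem card_dblOf {q : ℕ} (c : Fin 19 × Fin 19 × Option (Fin q × Bool)) :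
    Nat.card ((chain [] c.1).V ⊕ (chain (word c.2.2) c.2.1).V) = 14 + 6 * q + 2 * excess c := by
  rw [card_dbl, length_word, wex_word, excess]

theorem exists_iso_dblOf {V : Type} [Finite V] {G : SimpleGraph V} {d : ℕ} (hd : 9 ≤ d)
    (hG : IsKGDGraph 3 4 d G) (hn : 2 * Nat.card V ≤ 3 * (d + 1) + 10 + (d - 5) % 4) :
    ∃ c : Fin 19 × Fin 19 × Option (Fin ((d - 5) / 4) × Bool), excess c = (d - 5) % 4 ∧
      Nonempty (dblOf c ≃g G) := by
  obtain ⟨i, w, j, φ, hX, hl⟩ := exists_iso_dbl hd hG hn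
  obtain ⟨o, ho⟩ := exists_word (w := w) (by omega)
  rw [← hl]
  refine ⟨(i, j, o), ?_, ?_⟩
  · rw [excess, ← wex_word, ← ho, hX]
  · rw [dblOf, ← ho]
    exact φ

theorem exists_iso_fin {q n : ℕ} {c : Fin 19 × Fin 19 × Option (Fin q × Bool)}
    (hn : n = 14 + 6 * q + 2 * excess c) :
    ∃ G : SimpleGraph (Fin n), Nonempty (dblOf c ≃g G) := by
  have := (isTail_chain [] c.1).finite
  have := (isTail_chain (word c.2.2) c.2.1).finite
  exact ⟨_, ⟨SimpleGraph.Iso.map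
    (Finite.equivFinOfCardEq ((card_dblOf c).trans hn.symm)) (dblOf c)⟩⟩

theorem minOrderKGD_three_four {d : ℕ} (hd : 9 ≤ d) :
    minOrderKGD 3 4 d = 14 + 6 * ((d - 5) / 4) + 2 * ((d - 5) % 4) := by
  have hmem : 14 + 6 * ((d - 5) / 4) + 2 * ((d - 5) % 4) ∈
      {n : ℕ | ∃ G : SimpleGraph (Fin n), IsKGDGraph 3 4 d G} := by
    have he : ∀ r < 4, ∃ i, eex i = r := by decide
    obtain ⟨i, hi⟩ := he _ (Nat.mod_lt (d - 5) (by norm_num : 0 < 4))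
    have hc : excess (q := (d - 5) / 4) (i, 0, none) = (d - 5) % 4 := hi
    obtain ⟨G, ⟨φ⟩⟩ := exists_iso_fin (c := (i, 0, none))
      (congrArg (fun r => 14 + 6 * ((d - 5) / 4) + 2 * r) hc.symm)
    exact ⟨G, isKGDGraph_iso φ (isKGDGraph_dblOf hd rfl hc)⟩
  refine le_antisymm (Nat.sInf_le hmem) ?_
  obtain ⟨G, hG⟩ : minOrderKGD 3 4 d ∈ _ := Nat.sInf_mem ⟨_, hmem⟩
  by_contra! hlt
  obtain ⟨c, hc, ⟨φ⟩⟩ := exists_iso_dblOf hd hG (by rw [Nat.card_fin]; omega)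
  have := Nat.card_congr φ.toEquiv
  rw [card_dblOf, hc, Nat.card_fin] at this
  omega

theorem numCages_eq_card_reps {d : ℕ} (hd : 9 ≤ d) :
    numCages 3 4 d = (reps ((d - 5) / 4) ((d - 5) % 4)).card := by
  rw [← Nat.card_eq_finsetCard, numCages]
  have hN := minOrderKGD_three_four hd
  have hequiv : Equivalence fun G H :
      {G : SimpleGraph (Fin (minOrderKGD 3 4 d)) // IsKGDGraph 3 4 d G} =>
      Nonempty (G.1 ≃g H.1) :=
    ⟨fun _ => ⟨.refl⟩, fun ⟨φ⟩ => ⟨φ.symm⟩, fun ⟨φ⟩ ⟨ψ⟩ => ⟨φ.trans ψ⟩⟩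
  have hex : ∀ c : reps ((d - 5) / 4) ((d - 5) % 4),
      ∃ G : {G : SimpleGraph (Fin (minOrderKGD 3 4 d)) // IsKGDGraph 3 4 d G},
        Nonempty (dblOf c.1 ≃g G.1) := by
    intro c
    have hc := (mem_reps.1 c.2).1
    obtain ⟨G, ⟨φ⟩⟩ := exists_iso_fin (c := c.1) (n := minOrderKGD 3 4 d) (by rw [hN, hc])
    exact ⟨⟨G, isKGDGraph_iso φ (isKGDGraph_dblOf hd rfl hc)⟩, ⟨φ⟩⟩
  choose G hG using hex
  symm
  refine Nat.card_eq_of_bijective (fun c => Quot.mk _ (G c)) ⟨fun c c' h => ?_, fun x => ?_⟩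
  · obtain ⟨ψ⟩ := (hequiv.quot_mk_eq_iff _ _).1 h
    obtain ⟨φ⟩ := hG c
    obtain ⟨φ'⟩ := hG c'
    exact Subtype.ext (eq_of_isFirst (mem_reps.1 c.2).2 (mem_reps.1 c'.2).2
      ⟨(φ.trans ψ).trans φ'.symm⟩)
  · obtain ⟨H, rfl⟩ := Quot.exists_rep x
    obtain ⟨c, hc, ⟨φ⟩⟩ := exists_iso_dblOf hd H.2 (by rw [Nat.card_fin]; omega)
    obtain ⟨c', hc', hf, ⟨ψ⟩⟩ := exists_isFirst c
    obtain ⟨θ⟩ := hG ⟨c', mem_reps.2 ⟨hc'.trans hc, hf⟩⟩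
    exact ⟨_, Quot.sound ⟨θ.symm.trans (ψ.trans φ)⟩⟩

end CubicChain

theorem count_cages_three_four (d : ℕ) (hd : 9 ≤ d) :
    numCages 3 4 d =
      if d % 4 = 1 then 1
      else if d % 4 = 2 then 4
      else if d % 4 = 3 then 17 + d / 8
      else 27 + d + (d - 4) / 8 := by
  rw [CubicChain.numCages_eq_card_reps hd, CubicChain.card_reps _ (Nat.mod_lt _ (by norm_num))]
  split_ifs <;> omega
end

section
/- For every integer d ≥ 5, n(3;5,d) = 2d + 10 if d ≡ 0 or 1 (mod 5), and n(3;5,d) = 2d + 8 if d ≡ 2, 3 or 4 (mod 5). Moreover, for every integer d with 2 ≤ d ≤ 4, n(3;5,d) = 2d + 6. -/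
open SimpleGraph

variable {V W : Type*}

section Distance

lemma edist_map_le {G : SimpleGraph V} {H : SimpleGraph W} (f : G →g H) (u v : V) :
    H.edist (f u) (f v) ≤ G.edist u v := by
  by_cases h : G.edist u v = ⊤
  · simp [h]
  · obtain ⟨p, hp⟩ := exists_walk_of_edist_ne_top h
    rw [← hp, ← Walk.length_map f p]
    exact edist_le _

lemma SimpleGraph.Iso.edist_eq {G : SimpleGraph V} {H : SimpleGraph W} (f : G ≃g H) (u v : V) :
    H.edist (f u) (f v) = G.edist u v := by
  refine le_antisymm (edist_map_le f.toHom u v) ?_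
  simpa using edist_map_le f.symm.toHom (f u) (f v)

lemma SimpleGraph.Iso.ediam_eq {G : SimpleGraph V} {H : SimpleGraph W} (f : G ≃g H) :
    H.ediam = G.ediam := by
  refine le_antisymm (ediam_le_of_edist_le fun u v => ?_) (ediam_le_of_edist_le fun u v => ?_)
  · rw [← f.symm.edist_eq]
    exact edist_le_ediam
  · rw [← f.edist_eq]
    exact edist_le_ediam

/-- An integer labelling that changes by at most one along each edge. -/
def IsPotential (G : SimpleGraph V) (f : V → ℤ) : Prop :=
  ∀ a b, G.Adj a b → f a ≤ f b + 1

lemma IsPotential.le_add_length {G : SimpleGraph V} {f : V → ℤ} (hf : IsPotential G f) {a b : V}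
    (p : G.Walk a b) : f a ≤ f b + p.length := by
  induction p with
  | nil => simp
  | cons h p ih =>
    have := hf _ _ h
    simp only [Walk.length_cons, Nat.cast_add, Nat.cast_one]
    linarith

lemma IsPotential.le_edist {G : SimpleGraph V} {f : V → ℤ} (hf : IsPotential G f) {a b : V}
    {d : ℕ} (h : f a = f b + d) : (d : ℕ∞) ≤ G.edist a b := by
  by_cases ht : G.edist a b = ⊤
  · simp [ht]
  · obtain ⟨p, hp⟩ := exists_walk_of_edist_ne_top ht
    rw [← hp]
    have := hf.le_add_length p
    exact_mod_cast (by omega : d ≤ p.length)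

lemma ediam_eq_of_potential {G : SimpleGraph V} {f : V → ℤ} (hf : IsPotential G f) {a b : V}
    {d : ℕ} (h : f a = f b + d) (hd : ∀ u v, G.edist u v ≤ d) : G.ediam = d :=
  le_antisymm (ediam_le_of_edist_le hd) ((hf.le_edist h).trans edist_le_ediam)

end Distance

section Girth

/-- Local form of "girth at least five": a graph without triangles and quadrilaterals. -/
structure NoShortCycle (G : SimpleGraph V) : Prop where
  triangle : ∀ a b c, G.Adj a b → G.Adj b c → ¬ G.Adj c a
  square : ∀ a b c d, G.Adj a b → G.Adj b c → G.Adj c d → G.Adj d a → a = c ∨ b = d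

/-- The graph contains a closed walk of length five. -/
def HasPentagon (G : SimpleGraph V) : Prop :=
  ∃ a b, G.Adj a b ∧ ∃ c, G.Adj b c ∧ ∃ d, G.Adj c d ∧ ∃ e, G.Adj d e ∧ G.Adj e a

lemma noShortCycle_iff_five_le_egirth {G : SimpleGraph V} :
    NoShortCycle G ↔ 5 ≤ G.egirth := by
  rw [le_egirth]
  constructor
  · intro h a w hw
    have h3 := hw.three_le_length
    by_contra! hlt
    have hlt : w.length < 5 := by exact_mod_cast hlt
    match w, hw with
    | .cons h₁ (.cons h₂ (.cons h₃ .nil)), _ => exact h.triangle _ _ _ h₁ h₂ h₃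
    | .cons h₁ (.cons h₂ (.cons h₃ (.cons h₄ .nil))), hw =>
      have := h.square _ _ _ _ h₁ h₂ h₃ h₄
      simp [Walk.cons_isCycle_iff] at hw
      grind
    | .cons _ (.cons _ (.cons _ (.cons _ (.cons _ _)))), _ => simp at hlt; omega
  · intro h
    constructor
    · intro a b c hab hbc hca
      have hw : (Walk.cons hab (.cons hbc (.cons hca .nil))).IsCycle := by
        simp [Walk.cons_isCycle_iff]
        grind [hab.ne, hbc.ne, hca.ne]
      have := h _ _ hw
      revert this
      simp
      decide
    · intro a b c d hab hbc hcd hda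
      by_contra! hne
      have hw : (Walk.cons hab (.cons hbc (.cons hcd (.cons hda .nil)))).IsCycle := by
        simp [Walk.cons_isCycle_iff]
        grind [hab.ne, hbc.ne, hcd.ne, hda.ne]
      have := h _ _ hw
      revert this
      simp
      decide

lemma HasPentagon.egirth_le {G : SimpleGraph V} (h : HasPentagon G) (hG : NoShortCycle G) :
    G.egirth ≤ 5 := by
  obtain ⟨a, b, hab, c, hbc, d, hcd, e, hde, hea⟩ := h
  have h₁ : a ≠ c := by rintro rfl; exact hG.triangle _ _ _ hcd hde hea
  have h₂ : b ≠ d := by rintro rfl; exact hG.triangle _ _ _ hde hea hab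
  have h₃ : c ≠ e := by rintro rfl; exact hG.triangle _ _ _ hea hab hbc
  have h₄ : d ≠ a := by rintro rfl; exact hG.triangle _ _ _ hab hbc hcd
  have h₅ : e ≠ b := by rintro rfl; exact hG.triangle _ _ _ hbc hcd hde
  have hw : (Walk.cons hab (.cons hbc (.cons hcd (.cons hde (.cons hea .nil))))).IsCycle := by
    simp [Walk.cons_isCycle_iff]
    grind [hab.ne, hbc.ne, hcd.ne, hde.ne, hea.ne]
  simpa using egirth_le_length hw

lemma egirth_eq_five {G : SimpleGraph V} (h : NoShortCycle G) (hp : HasPentagon G) :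
    G.egirth = 5 :=
  le_antisymm (hp.egirth_le h) (noShortCycle_iff_five_le_egirth.1 h)

end Girth

section Layers

variable {G : SimpleGraph V}

lemma edist_getVert_of_length_eq_dist {u v : V} (p : G.Walk u v) (hp : p.length = G.dist u v)
    {i : ℕ} (hi : i ≤ p.length) : G.dist u (p.getVert i) = i := by
  have h₁ := dist_le (p.take i)
  have h₂ := dist_le (p.drop i)
  have h₃ := (p.take i).reachable.dist_triangle_left v
  rw [Walk.take_length] at h₁
  rw [Walk.drop_length] at h₂
  omega

/-- The number of vertices whose distance from `u` lies in `[a, b)`. -/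
noncomputable def layerCard (G : SimpleGraph V) (u : V) (a b : ℕ) : ℕ :=
  ({w | a ≤ G.dist u w ∧ G.dist u w < b} : Set V).ncard

lemma layerCard_add [Finite V] (u : V) {a b c : ℕ} (hab : a ≤ b) (hbc : b ≤ c) :
    layerCard G u a b + layerCard G u b c = layerCard G u a c := by
  unfold layerCard
  rw [← Set.ncard_union_eq]
  · congr 1
    ext w
    simp only [Set.mem_union, Set.mem_ofPred_eq]
    omega
  · rw [Set.disjoint_left]
    intro w
    simp only [Set.mem_ofPred_eq]
    omega

lemma layerCard_le [Fintype V] (u : V) (a b : ℕ) : layerCard G u a b ≤ Fintype.card V := by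
  rw [← Nat.card_eq_fintype_card, ← Set.ncard_univ]
  exact Set.ncard_le_ncard (Set.subset_univ _)

lemma card_le_layerCard [Finite V] (hc : G.Connected) {u v : V} {i r a b : ℕ} (hv : G.dist u v = i)
    {S : Finset V} (hS : ∀ w ∈ S, G.edist v w ≤ r)
    (hab : ∀ w j, G.dist u w = j → i ≤ j + r → j ≤ i + r → a ≤ j ∧ j < b) :
    S.card ≤ layerCard G u a b := by
  rw [← Set.ncard_coe_finset]
  refine Set.ncard_le_ncard fun w hw => ?_
  have h := hS w hw
  rw [← (hc v w).coe_dist_eq_edist] at h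
  have h : G.dist v w ≤ r := by exact_mod_cast h
  have h₁ : G.dist u w ≤ G.dist u v + G.dist v w := hc.dist_triangle
  have h₂ : G.dist u v ≤ G.dist u w + G.dist w v := hc.dist_triangle
  rw [dist_comm (u := w)] at h₂
  exact hab w _ rfl (by omega) (by omega)

end Layers

section LowerBound

variable [Fintype V] {G : SimpleGraph V} [DecidableRel G.Adj]

lemma card_neighborFinset (hr : IsRegular' 3 G) (v : V) : (G.neighborFinset v).card = 3 := by
  rw [← Set.ncard_coe_finset, coe_neighborFinset, hr v]

lemma exists_card_four [DecidableEq V] (hr : IsRegular' 3 G) (v : V) :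
    ∃ S : Finset V, S.card = 4 ∧ ∀ w ∈ S, G.edist v w ≤ 1 := by
  refine ⟨insert v (G.neighborFinset v), ?_, ?_⟩
  · rw [Finset.card_insert_of_notMem (by simp), card_neighborFinset hr]
  · intro w hw
    rw [edist_le_one_iff_adj_or_eq]
    simp at hw
    tauto

lemma exists_card_ten [DecidableEq V] (hr : IsRegular' 3 G) (hG : NoShortCycle G) (v : V) :
    ∃ S : Finset V, S.card = 10 ∧ ∀ w ∈ S, G.edist v w ≤ 2 := by
  let N := (G.neighborFinset v).biUnion fun u => (G.neighborFinset u).erase v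
  have hN : N.card = 6 := by
    rw [Finset.card_biUnion]
    · rw [Finset.sum_congr rfl (g := fun _ => 2), Finset.sum_const, card_neighborFinset hr]
      · rfl
      · intro u hu
        rw [Finset.card_erase_of_mem (by simpa [adj_comm] using hu), card_neighborFinset hr]
    · intro a ha b hb hab
      rw [Function.onFun, Finset.disjoint_left]
      intro w hwa hwb
      simp only [Finset.mem_coe, Finset.mem_erase, mem_neighborFinset] at ha hb hwa hwb
      have := hG.square _ _ _ _ ha hwa.2 hwb.2.symm hb.symm
      grind
  have hd : Disjoint (G.neighborFinset v) N := by
    rw [Finset.disjoint_left]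
    intro w hw hwN
    simp only [N, Finset.mem_biUnion, Finset.mem_erase, mem_neighborFinset] at hw hwN
    obtain ⟨u, hu, -, huw⟩ := hwN
    exact hG.triangle _ _ _ hu huw hw.symm
  have hv : v ∉ G.neighborFinset v ∪ N := by simp [N]
  refine ⟨insert v (G.neighborFinset v ∪ N), ?_, ?_⟩
  · rw [Finset.card_insert_of_notMem hv, Finset.card_union_of_disjoint hd, hN,
      card_neighborFinset hr]
  · intro w hw
    simp only [Finset.mem_insert, Finset.mem_union, mem_neighborFinset, N, Finset.mem_biUnion,
      Finset.mem_erase] at hw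
    rcases hw with rfl | hw | ⟨u, hu, -, huw⟩
    · simp
    · exact (edist_eq_one_iff_adj.2 hw).le.trans (by norm_num)
    · calc G.edist v w ≤ G.edist v u + G.edist u w := G.edist_triangle
        _ = 2 := by
          rw [edist_eq_one_iff_adj.2 hu, edist_eq_one_iff_adj.2 huw]
          norm_num

lemma even_card_of_cubic (hr : IsRegular' 3 G) : Even (Fintype.card V) := by
  have h := G.sum_degrees_eq_twice_card_edges
  simp only [← card_neighborFinset_eq_degree, card_neighborFinset hr] at h
  simp at h
  grind

/-- The order of a cubic graph of girth at least five and diameter `d`. -/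
lemma card_lower_bound [DecidableEq V] [Nonempty V] {d : ℕ} (hr : IsRegular' 3 G)
    (hG : NoShortCycle G) (hd : G.ediam = d) :
    (5 ≤ d → d % 5 = 0 ∨ d % 5 = 1 → 2 * d + 10 ≤ Fintype.card V) ∧
    (5 ≤ d → d % 5 = 2 ∨ d % 5 = 3 ∨ d % 5 = 4 → 2 * d + 8 ≤ Fintype.card V) ∧
    (2 ≤ d → d ≤ 4 → 2 * d + 6 ≤ Fintype.card V) := by
  have hc : G.Connected := connected_of_ediam_ne_top (by simp [hd])
  obtain ⟨u, v, huv⟩ := G.exists_edist_eq_ediam_of_finite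
  rw [hd, ← (hc u v).coe_dist_eq_edist] at huv
  have huv : G.dist u v = d := by exact_mod_cast huv
  obtain ⟨p, hp⟩ := hc.exists_walk_length_eq_dist u v
  have hmax (w : V) : G.dist u w ≤ d := by
    have h : G.edist u w ≤ G.ediam := edist_le_ediam
    rw [hd, ← (hc u w).coe_dist_eq_edist] at h
    exact_mod_cast h
  have hver (i : ℕ) (hi : i ≤ d) : ∃ w, G.dist u w = i :=
    ⟨_, edist_getVert_of_length_eq_dist p hp (by omega)⟩
  have window {i a b : ℕ} (hi : i ≤ d) (ha : a ≤ i - 2) (hb : i + 2 < b ∨ d < b) :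
      10 ≤ layerCard G u a b := by
    obtain ⟨w, hw⟩ := hver i hi
    obtain ⟨S, hS, hSw⟩ := exists_card_ten hr hG w
    rw [← hS]
    exact card_le_layerCard hc hw (r := 2) hSw fun x j hj _ _ => by have := hmax x; omega
  have triple {i a b : ℕ} (hi : i ≤ d) (ha : a ≤ i - 1) (hb : i + 1 < b ∨ d < b) :
      4 ≤ layerCard G u a b := by
    obtain ⟨w, hw⟩ := hver i hi
    obtain ⟨S, hS, hSw⟩ := exists_card_four hr w
    rw [← hS]
    exact card_le_layerCard hc hw (r := 1) hSw fun x j hj _ _ => by have := hmax x; omega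
  have single {i : ℕ} (hi : i ≤ d) : 1 ≤ layerCard G u i (i + 1) := by
    obtain ⟨w, hw⟩ := hver i hi
    exact card_le_layerCard (S := {w}) hc hw (r := 0) (by simp) fun x j hj h₁ h₂ => by omega
  have middle (q : ℕ) (hq : 5 * q + 5 ≤ d) : 10 * q ≤ layerCard G u 3 (3 + 5 * q) := by
    induction q with
    | zero => simp
    | succ q ih =>
      have h₁ := ih (by omega)
      have h₂ := window (i := 5 + 5 * q) (a := 3 + 5 * q) (b := 3 + 5 * (q + 1))
        (by omega) (by omega) (by omega)
      have h₃ := layerCard_add (G := G) u (a := 3) (b := 3 + 5 * q) (c := 3 + 5 * (q + 1))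
        (by omega) (by omega)
      omega
  have heven := even_card_of_cubic hr
  rw [Nat.even_iff] at heven
  have hall := layerCard_le (G := G) u 0 (d + 1)
  have main (hd5 : 5 ≤ d) :
      10 * (d / 5) + 10 + layerCard G u (3 + 5 * (d / 5 - 1)) (d - 2) ≤ Fintype.card V := by
    have h₁ := window (i := 0) (a := 0) (b := 3) (by omega) (by omega) (by omega)
    have h₂ := middle (d / 5 - 1) (by omega)
    have h₃ := window (i := d) (a := d - 2) (b := d + 1) le_rfl le_rfl (by omega)
    have e₁ := layerCard_add (G := G) u (a := 0) (b := 3) (c := d + 1) (by omega) (by omega)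
    have e₂ := layerCard_add (G := G) u (a := 3) (b := 3 + 5 * (d / 5 - 1)) (c := d + 1)
      (by omega) (by omega)
    have e₃ := layerCard_add (G := G) u (a := 3 + 5 * (d / 5 - 1)) (b := d - 2) (c := d + 1)
      (by omega) (by omega)
    omega
  refine ⟨fun hd5 hmod => ?_, fun hd5 hmod => ?_, fun h2 h4 => ?_⟩
  · have := main hd5
    rcases hmod with hmod | hmod
    · omega
    · have h₁ := single (i := d - 3) (by omega)
      rw [show 3 + 5 * (d / 5 - 1) = d - 3 by omega, show d - 2 = d - 3 + 1 by omega] at this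
      omega
  · have := main hd5
    rcases hmod with hmod | hmod | hmod
    · have h₁ := single (i := d - 4) (by omega)
      have h₂ := single (i := d - 3) (by omega)
      have h₃ := layerCard_add (G := G) u (a := d - 4) (b := d - 4 + 1) (c := d - 2)
        (by omega) (by omega)
      rw [show d - 3 + 1 = d - 2 by omega, show d - 3 = d - 4 + 1 by omega] at h₂
      rw [show 3 + 5 * (d / 5 - 1) = d - 4 by omega] at this
      omega
    · have h₁ := triple (i := d - 4) (a := d - 5) (b := d - 2) (by omega) (by omega) (by omega)
      rw [show 3 + 5 * (d / 5 - 1) = d - 5 by omega] at this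
      omega
    · have h₁ := single (i := d - 6) (by omega)
      have h₂ := triple (i := d - 4) (a := d - 6 + 1) (b := d - 2) (by omega) (by omega) (by omega)
      have h₃ := layerCard_add (G := G) u (a := d - 6) (b := d - 6 + 1) (c := d - 2)
        (by omega) (by omega)
      rw [show 3 + 5 * (d / 5 - 1) = d - 6 by omega] at this
      omega
  · have h₁ := window (i := 0) (a := 0) (b := 3) (by omega) (by omega) (by omega)
    have h₂ := layerCard_add (G := G) u (a := 0) (b := 3) (c := d + 1) (by omega) (by omega)
    obtain rfl | rfl | rfl : d = 2 ∨ d = 3 ∨ d = 4 := by omega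
    · omega
    · have h₃ := single (i := 3) le_rfl
      omega
    · have h₃ := triple (i := 4) (a := 3) (b := 4 + 1) le_rfl (by omega) (by omega)
      omega

end LowerBound

section Pieces

/-- A graph of girth five and diameter at most `D`, together with a potential. -/
structure IsPiece (G : SimpleGraph V) (f : V → ℤ) (D : ℕ) : Prop where
  noShortCycle : NoShortCycle G
  hasPentagon : HasPentagon G
  isPotential : IsPotential G f
  edist_le : ∀ u v, G.edist u v ≤ D

lemma IsPiece.add_const {G : SimpleGraph V} {f : V → ℤ} {D : ℕ} (h : IsPiece G f D) (c : ℤ) :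
    IsPiece G (fun v => f v + c) D where
  __ := h
  isPotential a b hab := by
    have := h.isPotential a b hab
    dsimp only
    linarith

lemma IsPiece.const_sub {G : SimpleGraph V} {f : V → ℤ} {D : ℕ} (h : IsPiece G f D) (c : ℤ) :
    IsPiece G (fun v => c - f v) D where
  __ := h
  isPotential a b hab := by
    have := h.isPotential b a hab.symm
    dsimp only
    linarith

lemma IsPiece.isKGDGraph {G : SimpleGraph V} {f : V → ℤ} {d : ℕ} (h : IsPiece G f d)
    (hr : IsRegular' 3 G) {a b : V} (hab : f a = f b + d) : IsKGDGraph 3 5 d G :=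
  ⟨hr, egirth_eq_five h.noShortCycle h.hasPentagon,
    ediam_eq_of_potential h.isPotential hab h.edist_le⟩

/-- The disjoint union of two graphs with an additional edge joining `x` to `y`. -/
def bridge (G : SimpleGraph V) (H : SimpleGraph W) (x : V) (y : W) : SimpleGraph (V ⊕ W) where
  Adj
    | .inl a, .inl b => G.Adj a b
    | .inl a, .inr b => a = x ∧ b = y
    | .inr b, .inl a => a = x ∧ b = y
    | .inr a, .inr b => H.Adj a b
  symm := ⟨by
    rintro (a | a) (b | b) h
    exacts [Adj.symm h, h, h, Adj.symm h]⟩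
  loopless := ⟨by
    rintro (a | a) h
    exacts [G.irrefl h, H.irrefl h]⟩

section Bridge

variable {G : SimpleGraph V} {H : SimpleGraph W} {x : V} {y : W}

@[simp] lemma bridge_adj_inl_inl {a b : V} :
    (bridge G H x y).Adj (.inl a) (.inl b) ↔ G.Adj a b := Iff.rfl

@[simp] lemma bridge_adj_inl_inr {a : V} {b : W} :
    (bridge G H x y).Adj (.inl a) (.inr b) ↔ a = x ∧ b = y := Iff.rfl

@[simp] lemma bridge_adj_inr_inl {a : V} {b : W} :
    (bridge G H x y).Adj (.inr b) (.inl a) ↔ a = x ∧ b = y := Iff.rfl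

@[simp] lemma bridge_adj_inr_inr {a b : W} :
    (bridge G H x y).Adj (.inr a) (.inr b) ↔ H.Adj a b := Iff.rfl

lemma ncard_neighborSet_bridge_inl [Finite V] [DecidableEq V] (v : V) :
    ((bridge G H x y).neighborSet (.inl v)).ncard =
      (G.neighborSet v).ncard + if v = x then 1 else 0 := by
  have h : (bridge G H x y).neighborSet (.inl v) =
      Sum.inl '' G.neighborSet v ∪ if v = x then {Sum.inr y} else ∅ := by
    ext (w | w) <;> by_cases hv : v = x <;> simp [hv]
  rw [h, Set.ncard_union_eq (by split_ifs <;> simp) (Set.toFinite _) (by split_ifs <;> simp),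
    Set.ncard_image_of_injective _ Sum.inl_injective]
  split_ifs <;> simp

lemma ncard_neighborSet_bridge_inr [Finite W] [DecidableEq W] (w : W) :
    ((bridge G H x y).neighborSet (.inr w)).ncard =
      (H.neighborSet w).ncard + if w = y then 1 else 0 := by
  have h : (bridge G H x y).neighborSet (.inr w) =
      Sum.inr '' H.neighborSet w ∪ if w = y then {Sum.inl x} else ∅ := by
    ext (v | v) <;> by_cases hv : w = y <;> simp [hv]
  rw [h, Set.ncard_union_eq (by split_ifs <;> simp) (Set.toFinite _) (by split_ifs <;> simp),
    Set.ncard_image_of_injective _ Sum.inr_injective]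
  split_ifs <;> simp

lemma edist_bridge_inl_inl_le (a b : V) :
    (bridge G H x y).edist (.inl a) (.inl b) ≤ G.edist a b :=
  edist_map_le (⟨Sum.inl, id⟩ : G →g bridge G H x y) a b

lemma edist_bridge_inr_inr_le (a b : W) :
    (bridge G H x y).edist (.inr a) (.inr b) ≤ H.edist a b :=
  edist_map_le (⟨Sum.inr, id⟩ : H →g bridge G H x y) a b

lemma edist_bridge_inl_inr_le {a : V} {b : W} {p q : ℕ} (ha : G.edist a x ≤ p)
    (hb : H.edist y b ≤ q) : (bridge G H x y).edist (.inl a) (.inr b) ≤ (p + 1 + q : ℕ) := by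
  have h : (bridge G H x y).edist (.inl x) (.inr y) ≤ 1 := by
    rw [edist_le_one_iff_adj_or_eq]
    simp
  push_cast
  calc _ ≤ (bridge G H x y).edist (.inl a) (.inl x) + (bridge G H x y).edist (.inl x) (.inr b) :=
        SimpleGraph.edist_triangle
    _ ≤ (bridge G H x y).edist (.inl a) (.inl x) + ((bridge G H x y).edist (.inl x) (.inr y) +
        (bridge G H x y).edist (.inr y) (.inr b)) := by
        gcongr
        exact SimpleGraph.edist_triangle
    _ ≤ p + (1 + q) := by
        gcongr
        · exact (edist_bridge_inl_inl_le _ _).trans ha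
        · exact (edist_bridge_inr_inr_le _ _).trans hb
    _ = _ := by ring

lemma NoShortCycle.bridge (hG : NoShortCycle G) (hH : NoShortCycle H) (x : V) (y : W) :
    NoShortCycle (bridge G H x y) where
  triangle := by
    rintro (a | a) (b | b) (c | c) h₁ h₂ h₃ <;> simp only [bridge_adj_inl_inl,
      bridge_adj_inl_inr, bridge_adj_inr_inl, bridge_adj_inr_inr] at h₁ h₂ h₃
    all_goals first
      | exact hG.triangle _ _ _ h₁ h₂ h₃
      | exact hH.triangle _ _ _ h₁ h₂ h₃
      | grind [G.irrefl, H.irrefl]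
  square := by
    rintro (a | a) (b | b) (c | c) (d | d) h₁ h₂ h₃ h₄ <;> simp only [bridge_adj_inl_inl,
      bridge_adj_inl_inr, bridge_adj_inr_inl, bridge_adj_inr_inr] at h₁ h₂ h₃ h₄
    all_goals first
      | simpa using hG.square _ _ _ _ h₁ h₂ h₃ h₄
      | simpa using hH.square _ _ _ _ h₁ h₂ h₃ h₄
      | grind [G.irrefl, H.irrefl]

lemma HasPentagon.bridge (hG : HasPentagon G) (H : SimpleGraph W) (x : V) (y : W) :
    HasPentagon (bridge G H x y) := by
  obtain ⟨a, b, hab, c, hbc, d, hcd, e, hde, hea⟩ := hG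
  exact ⟨.inl a, .inl b, hab, .inl c, hbc, .inl d, hcd, .inl e, hde, hea⟩

lemma IsPiece.bridge {f : V → ℤ} {g : W → ℤ} {D₁ D₂ p q D : ℕ} (hG : IsPiece G f D₁)
    (hH : IsPiece H g D₂) (hfg : f x ≤ g y + 1) (hgf : g y ≤ f x + 1)
    (hx : ∀ v, G.edist x v ≤ p) (hy : ∀ w, H.edist y w ≤ q)
    (h₁ : D₁ ≤ D) (h₂ : D₂ ≤ D) (hpq : p + 1 + q ≤ D) :
    IsPiece (bridge G H x y) (Sum.elim f g) D where
  noShortCycle := hG.noShortCycle.bridge hH.noShortCycle x y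
  hasPentagon := hG.hasPentagon.bridge H x y
  isPotential := by
    rintro (a | a) (b | b) h
    · exact hG.isPotential a b h
    · obtain ⟨rfl, rfl⟩ := h
      exact hfg
    · obtain ⟨rfl, rfl⟩ := h
      exact hgf
    · exact hH.isPotential a b h
  edist_le := by
    have hx' (v : V) : G.edist v x ≤ p := edist_comm.trans_le (hx v)
    rintro (a | a) (b | b)
    · exact (edist_bridge_inl_inl_le a b).trans
        ((hG.edist_le a b).trans (Nat.cast_le.2 h₁))
    · exact (edist_bridge_inl_inr_le (hx' a) (hy b)).trans (Nat.cast_le.2 hpq)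
    · rw [edist_comm]
      exact (edist_bridge_inl_inr_le (hx' b) (hy a)).trans (Nat.cast_le.2 hpq)
    · exact (edist_bridge_inr_inr_le a b).trans
        ((hH.edist_le a b).trans (Nat.cast_le.2 h₂))

end Bridge

/-- There is an end block of order `n` and depth `e`: a graph that is cubic except for a root of
degree two, from which every vertex has distance at most `e`. -/
def ExistsBlock (n e : ℕ) : Prop :=
  ∃ (V : Type) (_ : Fintype V) (_ : DecidableEq V) (G : SimpleGraph V) (x : V) (f : V → ℤ),
    Fintype.card V = n ∧ IsPiece G f (e + 3) ∧ f x = 0 ∧ (∃ v, f v = e) ∧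
    (∀ v, G.edist x v ≤ e) ∧ ∀ v, (G.neighborSet v).ncard = if v = x then 2 else 3

lemma IsKGDGraph.exists_fin [Fintype V] {k g d n : ℕ} {G : SimpleGraph V} (h : IsKGDGraph k g d G)
    (hn : Fintype.card V = n) : ∃ H : SimpleGraph (Fin n), IsKGDGraph k g d H := by
  let φ := Iso.map (Fintype.equivFinOfCardEq hn) G
  refine ⟨_, fun v => ?_, φ.egirth_eq.symm.trans h.2.1, φ.ediam_eq.trans h.2.2⟩
  rw [← h.1 (φ.symm v)]
  exact Set.ncard_congr' (φ.symm.mapNeighborSet v)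

lemma ExistsBlock.join {n₁ n₂ e₁ e₂ : ℕ} (h₁ : ExistsBlock n₁ e₁) (h₂ : ExistsBlock n₂ e₂)
    (he₁ : 2 ≤ e₁) (he₂ : 2 ≤ e₂) :
    ∃ G : SimpleGraph (Fin (n₁ + n₂)), IsKGDGraph 3 5 (e₁ + e₂ + 1) G := by
  obtain ⟨V, _, _, G, x, f, hV, hG, hfx, ⟨v, hv⟩, hx, hdV⟩ := h₁
  obtain ⟨W, _, _, H, y, g, hW, hH, hgy, ⟨w, hw⟩, hy, hdW⟩ := h₂
  have hp : IsPiece (bridge G H x y) _ (e₁ + e₂ + 1) :=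
    hG.bridge (hH.const_sub (-1)) (by simp [hfx, hgy]) (by simp [hfx, hgy]) hx hy
      (by omega) (by omega) (by omega)
  refine (hp.isKGDGraph ?_ (a := .inl v) (b := .inr w) ?_).exists_fin (by simp [hV, hW])
  · rintro (a | a)
    · rw [ncard_neighborSet_bridge_inl, hdV]
      split_ifs <;> rfl
    · rw [ncard_neighborSet_bridge_inr, hdW]
      split_ifs <;> rfl
  · simp [hv, hw]
    ring

end Pieces

section Explicit

variable {n : ℕ}

/-- The graph on `Fin n` given by a table of neighbours. -/
def ofTable (nb : Fin n → Finset (Fin n)) : SimpleGraph (Fin n) :=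
  SimpleGraph.fromRel fun a b => b ∈ nb a

/-- The vertices reached from `u` in at most `k` steps in the table `nb`. -/
def tableBall (nb : Fin n → Finset (Fin n)) : ℕ → Fin n → Finset (Fin n)
  | 0, u => {u}
  | k + 1, u => (tableBall nb k u).biUnion fun w => insert w (nb w)

/-- The table is symmetric and irreflexive. -/
abbrev IsAdjTable (nb : Fin n → Finset (Fin n)) : Prop :=
  ∀ a, ∀ b ∈ nb a, a ≠ b ∧ a ∈ nb b

variable {nb : Fin n → Finset (Fin n)}

lemma IsAdjTable.adj_iff (h : IsAdjTable nb) {a b : Fin n} : (ofTable nb).Adj a b ↔ b ∈ nb a := by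
  rw [ofTable, fromRel_adj]
  constructor
  · rintro ⟨-, hab | hab⟩
    exacts [hab, (h _ _ hab).2]
  · exact fun hab => ⟨(h _ _ hab).1, .inl hab⟩

lemma IsAdjTable.ncard_neighborSet (h : IsAdjTable nb) (v : Fin n) :
    ((ofTable nb).neighborSet v).ncard = (nb v).card := by
  rw [← Set.ncard_coe_finset]
  congr 1
  ext w
  simp [h.adj_iff]

lemma IsAdjTable.edist_le_of_mem_tableBall (h : IsAdjTable nb) {k : ℕ} {u v : Fin n}
    (hv : v ∈ tableBall nb k u) : (ofTable nb).edist u v ≤ k := by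
  induction k generalizing v with
  | zero =>
    obtain rfl : v = u := by simpa [tableBall] using hv
    simp
  | succ k ih =>
    simp only [tableBall, Finset.mem_biUnion, Finset.mem_insert] at hv
    obtain ⟨w, hw, hvw⟩ := hv
    have h₁ : (ofTable nb).edist w v ≤ 1 := by
      rw [edist_le_one_iff_adj_or_eq, h.adj_iff]
      tauto
    push_cast
    exact SimpleGraph.edist_triangle.trans (add_le_add (ih hw) h₁)

lemma IsAdjTable.isPiece (h : IsAdjTable nb) {f : Fin n → ℕ} {D : ℕ}
    (triangle : ∀ a, ∀ b ∈ nb a, ∀ c ∈ nb b, a ∉ nb c)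
    (square : ∀ a, ∀ b ∈ nb a, ∀ c ∈ nb b, ∀ d ∈ nb c, a ∈ nb d → a = c ∨ b = d)
    (pentagon : ∃ a, ∃ b ∈ nb a, ∃ c ∈ nb b, ∃ d ∈ nb c, ∃ e ∈ nb d, a ∈ nb e)
    (potential : ∀ a, ∀ b ∈ nb a, f a ≤ f b + 1)
    (ball : ∀ u, tableBall nb D u = Finset.univ) :
    IsPiece (ofTable nb) (fun v => (f v : ℤ)) D where
  noShortCycle :=
    { triangle := by simpa only [h.adj_iff] using fun a b c hab hbc => triangle a b hab c hbc
      square := by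
        simpa only [h.adj_iff] using fun a b c d hab hbc hcd => square a b hab c hbc d hcd }
  hasPentagon := by simpa only [HasPentagon, h.adj_iff, exists_and_left] using pentagon
  isPotential a b hab := by
    have := potential a b (h.adj_iff.1 hab)
    dsimp only
    omega
  edist_le u v := h.edist_le_of_mem_tableBall (by simp [ball])

/-- The Petersen graph. -/
def petersen : Fin 10 → Finset (Fin 10) :=
  ![{1, 2, 3}, {0, 4, 5}, {0, 6, 7}, {0, 8, 9}, {1, 7, 8}, {1, 6, 9}, {2, 5, 8}, {2, 4, 9},
    {3, 4, 6}, {3, 5, 7}]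

/-- Distances from the vertex 0 of `petersen`. -/
def petersenLevel : Fin 10 → ℕ :=
  ![0, 1, 1, 1, 2, 2, 2, 2, 2, 2]

/-- A cubic graph of order 12, girth 5 and diameter 3. -/
def twelve : Fin 12 → Finset (Fin 12) :=
  ![{1, 2, 3}, {0, 4, 5}, {0, 6, 7}, {0, 8, 9}, {1, 8, 11}, {1, 7, 10}, {2, 8, 10}, {2, 5, 9},
    {3, 4, 6}, {3, 7, 11}, {5, 6, 11}, {4, 9, 10}]

/-- Distances from the vertex 0 of `twelve`. -/
def twelveLevel : Fin 12 → ℕ :=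
  ![0, 1, 1, 1, 2, 2, 2, 2, 2, 2, 3, 3]

/-- A cubic graph of order 14, girth 5 and diameter 4. -/
def fourteen : Fin 14 → Finset (Fin 14) :=
  ![{1, 2, 3}, {0, 4, 5}, {0, 6, 7}, {0, 8, 9}, {1, 11, 13}, {1, 6, 10}, {2, 5, 12}, {2, 8, 11},
    {3, 7, 10}, {3, 12, 13}, {5, 8, 13}, {4, 7, 12}, {6, 9, 11}, {4, 9, 10}]

/-- Distances from the vertex 2 of `fourteen`. -/
def fourteenLevel : Fin 14 → ℕ :=
  ![1, 2, 0, 2, 3, 2, 1, 1, 2, 3, 3, 2, 2, 4]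

/-- A cubic graph of order 20, girth 5 and diameter 5. -/
def twenty : Fin 20 → Finset (Fin 20) :=
  ![{1, 2, 3}, {0, 4, 5}, {0, 6, 7}, {0, 8, 9}, {1, 9, 18}, {1, 7, 14}, {2, 8, 15}, {2, 5, 19},
    {3, 6, 16}, {3, 4, 19}, {11, 12, 13}, {10, 14, 15}, {10, 16, 17}, {10, 18, 19}, {5, 11, 16},
    {6, 11, 17}, {8, 12, 14}, {12, 15, 18}, {4, 13, 17}, {7, 9, 13}]

/-- Distances from the vertex 0 of `twenty`. -/
def twentyLevel : Fin 20 → ℕ :=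
  ![0, 1, 1, 1, 2, 2, 2, 2, 2, 2, 5, 4, 4, 4, 3, 3, 3, 4, 3, 3]

/-- A cubic graph of order 22, girth 5 and diameter 6. -/
def twentyTwo : Fin 22 → Finset (Fin 22) :=
  ![{1, 2, 3}, {0, 4, 5}, {0, 6, 7}, {0, 8, 9}, {1, 7, 10}, {1, 6, 9}, {2, 5, 8}, {2, 4, 9},
    {3, 6, 11}, {3, 5, 7}, {4, 11, 16}, {8, 10, 20}, {13, 14, 15}, {12, 16, 17}, {12, 18, 19},
    {12, 20, 21}, {10, 13, 19}, {13, 18, 21}, {14, 17, 20}, {14, 16, 21}, {11, 15, 18},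
    {15, 17, 19}]

/-- Distances from the vertex 0 of `twentyTwo`. -/
def twentyTwoLevel : Fin 22 → ℕ :=
  ![0, 1, 1, 1, 2, 2, 2, 2, 2, 2, 3, 3, 6, 5, 6, 5, 4, 6, 5, 5, 4, 6]

/-- The Petersen graph with the edge between the vertices 4 and 8 removed. -/
def link : Fin 10 → Finset (Fin 10) :=
  ![{1, 2, 3}, {0, 4, 5}, {0, 6, 7}, {0, 8, 9}, {1, 7}, {1, 6, 9}, {2, 5, 8}, {2, 4, 9}, {3, 6},
    {3, 5, 7}]

/-- Distances from the vertex 8 of `link`. -/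
def linkLevel : Fin 10 → ℕ :=
  ![2, 3, 2, 1, 4, 2, 1, 3, 0, 2]

/-- The Petersen graph with one edge subdivided by the vertex 10. -/
def eleven : Fin 11 → Finset (Fin 11) :=
  ![{1, 2, 3}, {0, 4, 5}, {0, 6, 7}, {0, 8, 9}, {1, 7, 10}, {1, 6, 9}, {2, 5, 8}, {2, 4, 9},
    {3, 6, 10}, {3, 5, 7}, {4, 8}]

/-- Distances from the vertex 10 of `eleven`. -/
def elevenLevel : Fin 11 → ℕ :=
  ![3, 2, 3, 2, 1, 3, 2, 2, 1, 3, 0]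

/-- A cubic graph of order 12 with one edge subdivided by the vertex 12. -/
def thirteen : Fin 13 → Finset (Fin 13) :=
  ![{1, 2, 3}, {0, 4, 5}, {0, 6, 7}, {0, 9, 12}, {1, 7, 11}, {1, 8, 10}, {2, 8, 11}, {2, 4, 10},
    {5, 6, 12}, {3, 10, 11}, {5, 7, 9}, {4, 6, 9}, {3, 8}]

/-- Distances from the vertex 12 of `thirteen`. -/
def thirteenLevel : Fin 13 → ℕ :=
  ![2, 3, 3, 1, 4, 2, 2, 4, 1, 2, 3, 3, 0]

/-- An end block of order 19 with root 14. -/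
def nineteen : Fin 19 → Finset (Fin 19) :=
  ![{1, 2, 3}, {0, 4, 5}, {0, 6, 7}, {0, 8, 9}, {1, 7, 13}, {1, 6, 9}, {2, 5, 8}, {2, 4, 9},
    {3, 6, 16}, {3, 5, 7}, {11, 12, 13}, {10, 14, 15}, {10, 16, 17}, {4, 10, 18}, {11, 17},
    {11, 16, 18}, {8, 12, 15}, {12, 14, 18}, {13, 15, 17}]

/-- Distances from the vertex 14 of `nineteen`. -/
def nineteenLevel : Fin 19 → ℕ :=
  ![6, 5, 6, 5, 4, 6, 5, 5, 4, 6, 2, 1, 2, 3, 0, 2, 3, 1, 2]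

lemma isAdjTable_petersen : IsAdjTable petersen := by decide +kernel

lemma isPiece_petersen : IsPiece (ofTable petersen) (fun v => (petersenLevel v : ℤ)) 2 :=
  isAdjTable_petersen.isPiece (by decide +kernel) (by decide +kernel) (by decide +kernel)
    (by decide +kernel) (by decide +kernel)

lemma isAdjTable_twelve : IsAdjTable twelve := by decide +kernel

lemma isPiece_twelve : IsPiece (ofTable twelve) (fun v => (twelveLevel v : ℤ)) 3 :=
  isAdjTable_twelve.isPiece (by decide +kernel) (by decide +kernel) (by decide +kernel)
    (by decide +kernel) (by decide +kernel)

lemma isAdjTable_fourteen : IsAdjTable fourteen := by decide +kernel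

lemma isPiece_fourteen : IsPiece (ofTable fourteen) (fun v => (fourteenLevel v : ℤ)) 4 :=
  isAdjTable_fourteen.isPiece (by decide +kernel) (by decide +kernel) (by decide +kernel)
    (by decide +kernel) (by decide +kernel)

lemma isAdjTable_twenty : IsAdjTable twenty := by decide +kernel

lemma isPiece_twenty : IsPiece (ofTable twenty) (fun v => (twentyLevel v : ℤ)) 5 :=
  isAdjTable_twenty.isPiece (by decide +kernel) (by decide +kernel) (by decide +kernel)
    (by decide +kernel) (by decide +kernel)

lemma isAdjTable_twentyTwo : IsAdjTable twentyTwo := by decide +kernel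

lemma isPiece_twentyTwo : IsPiece (ofTable twentyTwo) (fun v => (twentyTwoLevel v : ℤ)) 6 :=
  isAdjTable_twentyTwo.isPiece (by decide +kernel) (by decide +kernel) (by decide +kernel)
    (by decide +kernel) (by decide +kernel)

lemma isAdjTable_link : IsAdjTable link := by decide +kernel

lemma isPiece_link : IsPiece (ofTable link) (fun v => (linkLevel v : ℤ)) 4 :=
  isAdjTable_link.isPiece (by decide +kernel) (by decide +kernel) (by decide +kernel)
    (by decide +kernel) (by decide +kernel)

lemma isAdjTable_eleven : IsAdjTable eleven := by decide +kernel

lemma isPiece_eleven : IsPiece (ofTable eleven) (fun v => (elevenLevel v : ℤ)) 6 :=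
  isAdjTable_eleven.isPiece (by decide +kernel) (by decide +kernel) (by decide +kernel)
    (by decide +kernel) (by decide +kernel)

lemma isAdjTable_thirteen : IsAdjTable thirteen := by decide +kernel

lemma isPiece_thirteen : IsPiece (ofTable thirteen) (fun v => (thirteenLevel v : ℤ)) 7 :=
  isAdjTable_thirteen.isPiece (by decide +kernel) (by decide +kernel) (by decide +kernel)
    (by decide +kernel) (by decide +kernel)

lemma isAdjTable_nineteen : IsAdjTable nineteen := by decide +kernel

lemma isPiece_nineteen : IsPiece (ofTable nineteen) (fun v => (nineteenLevel v : ℤ)) 9 :=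
  isAdjTable_nineteen.isPiece (by decide +kernel) (by decide +kernel) (by decide +kernel)
    (by decide +kernel) (by decide +kernel)

lemma ExistsBlock.extend {n e : ℕ} (h : ExistsBlock n e) : ExistsBlock (n + 10) (e + 5) := by
  obtain ⟨V, _, _, G, x, f, hV, hG, hfx, ⟨v, hv⟩, hx, hdV⟩ := h
  refine ⟨Fin 10 ⊕ V, inferInstance, inferInstance, bridge (ofTable link) G 4 x, .inl 8, _,
    by simp [hV, add_comm], isPiece_link.bridge (hG.add_const 5) (p := 4) (q := e) ?_ ?_
      (isPiece_link.edist_le 4) hx (by omega) (by omega) (by omega), ?_, ⟨.inr v, ?_⟩, ?_, ?_⟩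
  · rw [hfx]
    decide
  · rw [hfx]
    decide
  · rfl
  · simp [hv]
  · rintro (a | a)
    · exact (edist_bridge_inl_inl_le _ _).trans
        ((isPiece_link.edist_le _ _).trans (Nat.cast_le.2 (by omega)))
    · exact (edist_bridge_inl_inr_le (isPiece_link.edist_le 8 4) (hx a)).trans
        (Nat.cast_le.2 (by omega))
  · rintro (a | a)
    · rw [ncard_neighborSet_bridge_inl, isAdjTable_link.ncard_neighborSet]
      simp only [Sum.inl.injEq]
      revert a
      decide +kernel
    · rw [ncard_neighborSet_bridge_inr, hdV]
      split_ifs <;> simp_all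

lemma ExistsBlock.extend_iterate {n e : ℕ} (h : ExistsBlock n e) (k : ℕ) :
    ExistsBlock (n + 10 * k) (e + 5 * k) := by
  induction k with
  | zero => exact h
  | succ k ih => exact ih.extend

lemma IsAdjTable.existsBlock {n e : ℕ} {nb : Fin n → Finset (Fin n)} (h : IsAdjTable nb)
    {f : Fin n → ℕ} (hp : IsPiece (ofTable nb) (fun v => (f v : ℤ)) (e + 3)) (x v : Fin n)
    (hx : f x = 0) (hv : f v = e) (ball : tableBall nb e x = Finset.univ)
    (degree : ∀ v, (nb v).card = if v = x then 2 else 3) : ExistsBlock n e :=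
  ⟨Fin n, inferInstance, inferInstance, ofTable nb, x, _, Fintype.card_fin n, hp, by simp [hx],
    ⟨v, by simp [hv]⟩, fun v => h.edist_le_of_mem_tableBall (by simp [ball]),
    fun v => (h.ncard_neighborSet v).trans (degree v)⟩

lemma existsBlock_eleven : ExistsBlock 11 3 :=
  isAdjTable_eleven.existsBlock isPiece_eleven 10 0 rfl rfl (by decide +kernel) (by decide +kernel)

lemma existsBlock_thirteen : ExistsBlock 13 4 :=
  isAdjTable_thirteen.existsBlock isPiece_thirteen 12 4 rfl rfl (by decide +kernel)
    (by decide +kernel)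

lemma existsBlock_nineteen : ExistsBlock 19 6 :=
  isAdjTable_nineteen.existsBlock isPiece_nineteen 14 0 rfl rfl (by decide +kernel)
    (by decide +kernel)

lemma IsAdjTable.exists_isKGDGraph {n d : ℕ} {nb : Fin n → Finset (Fin n)} (h : IsAdjTable nb)
    {f : Fin n → ℕ} (hp : IsPiece (ofTable nb) (fun v => (f v : ℤ)) d) (x v : Fin n)
    (hx : f x = 0) (hv : f v = d) (degree : ∀ v, (nb v).card = 3) :
    ∃ G : SimpleGraph (Fin n), IsKGDGraph 3 5 d G :=
  ⟨_, hp.isKGDGraph (fun v => (h.ncard_neighborSet v).trans (degree v)) (a := v) (b := x)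
    (by simp [hx, hv])⟩

lemma exists_isKGDGraph_small {d : ℕ} (h2 : 2 ≤ d) (h4 : d ≤ 4) :
    ∃ G : SimpleGraph (Fin (2 * d + 6)), IsKGDGraph 3 5 d G := by
  interval_cases d
  · exact isAdjTable_petersen.exists_isKGDGraph isPiece_petersen 0 4 rfl rfl (by decide +kernel)
  · exact isAdjTable_twelve.exists_isKGDGraph isPiece_twelve 0 10 rfl rfl (by decide +kernel)
  · exact isAdjTable_fourteen.exists_isKGDGraph isPiece_fourteen 2 13 rfl rfl (by decide +kernel)

lemma exists_isKGDGraph_zero_one {d : ℕ} (h5 : 5 ≤ d) (hd : d % 5 = 0 ∨ d % 5 = 1) :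
    ∃ G : SimpleGraph (Fin (2 * d + 10)), IsKGDGraph 3 5 d G := by
  obtain ⟨k, rfl | rfl | rfl | rfl⟩ :
      ∃ k, d = 5 ∨ d = 6 ∨ d = 3 + (6 + 5 * k) + 1 ∨ d = 4 + (6 + 5 * k) + 1 :=
    ⟨d / 5 - 2, by omega⟩
  · exact isAdjTable_twenty.exists_isKGDGraph isPiece_twenty 0 10 rfl rfl (by decide +kernel)
  · exact isAdjTable_twentyTwo.exists_isKGDGraph isPiece_twentyTwo 0 12 rfl rfl
      (by decide +kernel)
  · rw [show 2 * (3 + (6 + 5 * k) + 1) + 10 = 11 + (19 + 10 * k) by ring]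
    exact existsBlock_eleven.join (existsBlock_nineteen.extend_iterate k) (by omega) (by omega)
  · rw [show 2 * (4 + (6 + 5 * k) + 1) + 10 = 13 + (19 + 10 * k) by ring]
    exact existsBlock_thirteen.join (existsBlock_nineteen.extend_iterate k) (by omega) (by omega)

lemma exists_isKGDGraph_two_three_four {d : ℕ} (h5 : 5 ≤ d)
    (hd : d % 5 = 2 ∨ d % 5 = 3 ∨ d % 5 = 4) :
    ∃ G : SimpleGraph (Fin (2 * d + 8)), IsKGDGraph 3 5 d G := by
  obtain ⟨k, rfl | rfl | rfl⟩ :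
      ∃ k, d = 3 + (3 + 5 * k) + 1 ∨ d = 4 + (3 + 5 * k) + 1 ∨ d = 4 + (4 + 5 * k) + 1 :=
    ⟨d / 5 - 1, by omega⟩
  · rw [show 2 * (3 + (3 + 5 * k) + 1) + 8 = 11 + (11 + 10 * k) by ring]
    exact existsBlock_eleven.join (existsBlock_eleven.extend_iterate k) (by omega) (by omega)
  · rw [show 2 * (4 + (3 + 5 * k) + 1) + 8 = 13 + (11 + 10 * k) by ring]
    exact existsBlock_thirteen.join (existsBlock_eleven.extend_iterate k) (by omega) (by omega)
  · rw [show 2 * (4 + (4 + 5 * k) + 1) + 8 = 13 + (13 + 10 * k) by ring]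
    exact existsBlock_thirteen.join (existsBlock_thirteen.extend_iterate k) (by omega) (by omega)

end Explicit

open Classical in
lemma IsKGDGraph.card_lower_bound {n d : ℕ} {G : SimpleGraph (Fin n)} (h : IsKGDGraph 3 5 d G)
    (hd : 2 ≤ d) :
    (5 ≤ d → d % 5 = 0 ∨ d % 5 = 1 → 2 * d + 10 ≤ n) ∧
    (5 ≤ d → d % 5 = 2 ∨ d % 5 = 3 ∨ d % 5 = 4 → 2 * d + 8 ≤ n) ∧
    (2 ≤ d → d ≤ 4 → 2 * d + 6 ≤ n) := by
  have : Nontrivial (Fin n) := nontrivial_of_ediam_ne_zero (G := G) (by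
    rw [h.2.2]
    exact_mod_cast (by omega : d ≠ 0))
  simpa using _root_.card_lower_bound h.1 (noShortCycle_iff_five_le_egirth.2 h.2.1.ge) h.2.2

lemma minOrderKGD_eq {k g d n : ℕ} (h : ∃ G : SimpleGraph (Fin n), IsKGDGraph k g d G)
    (hn : ∀ m, ∀ G : SimpleGraph (Fin m), IsKGDGraph k g d G → n ≤ m) :
    minOrderKGD k g d = n :=
  le_antisymm (Nat.sInf_le h) (le_csInf ⟨n, h⟩ fun m ⟨G, hG⟩ => hn m G hG)

theorem minOrder_three_five :
    (∀ d : ℕ, 5 ≤ d → d % 5 = 0 ∨ d % 5 = 1 → minOrderKGD 3 5 d = 2 * d + 10) ∧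
    (∀ d : ℕ, 5 ≤ d → d % 5 = 2 ∨ d % 5 = 3 ∨ d % 5 = 4 → minOrderKGD 3 5 d = 2 * d + 8) ∧
    (∀ d : ℕ, 2 ≤ d → d ≤ 4 → minOrderKGD 3 5 d = 2 * d + 6) := by
  refine ⟨fun d h hd => ?_, fun d h hd => ?_, fun d h hd => ?_⟩
  · exact minOrderKGD_eq (exists_isKGDGraph_zero_one h hd)
      fun m G hG => (hG.card_lower_bound (by omega)).1 h hd
  · exact minOrderKGD_eq (exists_isKGDGraph_two_three_four h hd)
      fun m G hG => (hG.card_lower_bound (by omega)).2.1 h hd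
  · exact minOrderKGD_eq (exists_isKGDGraph_small h hd)
      fun m G hG => (hG.card_lower_bound h).2.2 h hd
end

section
/- For every integer k ≥ 3, n(k;3,3) = 2(k+1); that is, there exists a finite k-regular simple graph with girth exactly 3 and diameter exactly 3 on 2(k+1) vertices, and every finite k-regular simple graph with girth exactly 3 and diameter exactly 3 has at least 2(k+1) vertices. -/
namespace SimpleGraph

variable {V W : Type*} {G : SimpleGraph V} {H : SimpleGraph W}

lemma Hom.edist_le (f : G →g H) (u v : V) : H.edist (f u) (f v) ≤ G.edist u v := by
  refine le_iInf fun p => ?_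
  simpa using (p.map f).edist_le

lemma Iso.edist_eq_s17 (f : G ≃g H) (u v : V) : H.edist (f u) (f v) = G.edist u v := by
  refine le_antisymm (f.toHom.edist_le u v) ?_
  simpa using f.symm.toHom.edist_le (f u) (f v)

lemma Iso.ediam_eq_s17 (f : G ≃g H) : H.ediam = G.ediam := by
  simp_rw [ediam_eq_iSup_iSup_edist, ← f.surjective.iSup_comp, f.edist_eq_s17]

lemma Iso.ncard_neighborSet (f : G ≃g H) (v : V) :
    (H.neighborSet (f v)).ncard = (G.neighborSet v).ncard :=
  (Nat.card_congr (f.mapNeighborSet v)).symm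

lemma _root_.IsKGDGraph.of_iso {k g d : ℕ} (h : IsKGDGraph k g d G) (f : G ≃g H) :
    IsKGDGraph k g d H := by
  refine ⟨fun w => ?_, f.egirth_eq ▸ h.2.1, f.ediam_eq_s17 ▸ h.2.2⟩
  obtain ⟨v, rfl⟩ := f.surjective w
  exact (f.ncard_neighborSet v).trans (h.1 v)

lemma egirth_eq_three_of_adj {x y z : V} (hxy : G.Adj x y) (hyz : G.Adj y z) (hzx : G.Adj z x) :
    G.egirth = 3 := by
  classical
  refine le_antisymm ?_ three_le_egirth
  obtain ⟨u, w, hw, hlen⟩ := is3Clique_iff_exists_cycle_length_three.mp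
    ⟨_, is3Clique_triple_iff.mpr ⟨hxy, hzx.symm, hyz⟩⟩
  simpa [hlen] using egirth_le_length hw

/-- In a `k`-regular graph two vertices at distance more than two have disjoint closed
neighbourhoods, each with `k + 1` elements. -/
lemma two_mul_succ_le_card_of_two_lt_edist [Fintype V] {k : ℕ} (hG : IsRegular' k G) {u v : V}
    (h : 2 < G.edist u v) : 2 * (k + 1) ≤ Fintype.card V := by
  obtain ⟨hne, hadj, hcommon⟩ := two_lt_edist_iff.mp h
  have hball (x : V) : (insert x (G.neighborSet x)).ncard = k + 1 := by
    rw [Set.ncard_insert_of_notMem (by simp), hG]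
  have hdisj : Disjoint (insert u (G.neighborSet u)) (insert v (G.neighborSet v)) := by
    rw [commonNeighbors, ← Set.disjoint_iff_inter_eq_empty] at hcommon
    simp [hne.symm, hadj, hcommon, G.adj_comm v u]
  calc
    2 * (k + 1) = (insert u (G.neighborSet u) ∪ insert v (G.neighborSet v)).ncard := by
      rw [Set.ncard_union_eq hdisj, hball, hball, two_mul]
    _ ≤ Fintype.card V := by
      rw [← Nat.card_eq_fintype_card]
      exact Set.ncard_le_card _

/-- Two disjoint complete graphs on `α`, where the two copies of the edge `ab` are replaced by
edges joining the two copies of `a` and the two copies of `b`. -/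
def switchedCliques {α : Type*} (a b : α) : SimpleGraph (Bool × α) where
  Adj x y :=
    (x.1 = y.1 ∧ x.2 ≠ y.2 ∧ s(x.2, y.2) ≠ s(a, b)) ∨
      (x.1 ≠ y.1 ∧ x.2 = y.2 ∧ (x.2 = a ∨ x.2 = b))
  symm := ⟨fun x y h => by
    rw [Sym2.eq_swap]
    rcases h with ⟨h₁, h₂, h₃⟩ | ⟨h₁, h₂, h₃⟩
    · exact .inl ⟨h₁.symm, h₂.symm, h₃⟩
    · exact .inr ⟨h₁.symm, h₂.symm, h₂ ▸ h₃⟩⟩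
  loopless := ⟨fun x h => by simp at h⟩

section switchedCliques

variable {α : Type*} {a b c d : α}

lemma isRegular'_switchedCliques [Fintype α] (hab : a ≠ b) {k : ℕ}
    (hα : Fintype.card α = k + 1) : IsRegular' k (switchedCliques a b) := by
  classical
  rintro ⟨s, i⟩
  let f (j : α) : Bool × α := if s(i, j) = s(a, b) then (!s, i) else (s, j)
  have hf : f.Injective := by
    intro j l h
    simp only [f] at h
    grind
  have himage : (switchedCliques a b).neighborSet (s, i) = f '' {i}ᶜ := by
    ext ⟨t, j⟩
    simp only [mem_neighborSet, switchedCliques, Set.mem_image, Set.mem_compl_singleton_iff, f]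
    constructor
    · rintro (⟨h₁, h₂, h₃⟩ | ⟨h₁, h₂, rfl | rfl⟩)
      · exact ⟨j, by grind⟩
      · exact ⟨b, by have := Bool.eq_not.mpr h₁.symm; grind⟩
      · exact ⟨a, by have := Bool.eq_not.mpr h₁.symm; grind⟩
    · rintro ⟨l, h, h'⟩
      grind
  rw [himage, Set.ncard_image_of_injective _ hf, Set.ncard_compl, Set.ncard_singleton,
    Nat.card_eq_fintype_card, hα, Nat.add_sub_cancel]

lemma egirth_switchedCliques (hac : a ≠ c) (had : a ≠ d) (hbc : b ≠ c) (hbd : b ≠ d)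
    (hcd : c ≠ d) : (switchedCliques a b).egirth = 3 := by
  apply egirth_eq_three_of_adj (x := (false, a)) (y := (false, c)) (z := (false, d)) <;>
    simp [switchedCliques] <;> grind

lemma ediam_switchedCliques (hab : a ≠ b) (hac : a ≠ c) (hbc : b ≠ c) :
    (switchedCliques a b).ediam = 3 := by
  apply le_antisymm
  · refine ediam_le_of_edist_le fun x y => ?_
    obtain ⟨p, q, hxp, hpq, hqy⟩ : ∃ p q,
        ((switchedCliques a b).Adj x p ∨ x = p) ∧ ((switchedCliques a b).Adj p q ∨ p = q) ∧
          ((switchedCliques a b).Adj q y ∨ q = y) := by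
      obtain ⟨s, i⟩ := x
      obtain ⟨t, j⟩ := y
      simp only [switchedCliques]
      by_cases hst : s = t
      · by_cases hij : s(i, j) = s(a, b)
        · exact ⟨(s, c), (s, c), by grind⟩
        · exact ⟨(s, j), (s, j), by grind⟩
      · by_cases hi : i = a ∨ i = b
        · by_cases hij : s(i, j) = s(a, b)
          · exact ⟨(t, i), (t, c), by grind⟩
          · exact ⟨(t, i), (t, i), by grind⟩
        · by_cases hj : j = b
          · exact ⟨(s, b), (t, b), by grind⟩
          · exact ⟨(s, a), (t, a), by grind⟩
    rw [← edist_le_one_iff_adj_or_eq] at hxp hpq hqy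
    calc
      (switchedCliques a b).edist x y ≤ _ + ((switchedCliques a b).edist p q + _) :=
        SimpleGraph.edist_triangle.trans (add_le_add_right SimpleGraph.edist_triangle _)
      _ ≤ 1 + (1 + 1) := by gcongr
      _ = 3 := by norm_num
  · have h : 2 < (switchedCliques a b).edist (false, c) (true, c) := by
      refine two_lt_edist_iff.mpr ⟨by simp, by simp [switchedCliques]; grind, ?_⟩
      ext ⟨s, i⟩
      simp only [mem_commonNeighbors, switchedCliques, Set.mem_empty_iff_false]
      grind
    exact (Order.add_one_le_of_lt h).trans edist_le_ediam

end switchedCliques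

end SimpleGraph

theorem minOrder_k_three_three (k : ℕ) (hk : 3 ≤ k) :
    (∃ G : SimpleGraph (Fin (2 * (k + 1))), IsKGDGraph k 3 3 G) ∧
    ∀ {V : Type} [Fintype V] (G : SimpleGraph V), IsKGDGraph k 3 3 G →
      2 * (k + 1) ≤ Fintype.card V := by
  refine ⟨?_, fun {V} _ G hG => ?_⟩
  · let v (i : ℕ) (hi : i ≤ 3 := by norm_num) : Fin (k + 1) := ⟨i, by omega⟩
    have hcard : Fintype.card (Bool × Fin (k + 1)) = 2 * (k + 1) := by simp
    have hG : IsKGDGraph k 3 3 (SimpleGraph.switchedCliques (v 0) (v 1)) :=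
      ⟨SimpleGraph.isRegular'_switchedCliques (by simp [v]) (by simp),
        SimpleGraph.egirth_switchedCliques (c := v 2) (d := v 3) (by simp [v]) (by simp [v])
          (by simp [v]) (by simp [v]) (by simp [v]),
        SimpleGraph.ediam_switchedCliques (c := v 2) (by simp [v]) (by simp [v]) (by simp [v])⟩
    exact ⟨_, hG.of_iso (SimpleGraph.Iso.map (Fintype.equivFinOfCardEq hcard) _)⟩
  · have : Nonempty V := not_isEmpty_iff.mp fun _ => by
      have := hG.2.2
      simp [SimpleGraph.ediam_eq_zero_of_subsingleton] at this
    obtain ⟨u, v, huv⟩ := G.exists_edist_eq_ediam_of_finite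
    refine SimpleGraph.two_mul_succ_le_card_of_two_lt_edist hG.1 (u := u) (v := v) ?_
    rw [huv, hG.2.2]
    norm_num
end
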